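/- Let X be S^d, ℝ^d or H^d with d ≥ 2, let K, L ⊊ X be proper closed convex sets with interior points satisfying condition (**); for X = ℝ^d assume one of K, L has an extreme point, and for X = H^d assume additionally condition (***). Suppose that for each pair of orientation-preserving congruences φ, ψ with int((φK) ∩ (ψL)) ≠ ∅ and each x ∈ bd K, y ∈ bd L there exists ε = ε(K,L,x,y) > 0 such that whenever (A) diam((φK) ∩ (ψL)) < ε, (B) (φK) ∩ (ψL) has a unique inball B₀, and (C) bd((φK) ∩ (ψL)) ∩ bd B₀ = {φx, ψy} with φx ∈ int(ψL) and ψy ∈ int(φK) antipodal on bd B₀, the set (φK) ∩ (ψL) is symmetric with respect to the orthogonal bisector hyperplane of [φx, ψy]. Then the connected components of the boundaries of both K and L are congruent spheres (for S^d of radius at most π/2), or paraspheres, or congruent hyperspheres (degeneration to hyperplanes not admitted); and in the case of congruent spheres or paraspheres, either K and L are congruent balls (for S^d of radius at most π/2) or they are paraballs. -/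

import Mathlib

open Metric Set Filter

namespace BallChar

/-- `X` is (isometric to) the `d`-dimensional round sphere of radius 1,
with the intrinsic (great-circle) metric. -/
def IsSphereSpace (X : Type*) [MetricSpace X] (d : ℕ) : Prop :=
  ∃ e : X → EuclideanSpace ℝ (Fin (d + 1)),
    Function.Injective e ∧
    Set.range e = Metric.sphere (0 : EuclideanSpace ℝ (Fin (d + 1))) 1 ∧
    ∀ x y : X, dist x y = Real.arccos (@inner ℝ _ _ (e x) (e y))

/-- `X` is (isometric to) the `d`-dimensional Euclidean space. -/
def IsEuclideanSpaceForm (X : Type*) [MetricSpace X] (d : ℕ) : Prop :=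
  Nonempty (X ≃ᵢ EuclideanSpace ℝ (Fin d))

/-- The Minkowski bilinear form on `ℝ^d × ℝ`. -/
noncomputable def mink (d : ℕ) (u v : EuclideanSpace ℝ (Fin d) × ℝ) : ℝ :=
  @inner ℝ _ _ u.1 v.1 - u.2 * v.2

/-- `X` is (isometric to) the `d`-dimensional hyperbolic space of curvature `-1`
(the hyperboloid model). -/
def IsHyperbolicSpace (X : Type*) [MetricSpace X] (d : ℕ) : Prop :=
  ∃ e : X → EuclideanSpace ℝ (Fin d) × ℝ,
    Function.Injective e ∧
    Set.range e = {u | mink d u u = -1 ∧ 0 < u.2} ∧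
    ∀ x y : X, Real.cosh (dist x y) = - mink d (e x) (e y)

/-- `X` is `S^d`, `ℝ^d` or `H^d`. -/
def IsSpaceForm (X : Type*) [MetricSpace X] (d : ℕ) : Prop :=
  IsSphereSpace X d ∨ IsEuclideanSpaceForm X d ∨ IsHyperbolicSpace X d

variable {X : Type*} [MetricSpace X]

/-- Metric betweenness: `z` lies on a shortest geodesic from `x` to `y`. -/
def Btw (x z y : X) : Prop := dist x z + dist z y = dist x y

/-- `z` is the unique point between `x` and `y` at its distance from `x`. -/
def UniqueBtwPt (x z y : X) : Prop :=
  Btw x z y ∧ ∀ w, Btw x w y → dist x w = dist x z → w = z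

/-- Geodesic convexity (for two antipodal points of a sphere no condition is imposed). -/
def GConvex (K : Set X) : Prop :=
  ∀ x ∈ K, ∀ y ∈ K, ∀ z, UniqueBtwPt x z y → z ∈ K

/-- `p` is a (metric) midpoint of `x` and `y`. -/
def IsMidpoint (p x y : X) : Prop := Btw x p y ∧ dist x p = dist p y

/-- A reflection in a hyperplane: a non-trivial involutive isometry whose
non-fixed locus is disconnected (by the mirror hyperplane). -/
def IsReflection (σ : X ≃ᵢ X) : Prop :=
  σ.trans σ = IsometryEquiv.refl X ∧ σ ≠ IsometryEquiv.refl X ∧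
    ¬ IsPreconnected {x : X | σ x ≠ x}

/-- An orientation preserving congruence: a product of an even number of reflections. -/
def OrientationPreserving (f : X ≃ᵢ X) : Prop :=
  ∃ l : List (X ≃ᵢ X), (∀ σ ∈ l, IsReflection σ) ∧ Even l.length ∧
    f = l.foldr IsometryEquiv.trans (IsometryEquiv.refl X)

/-- Two subsets are congruent if some isometry of the space maps one onto the other. -/
def Congruent (A B : Set X) : Prop := ∃ f : X ≃ᵢ X, ⇑f '' A = B

/-- `S` admits some non-trivial congruence. -/
def AdmitsNontrivialCongruence (S : Set X) : Prop :=
  ∃ f : X ≃ᵢ X, f ≠ IsometryEquiv.refl X ∧ ⇑f '' S = S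

/-- `S` is axially symmetric (symmetric with respect to some reflection). -/
def AxiallySymmetric (S : Set X) : Prop :=
  ∃ σ : X ≃ᵢ X, IsReflection σ ∧ ⇑σ '' S = S

/-- `S` is centrally symmetric: some involutive isometry fixing a point `p`
maps `S` onto itself, `p` being a midpoint of every pair `x`, `σ x` of `S`. -/
def CentrallySymmetric (S : Set X) : Prop :=
  ∃ (σ : X ≃ᵢ X) (p : X), Function.Involutive ⇑σ ∧ σ p = p ∧ ⇑σ '' S = S ∧
    ∀ x ∈ S, IsMidpoint p x (σ x)

/-- `S` is symmetric with respect to the orthogonal bisector hyperplane of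
the segment `[a, b]`, i.e. invariant under the reflection interchanging `a` and `b`. -/
def SymmetricWrtPerpBisector (S : Set X) (a b : X) : Prop :=
  ∃ σ : X ≃ᵢ X, IsReflection σ ∧ σ a = b ∧ ⇑σ '' S = S

/-- A closed half-space: one of the two closed sides of the mirror of a reflection. -/
def IsHalfspace (P : Set X) : Prop :=
  ∃ σ : X ≃ᵢ X, IsReflection σ ∧ IsClosed P ∧
    P ∪ ⇑σ '' P = univ ∧ P ∩ ⇑σ '' P = {x | σ x = x}

/-- A hyperplane: the mirror (fixed point set) of a reflection. -/
def IsHyperplane (B : Set X) : Prop :=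
  ∃ σ : X ≃ᵢ X, IsReflection σ ∧ B = {x | σ x = x}

/-- A paraball (horoball): a sublevel set of a Busemann function. -/
def IsParaball (K : Set X) : Prop :=
  ∃ γ : ℝ → X, Isometry γ ∧
    K = {x | ∃ b ≤ 0, Tendsto (fun t => dist x (γ t) - t) atTop (nhds b)}

/-- A parasphere (horosphere): the boundary of a paraball. -/
def IsParasphere (C : Set X) : Prop := ∃ K : Set X, IsParaball K ∧ C = frontier K

/-- A hypersphere at distance `lam > 0` from its base hyperplane
(degeneration to a hyperplane excluded). -/
def IsHypersphere (C : Set X) (lam : ℝ) : Prop :=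
  0 < lam ∧ (∃ P : Set X, IsHalfspace P ∧ C = frontier {x | infDist x P ≤ lam}) ∧
    ¬ IsHyperplane C

/-- The family of connected components of the boundary of `K`. -/
def bdryComponents (K : Set X) : Set (Set X) :=
  (connectedComponentIn (frontier K)) '' (frontier K)

/-- `closedBall p r` is an inball of `M` (a ball of maximal radius contained in `M`). -/
def IsInball (M : Set X) (p : X) (r : ℝ) : Prop :=
  0 ≤ r ∧ closedBall p r ⊆ M ∧ ∀ (q : X) (s : ℝ), closedBall q s ⊆ M → s ≤ r

/-- `closedBall p r` is the unique inball of `M`. -/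
def HasUniqueInball (M : Set X) (p : X) (r : ℝ) : Prop :=
  IsInball M p r ∧ ∀ (q : X) (s : ℝ), IsInball M q s → q = p

/-- The (geodesic) convex hull of a set. -/
def gconvexHull (Y : Set X) : Set X := ⋂₀ {C : Set X | GConvex C ∧ Y ⊆ C}

/-- `z` lies on the complete geodesic line through `a` and `b`. -/
def OnLine (a b z : X) : Prop := Btw a z b ∨ Btw z a b ∨ Btw a b z

/-- The closed `(d-1)`-ball of radius `ε` centred at `a` in the hyperplane through `a`
orthogonal to the segment `[a, b]`. -/
def perpDisc (a b : X) (ε : ℝ) : Set X :=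
  {x | (∀ z, OnLine a b z → dist x a ≤ dist x z) ∧ dist x a ≤ ε}

/-- The set `D(ε)` associated to the segment `D = [a, b]`: the convex hull of the two
`(d-1)`-balls of radius `ε` orthogonal to `D` at its endpoints. -/
def segCyl (a b : X) (ε : ℝ) : Set X :=
  gconvexHull (perpDisc a b ε ∪ perpDisc b a ε)

/-- `[a, b]` is the unique diametral segment of `M`. -/
def UniqueDiametral (M : Set X) (a b : X) : Prop :=
  a ∈ M ∧ b ∈ M ∧ a ≠ b ∧ dist a b = diam M ∧
    ∀ a' ∈ M, ∀ b' ∈ M, dist a' b' = diam M → (a' = a ∧ b' = b) ∨ (a' = b ∧ b' = a)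

/-- Condition (**): at every boundary point, `K` contains a ball having this point
on its boundary. -/
def CondBallInside (K : Set X) : Prop :=
  ∀ x ∈ frontier K, ∃ ε > 0, ∃ p : X, closedBall p ε ⊆ K ∧ x ∈ sphere p ε

/-- `K` has an extreme point. -/
def HasExtremePoint (K : Set X) : Prop :=
  ∃ x ∈ K, ∀ y ∈ K, ∀ z ∈ K, Btw y x z → x = y ∨ x = z

/-- Condition (***): near every boundary point, `K` is contained in a ball
(resp. in a convex set bounded by a hypersphere, for hyperbolic space) whose boundary
has sectional curvatures bounded below and passes through the given point. -/
def CondCurvBound (d : ℕ) (K : Set X) : Prop :=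
  ∀ x ∈ frontier K, ∃ ε > 0, ∃ B : Set X,
    {y | y ∈ K ∧ dist y x ≤ ε} ⊆ B ∧ x ∈ frontier B ∧
    (IsSphereSpace X d → ∃ (q : X) (R : ℝ), 0 < R ∧ R < Real.pi / 2 ∧
        ε ≤ Real.cos R / Real.sin R ∧ B = closedBall q R) ∧
    (IsEuclideanSpaceForm X d → ∃ (q : X) (R : ℝ), 0 < R ∧ ε ≤ 1 / R ∧ B = closedBall q R) ∧
    (IsHyperbolicSpace X d → ∃ (P : Set X) (lam : ℝ), IsHalfspace P ∧ 0 < lam ∧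
        ε ≤ Real.tanh lam ∧ B = {y | infDist y P ≤ lam})

/-- `K` has a supporting sphere at each of its boundary points
(for the sphere, of radius less than `π/2`). -/
def SupportingSpheres (d : ℕ) (K : Set X) : Prop :=
  ∀ x ∈ frontier K, ∃ (p : X) (R : ℝ), 0 < R ∧ K ⊆ closedBall p R ∧ x ∈ sphere p R ∧
    (IsSphereSpace X d → R < Real.pi / 2)

/-- `K` is `C¹` (smooth): at each boundary point there is a unique supporting half-space. -/
def SmoothBody (K : Set X) : Prop :=
  ∀ x ∈ frontier K, ∃! P : Set X, IsHalfspace P ∧ K ⊆ P ∧ x ∈ frontier P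

/-- A complete geodesic (straight line). -/
def IsGeodesicLine (B : Set X) : Prop := ∃ γ : ℝ → X, Isometry γ ∧ B = Set.range γ

/-- A circle (closed disc) of positive radius. -/
def IsDisc (K : Set X) : Prop := ∃ (p : X) (r : ℝ), 0 < r ∧ K = closedBall p r

/-- The parallel domain of `B` at distance `l`. -/
def parallelDomain (B : Set X) (l : ℝ) : Set X := {x | infDist x B ≤ l}

/-- `K` is the parallel domain of some straight line, at some distance `l > 0`. -/
def IsParallelDomain (K : Set X) : Prop :=
  ∃ (B : Set X) (l : ℝ), IsGeodesicLine B ∧ 0 < l ∧ K = parallelDomain B l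

/-- A convex domain bounded by a (proper) hypercycle. -/
def IsHypercycleDomain (K : Set X) : Prop :=
  ∃ (P : Set X) (l : ℝ), IsHalfspace P ∧ 0 < l ∧ K = {x | infDist x P ≤ l}

/-- `C` is a hypercycle or a straight line (a curve at constant distance `l ≥ 0`
from its base line). -/
def IsHypercycleOrLine (C : Set X) : Prop :=
  ∃ (P : Set X) (l : ℝ), IsHalfspace P ∧ 0 ≤ l ∧ C = frontier {x | infDist x P ≤ l}

/-- `C` is a hypercycle (or straight line) with base line `B`. -/
def HypercycleWithBase (C B : Set X) : Prop :=
  ∃ (P : Set X) (l : ℝ), IsHalfspace P ∧ 0 ≤ l ∧ frontier P = B ∧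
    C = frontier {x | infDist x P ≤ l}


/-! Cases (A)-(E) of Theorem 5 (hyperbolic plane). -/

/-- One of the basic bodies of case (A). -/
def CaseABody (K : Set X) : Prop :=
  IsDisc K ∨ IsParaball K ∨ IsHypercycleDomain K ∨ IsHalfspace K

/-- Case (A) of Theorem 5. -/
def CaseA (K L : Set X) : Prop :=
  CaseABody K ∧ CaseABody L ∧
    ((IsHypercycleDomain K ∨ IsHalfspace K) → IsDisc L ∨ Congruent K L) ∧
    ((IsHypercycleDomain L ∨ IsHalfspace L) → IsDisc K ∨ Congruent L K)

/-- `M` is bounded either by two hypercycles whose base lines coincide, or by a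
hypercycle and its base line. -/
def TwoHypSameBase (M : Set X) : Prop :=
  ∃ (B C₁ C₂ : Set X), IsGeodesicLine B ∧ C₁ ≠ C₂ ∧
    HypercycleWithBase C₁ B ∧ HypercycleWithBase C₂ B ∧ frontier M = C₁ ∪ C₂

/-- Case (B) of Theorem 5. -/
def CaseB (K L : Set X) : Prop :=
  (IsDisc K ∧ TwoHypSameBase L) ∨ (IsDisc L ∧ TwoHypSameBase K)

/-- `M` is bounded by at least two hypercycles or straight lines, with all base lines
different, whose mutual distances are at least `2r`. -/
def MultiHypFarApart (M : Set X) (r : ℝ) : Prop :=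
  (∀ x ∈ frontier M, IsHypercycleOrLine (connectedComponentIn (frontier M) x)) ∧
  (∃ x ∈ frontier M, ∃ y ∈ frontier M,
      connectedComponentIn (frontier M) x ≠ connectedComponentIn (frontier M) y) ∧
  (∀ x ∈ frontier M, ∀ y ∈ frontier M,
      connectedComponentIn (frontier M) x ≠ connectedComponentIn (frontier M) y →
        2 * r ≤ dist x y ∧
        ∀ B₁ B₂ : Set X, HypercycleWithBase (connectedComponentIn (frontier M) x) B₁ →
          HypercycleWithBase (connectedComponentIn (frontier M) y) B₂ → B₁ ≠ B₂)

/-- Case (C) of Theorem 5. -/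
def CaseC (K L : Set X) : Prop :=
  (∃ (p : X) (r : ℝ), 0 < r ∧ K = closedBall p r ∧ MultiHypFarApart L r) ∨
  (∃ (p : X) (r : ℝ), 0 < r ∧ L = closedBall p r ∧ MultiHypFarApart K r)

/-- Case (D) of Theorem 5. -/
def CaseD (K L : Set X) : Prop :=
  (IsParaball K ∧ IsParallelDomain L) ∨ (IsParaball L ∧ IsParallelDomain K)

/-- Case (E) of Theorem 5. -/
def CaseE (K L : Set X) : Prop :=
  Congruent K L ∧ IsParallelDomain K ∧ IsParallelDomain L

/-- All cases of (3) of Theorem 5 together. -/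
def Theorem5Cases (K L : Set X) : Prop :=
  CaseA K L ∨ CaseB K L ∨ CaseC K L ∨ CaseD K L ∨ CaseE K L

/-- Condition (1) of Theorem 5: every intersection of congruent copies admits some
non-trivial congruence. -/
def T5Cond1 (K L : Set X) : Prop :=
  ∀ φ ψ : X ≃ᵢ X, OrientationPreserving φ → OrientationPreserving ψ →
    (interior ((⇑φ '' K) ∩ (⇑ψ '' L))).Nonempty →
    AdmitsNontrivialCongruence ((⇑φ '' K) ∩ (⇑ψ '' L))

/-- Condition (2) of Theorem 5: every intersection of congruent copies is axially
symmetric. -/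
def T5Cond2 (K L : Set X) : Prop :=
  ∀ φ ψ : X ≃ᵢ X, OrientationPreserving φ → OrientationPreserving ψ →
    (interior ((⇑φ '' K) ∩ (⇑ψ '' L))).Nonempty →
    AxiallySymmetric ((⇑φ '' K) ∩ (⇑ψ '' L))

/-- All connected components of the boundary of `K` are hypercycles or straight lines. -/
def BdryHypOrLine (K : Set X) : Prop :=
  ∀ x ∈ frontier K, IsHypercycleOrLine (connectedComponentIn (frontier K) x)

/-- The boundary of `K` has at least two connected components. -/
def AtLeastTwoComponents (K : Set X) : Prop :=
  ∃ x ∈ frontier K, ∃ y ∈ frontier K,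
    connectedComponentIn (frontier K) x ≠ connectedComponentIn (frontier K) y

/-- The boundary of `K` is nonempty and has a single connected component. -/
def SingleComponent (K : Set X) : Prop :=
  (frontier K).Nonempty ∧ ∀ x ∈ frontier K, ∀ y ∈ frontier K,
    connectedComponentIn (frontier K) x = connectedComponentIn (frontier K) y

/-- The associated graph of `K` contains two edges with at least one common endpoint:
`K` has two distinct boundary components which are asymptotic (come arbitrarily close). -/
def TwoAsymptoticComponents (K : Set X) : Prop :=
  ∃ x ∈ frontier K, ∃ y ∈ frontier K,
    connectedComponentIn (frontier K) x ≠ connectedComponentIn (frontier K) y ∧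
    ∀ δ > (0 : ℝ), ∃ p ∈ connectedComponentIn (frontier K) x,
      ∃ q ∈ connectedComponentIn (frontier K) y, dist p q < δ

/-- The associated graph of `K` has only pairwise vertex-disjoint edges: distinct
boundary components of `K` stay at positive distance from each other. -/
def VertexDisjointEdges (K : Set X) : Prop :=
  ∀ x ∈ frontier K, ∀ y ∈ frontier K,
    connectedComponentIn (frontier K) x ≠ connectedComponentIn (frontier K) y →
      ∃ δ > (0 : ℝ), ∀ p ∈ connectedComponentIn (frontier K) x,
        ∀ q ∈ connectedComponentIn (frontier K) y, δ ≤ dist p q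

/-! Conditions of Theorem 6. -/

/-- Condition (1) of Theorem 6. -/
def T6Cond1 (K L : Set X) : Prop :=
  ∃ ε > (0 : ℝ), ∀ φ ψ : X ≃ᵢ X, OrientationPreserving φ → OrientationPreserving ψ →
    (interior ((⇑φ '' K) ∩ (⇑ψ '' L))).Nonempty →
    diam ((⇑φ '' K) ∩ (⇑ψ '' L)) < ε →
    CentrallySymmetric ((⇑φ '' K) ∩ (⇑ψ '' L))

/-- Condition (2) of Theorem 6. -/
def T6Cond2 (K L : Set X) : Prop :=
  ∀ x ∈ frontier K, ∀ y ∈ frontier L, ∃ ε > (0 : ℝ),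
    ∀ φ ψ : X ≃ᵢ X, OrientationPreserving φ → OrientationPreserving ψ →
      (interior ((⇑φ '' K) ∩ (⇑ψ '' L))).Nonempty →
      diam ((⇑φ '' K) ∩ (⇑ψ '' L)) < ε →
      ∀ (p : X) (r : ℝ), HasUniqueInball ((⇑φ '' K) ∩ (⇑ψ '' L)) p r →
        frontier ((⇑φ '' K) ∩ (⇑ψ '' L)) ∩ sphere p r = {φ x, ψ y} →
        φ x ∈ interior (⇑ψ '' L) → ψ y ∈ interior (⇑φ '' K) →
        IsMidpoint p (φ x) (ψ y) →
        CentrallySymmetric ((⇑φ '' K) ∩ (⇑ψ '' L))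

/-- Condition (3) of Theorem 6. -/
def T6Cond3 (K L : Set X) : Prop :=
  ∀ x ∈ frontier K, ∀ y ∈ frontier L, ∃ ε > (0 : ℝ),
    ∀ φ ψ : X ≃ᵢ X, OrientationPreserving φ → OrientationPreserving ψ →
      (interior ((⇑φ '' K) ∩ (⇑ψ '' L))).Nonempty →
      diam ((⇑φ '' K) ∩ (⇑ψ '' L)) < ε →
      ∀ (p : X) (r : ℝ), HasUniqueInball ((⇑φ '' K) ∩ (⇑ψ '' L)) p r →
        frontier ((⇑φ '' K) ∩ (⇑ψ '' L)) ∩ sphere p r = {φ x, ψ y} →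
        φ x ∈ interior (⇑ψ '' L) → ψ y ∈ interior (⇑φ '' K) →
        IsMidpoint p (φ x) (ψ y) →
        SymmetricWrtPerpBisector ((⇑φ '' K) ∩ (⇑ψ '' L)) (φ x) (ψ y)

/-- Condition (4) of Theorem 6. -/
def T6Cond4 (d : ℕ) (K L : Set X) : Prop :=
  (∃ r > (0 : ℝ), (IsSphereSpace X d → r ≤ Real.pi / 2) ∧
      (∀ C ∈ bdryComponents K ∪ bdryComponents L, ∃ p : X, C = sphere p r) ∧
      (∃ p : X, K = closedBall p r) ∧ ∃ q : X, L = closedBall q r) ∨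
  ((∀ C ∈ bdryComponents K ∪ bdryComponents L, IsParasphere C) ∧
      IsParaball K ∧ IsParaball L) ∨
  (∃ lam > (0 : ℝ), ∀ C ∈ bdryComponents K ∪ bdryComponents L, IsHypersphere C lam)

/-! Conditions of Theorems 7 and 8. -/

/-- The pair `φ, ψ` is admissible for hypothesis (****): both are orientation
preserving, and for the sphere `(φ K) ∪ (ψ L)` lies in an open hemisphere. -/
def GoodPair (d : ℕ) (K L : Set X) (φ ψ : X ≃ᵢ X) : Prop :=
  OrientationPreserving φ ∧ OrientationPreserving ψ ∧
    (IsSphereSpace X d → ∃ s : X, (⇑φ '' K) ∪ (⇑ψ '' L) ⊆ ball s (Real.pi / 2))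

/-- The convex hull of the union of the two congruent copies. -/
def hullUnion (K L : Set X) (φ ψ : X ≃ᵢ X) : Set X := gconvexHull ((⇑φ '' K) ∪ (⇑ψ '' L))

/-- Condition (A) of (3) of Theorem 7: the diameter of `M` is sufficiently close to `π`
(sphere), resp. sufficiently large (Euclidean, hyperbolic), as measured by `δ`. -/
def BigDiam (d : ℕ) (X : Type*) [MetricSpace X] (M : Set X) (δ : ℝ) : Prop :=
  (IsSphereSpace X d → Real.pi - δ < diam M) ∧ (¬ IsSphereSpace X d → 1 / δ < diam M)

/-- Condition (1) of Theorem 7. -/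
def T7Cond1 (d : ℕ) (K L : Set X) : Prop :=
  ∀ φ ψ : X ≃ᵢ X, GoodPair d K L φ ψ → CentrallySymmetric (hullUnion K L φ ψ)

/-- Condition (2) of Theorem 7. -/
def T7Cond2 (d : ℕ) (K L : Set X) : Prop :=
  ∀ φ ψ : X ≃ᵢ X, GoodPair d K L φ ψ → ∀ a b : X, UniqueDiametral (hullUnion K L φ ψ) a b →
    SymmetricWrtPerpBisector (hullUnion K L φ ψ) a b

/-- Condition (3) of Theorem 7. -/
def T7Cond3 (d : ℕ) (K L : Set X) : Prop :=
  ∃ δ > (0 : ℝ), ∀ φ ψ : X ≃ᵢ X, GoodPair d K L φ ψ →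
    ∀ x ∈ frontier K, ∀ y ∈ frontier L,
      BigDiam d X (hullUnion K L φ ψ) δ →
      UniqueDiametral (hullUnion K L φ ψ) (φ x) (ψ y) →
      CentrallySymmetric (hullUnion K L φ ψ)

/-- Condition (4) of Theorem 7. -/
def T7Cond4 (d : ℕ) (K L : Set X) : Prop :=
  ∃ δ > (0 : ℝ), ∀ φ ψ : X ≃ᵢ X, GoodPair d K L φ ψ →
    ∀ x ∈ frontier K, ∀ y ∈ frontier L,
      BigDiam d X (hullUnion K L φ ψ) δ →
      UniqueDiametral (hullUnion K L φ ψ) (φ x) (ψ y) →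
      SymmetricWrtPerpBisector (hullUnion K L φ ψ) (φ x) (ψ y)

/-- Condition (5) of Theorem 7. -/
def T7Cond5 (d : ℕ) (K L : Set X) : Prop :=
  ∃ δ > (0 : ℝ), ∀ φ ψ : X ≃ᵢ X, GoodPair d K L φ ψ →
    ∀ x ∈ frontier K, ∀ y ∈ frontier L,
      BigDiam d X (hullUnion K L φ ψ) δ →
      UniqueDiametral (hullUnion K L φ ψ) (φ x) (ψ y) →
      ∃ ε₀ > (0 : ℝ), ∀ ε : ℝ, 0 < ε → ε < ε₀ →
        (IsSphereSpace X d → ∃ s : X, (⇑φ '' K) ∪ (⇑ψ '' L) ⊆ ball s (Real.pi / 2) ∧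
            segCyl (φ x) (ψ y) ε ⊆ ball s (Real.pi / 2)) ∧
        CentrallySymmetric (hullUnion K L φ ψ ∩ segCyl (φ x) (ψ y) ε)

/-- Condition (6) of Theorem 7. -/
def T7Cond6 (d : ℕ) (K L : Set X) : Prop :=
  ∃ δ > (0 : ℝ), ∀ φ ψ : X ≃ᵢ X, GoodPair d K L φ ψ →
    ∀ x ∈ frontier K, ∀ y ∈ frontier L,
      BigDiam d X (hullUnion K L φ ψ) δ →
      UniqueDiametral (hullUnion K L φ ψ) (φ x) (ψ y) →
      ∃ ε₀ > (0 : ℝ), ∀ ε : ℝ, 0 < ε → ε < ε₀ →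
        (IsSphereSpace X d → ∃ s : X, (⇑φ '' K) ∪ (⇑ψ '' L) ⊆ ball s (Real.pi / 2) ∧
            segCyl (φ x) (ψ y) ε ⊆ ball s (Real.pi / 2)) ∧
        SymmetricWrtPerpBisector (hullUnion K L φ ψ ∩ segCyl (φ x) (ψ y) ε) (φ x) (ψ y)

/-- Condition (7) of Theorem 7: `K` and `L` are congruent balls. -/
def T7Cond7 (d : ℕ) (K L : Set X) : Prop :=
  ∃ r > (0 : ℝ), (IsSphereSpace X d → r < Real.pi / 2) ∧
    (∃ p : X, K = closedBall p r) ∧ ∃ q : X, L = closedBall q r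

/-- Condition (1) of Theorem 8. -/
def T8Cond1 (K L : Set X) : Prop :=
  ∀ φ ψ : X ≃ᵢ X, GoodPair 2 K L φ ψ → AxiallySymmetric (hullUnion K L φ ψ)

/-- Condition (2) of Theorem 8. -/
def T8Cond2 (K L : Set X) : Prop :=
  ∀ φ ψ : X ≃ᵢ X, GoodPair 2 K L φ ψ → AdmitsNontrivialCongruence (hullUnion K L φ ψ)

/-- Condition (3) of Theorem 8. -/
def T8Cond3 (K L : Set X) : Prop :=
  ∃ δ > (0 : ℝ), ∀ φ ψ : X ≃ᵢ X, GoodPair 2 K L φ ψ →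
    ∀ x ∈ frontier K, ∀ y ∈ frontier L,
      BigDiam 2 X (hullUnion K L φ ψ) δ →
      UniqueDiametral (hullUnion K L φ ψ) (φ x) (ψ y) →
      AxiallySymmetric (hullUnion K L φ ψ)

/-- Condition (4) of Theorem 8. -/
def T8Cond4 (K L : Set X) : Prop :=
  ∃ δ > (0 : ℝ), ∀ φ ψ : X ≃ᵢ X, GoodPair 2 K L φ ψ →
    ∀ x ∈ frontier K, ∀ y ∈ frontier L,
      BigDiam 2 X (hullUnion K L φ ψ) δ →
      UniqueDiametral (hullUnion K L φ ψ) (φ x) (ψ y) →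
      AdmitsNontrivialCongruence (hullUnion K L φ ψ)

/-- Condition (5) of Theorem 8. -/
def T8Cond5 (K L : Set X) : Prop :=
  ∃ δ > (0 : ℝ), ∀ φ ψ : X ≃ᵢ X, GoodPair 2 K L φ ψ →
    ∀ x ∈ frontier K, ∀ y ∈ frontier L,
      BigDiam 2 X (hullUnion K L φ ψ) δ →
      UniqueDiametral (hullUnion K L φ ψ) (φ x) (ψ y) →
      ∃ ε₀ > (0 : ℝ), ∀ ε : ℝ, 0 < ε → ε < ε₀ →
        (IsSphereSpace X 2 → ∃ s : X, (⇑φ '' K) ∪ (⇑ψ '' L) ⊆ ball s (Real.pi / 2) ∧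
            segCyl (φ x) (ψ y) ε ⊆ ball s (Real.pi / 2)) ∧
        AxiallySymmetric (hullUnion K L φ ψ ∩ segCyl (φ x) (ψ y) ε)

/-- Condition (6) of Theorem 8. -/
def T8Cond6 (K L : Set X) : Prop :=
  ∃ δ > (0 : ℝ), ∀ φ ψ : X ≃ᵢ X, GoodPair 2 K L φ ψ →
    ∀ x ∈ frontier K, ∀ y ∈ frontier L,
      BigDiam 2 X (hullUnion K L φ ψ) δ →
      UniqueDiametral (hullUnion K L φ ψ) (φ x) (ψ y) →
      ∃ ε₀ > (0 : ℝ), ∀ ε : ℝ, 0 < ε → ε < ε₀ →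
        (IsSphereSpace X 2 → ∃ s : X, (⇑φ '' K) ∪ (⇑ψ '' L) ⊆ ball s (Real.pi / 2) ∧
            segCyl (φ x) (ψ y) ε ⊆ ball s (Real.pi / 2)) ∧
        AdmitsNontrivialCongruence (hullUnion K L φ ψ ∩ segCyl (φ x) (ψ y) ε)

/-- Condition (7) of Theorem 8: `K` and `L` are (in general incongruent) circles. -/
def T8Cond7 (K L : Set X) : Prop :=
  ∃ (p q : X) (r s : ℝ), 0 < r ∧ 0 < s ∧
    (IsSphereSpace X 2 → r < Real.pi / 2 ∧ s < Real.pi / 2) ∧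
    K = closedBall p r ∧ L = closedBall q s

set_option linter.unusedSectionVars false

section

/-! ### Generalized trigonometric functions -/

/-- The generalized cosine of curvature `k ∈ {1, 0, -1}`. -/
noncomputable def cs (k t : ℝ) : ℝ :=
  if k = 1 then Real.cos t else if k = 0 then 1 else Real.cosh t

/-- The generalized sine of curvature `k ∈ {1, 0, -1}`. -/
noncomputable def sn (k t : ℝ) : ℝ :=
  if k = 1 then Real.sin t else if k = 0 then t else Real.sinh t

/-- The generalized versed sine. -/
noncomputable def vs (k t : ℝ) : ℝ := 2 * sn k (t / 2) ^ 2

/-- The admissible curvatures. -/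
def IsCurv (k : ℝ) : Prop := k = 1 ∨ k = 0 ∨ k = -1

@[simp] lemma cs_one (t : ℝ) : cs 1 t = Real.cos t := by simp [cs]
@[simp] lemma cs_null (t : ℝ) : cs 0 t = 1 := by simp [cs]
@[simp] lemma cs_neg_one (t : ℝ) : cs (-1) t = Real.cosh t := by norm_num [cs]
@[simp] lemma sn_one (t : ℝ) : sn 1 t = Real.sin t := by simp [sn]
@[simp] lemma sn_null (t : ℝ) : sn 0 t = t := by simp [sn]
@[simp] lemma sn_neg_one (t : ℝ) : sn (-1) t = Real.sinh t := by norm_num [sn]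

variable {k : ℝ}

lemma cs_zero (hk : IsCurv k) : cs k 0 = 1 := by
  rcases hk with rfl | rfl | rfl <;> simp

lemma sn_zero (hk : IsCurv k) : sn k 0 = 0 := by
  rcases hk with rfl | rfl | rfl <;> simp

lemma cs_neg (hk : IsCurv k) (t : ℝ) : cs k (-t) = cs k t := by
  rcases hk with rfl | rfl | rfl <;> simp

lemma sn_neg (hk : IsCurv k) (t : ℝ) : sn k (-t) = -sn k t := by
  rcases hk with rfl | rfl | rfl <;> simp

lemma cs_sq (hk : IsCurv k) (t : ℝ) : cs k t ^ 2 + k * sn k t ^ 2 = 1 := by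
  rcases hk with rfl | rfl | rfl
  · simp
  · simp
  · simp [Real.cosh_sq]

lemma cs_add (hk : IsCurv k) (s t : ℝ) :
    cs k (s + t) = cs k s * cs k t - k * (sn k s * sn k t) := by
  rcases hk with rfl | rfl | rfl
  · simp [Real.cos_add]
  · simp
  · simp [Real.cosh_add]

lemma sn_add (hk : IsCurv k) (s t : ℝ) :
    sn k (s + t) = sn k s * cs k t + cs k s * sn k t := by
  rcases hk with rfl | rfl | rfl
  · simp [Real.sin_add]
  · simp
  · simp [Real.sinh_add]

lemma cs_sub (hk : IsCurv k) (s t : ℝ) :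
    cs k (s - t) = cs k s * cs k t + k * (sn k s * sn k t) := by
  rw [sub_eq_add_neg, cs_add hk, cs_neg hk, sn_neg hk]; ring

lemma sn_sub (hk : IsCurv k) (s t : ℝ) :
    sn k (s - t) = sn k s * cs k t - cs k s * sn k t := by
  rw [sub_eq_add_neg, sn_add hk, cs_neg hk, sn_neg hk]; ring

lemma cs_half (hk : IsCurv k) (t : ℝ) :
    cs k t = cs k (t / 2) ^ 2 - k * sn k (t / 2) ^ 2 := by
  have := cs_add hk (t / 2) (t / 2); rw [add_halves] at this; rw [this]; ring

lemma sn_half (hk : IsCurv k) (t : ℝ) :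
    sn k t = 2 * sn k (t / 2) * cs k (t / 2) := by
  have := sn_add hk (t / 2) (t / 2); rw [add_halves] at this; rw [this]; ring

lemma mul_vs (hk : IsCurv k) (t : ℝ) : k * vs k t = 1 - cs k t := by
  have h1 := cs_half hk t
  have h2 := cs_sq hk (t / 2)
  unfold vs; linarith

lemma sn_sq (hk : IsCurv k) (t : ℝ) : sn k t ^ 2 = vs k t * (1 + cs k t) := by
  have h1 := cs_half hk t
  have h2 := cs_sq hk (t / 2)
  have h3 := sn_half hk t
  unfold vs
  rw [h3]
  linear_combination (-2 * sn k (t / 2) ^ 2) * h1 + (2 * sn k (t / 2) ^ 2) * h2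

lemma vs_nonneg (t : ℝ) : 0 ≤ vs k t := by unfold vs; positivity

lemma vs_zero (hk : IsCurv k) : vs k 0 = 0 := by simp [vs, sn_zero hk]

lemma vs_neg (hk : IsCurv k) (t : ℝ) : vs k (-t) = vs k t := by
  simp [vs, neg_div, sn_neg hk]

lemma vs_abs (hk : IsCurv k) (t : ℝ) : vs k |t| = vs k t := by
  rcases abs_choice t with h | h <;> rw [h]
  exact vs_neg hk t

lemma hasDerivAt_cs (hk : IsCurv k) (t : ℝ) : HasDerivAt (cs k) (-(k * sn k t)) t := by
  rcases hk with rfl | rfl | rfl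
  · have : cs 1 = Real.cos := by ext; simp
    simpa [this] using Real.hasDerivAt_cos t
  · have : cs 0 = fun _ => 1 := by ext; simp
    simpa [this] using hasDerivAt_const t (1 : ℝ)
  · have : cs (-1) = Real.cosh := by ext; simp
    simpa [this] using Real.hasDerivAt_cosh t

lemma hasDerivAt_sn (hk : IsCurv k) (t : ℝ) : HasDerivAt (sn k) (cs k t) t := by
  rcases hk with rfl | rfl | rfl
  · have : sn 1 = Real.sin := by ext; simp
    simpa [this] using Real.hasDerivAt_sin t
  · have : sn 0 = fun t => t := by ext; simp
    simpa [this] using hasDerivAt_id' t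
  · have : sn (-1) = Real.sinh := by ext; simp
    simpa [this] using Real.hasDerivAt_sinh t

lemma continuous_cs (hk : IsCurv k) : Continuous (cs k) :=
  continuous_iff_continuousAt.2 fun t => (hasDerivAt_cs hk t).continuousAt

lemma continuous_sn (hk : IsCurv k) : Continuous (sn k) :=
  continuous_iff_continuousAt.2 fun t => (hasDerivAt_sn hk t).continuousAt

lemma continuous_vs (hk : IsCurv k) : Continuous (vs k) := by
  have := continuous_sn hk
  unfold vs; fun_prop

lemma sn_pos (hk : IsCurv k) {t : ℝ} (h0 : 0 < t) (h1 : k = 1 → t < Real.pi) : 0 < sn k t := by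
  rcases hk with rfl | rfl | rfl
  · simpa using Real.sin_pos_of_pos_of_lt_pi h0 (h1 rfl)
  · simpa
  · simpa using Real.sinh_pos_iff.2 h0

lemma cs_pos_of_nonpos (hk : IsCurv k) (h : k ≤ 0) (t : ℝ) : 1 ≤ cs k t := by
  rcases hk with rfl | rfl | rfl
  · norm_num at h
  · simp
  · simp

lemma cs_pos (hk : IsCurv k) {t : ℝ} (h0 : 0 ≤ t) (h1 : k = 1 → t < Real.pi / 2) :
    0 < cs k t := by
  by_cases h : k ≤ 0
  · linarith [cs_pos_of_nonpos hk h t]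
  · obtain rfl : k = 1 := by rcases hk with h' | h' | h' <;> [exact h'; simp [h'] at h; norm_num [h'] at h]
    simpa using Real.cos_pos_of_mem_Ioo ⟨by linarith [Real.pi_pos], h1 rfl⟩

lemma vs_lt (hk : IsCurv k) {s t : ℝ} (h0 : 0 ≤ s) (h : s < t) (h1 : k = 1 → t ≤ Real.pi) :
    vs k s < vs k t := by
  unfold vs
  have key : sn k (s / 2) < sn k (t / 2) := by
    rcases hk with rfl | rfl | rfl
    · have := h1 rfl
      simpa using Real.sin_lt_sin_of_lt_of_le_pi_div_two (by linarith [Real.pi_pos])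
        (by linarith) (by linarith)
    · simpa using by linarith
    · simpa using by linarith
  have h0' : 0 ≤ sn k (s / 2) := by
    rcases hk with rfl | rfl | rfl
    · have := h1 rfl
      simpa using Real.sin_nonneg_of_nonneg_of_le_pi (by linarith) (by linarith)
    · simpa using by linarith
    · simpa using by linarith
  nlinarith

lemma vs_le_iff (hk : IsCurv k) {s t : ℝ} (hs : 0 ≤ s) (ht : 0 ≤ t)
    (hs1 : k = 1 → s ≤ Real.pi) (ht1 : k = 1 → t ≤ Real.pi) : vs k s ≤ vs k t ↔ s ≤ t := by
  constructor
  · intro h; by_contra! h'; linarith [vs_lt hk ht h' hs1]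
  · intro h
    rcases h.eq_or_lt with rfl | h
    · rfl
    · exact (vs_lt hk hs h ht1).le

lemma vs_lt_iff (hk : IsCurv k) {s t : ℝ} (hs : 0 ≤ s) (ht : 0 ≤ t)
    (hs1 : k = 1 → s ≤ Real.pi) (ht1 : k = 1 → t ≤ Real.pi) : vs k s < vs k t ↔ s < t := by
  rw [← not_le, ← not_le, vs_le_iff hk ht hs ht1 hs1]

lemma vs_inj (hk : IsCurv k) {s t : ℝ} (hs : 0 ≤ s) (ht : 0 ≤ t)
    (hs1 : k = 1 → s ≤ Real.pi) (ht1 : k = 1 → t ≤ Real.pi) (h : vs k s = vs k t) : s = t :=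
  le_antisymm ((vs_le_iff hk hs ht hs1 ht1).1 h.le) ((vs_le_iff hk ht hs ht1 hs1).1 h.ge)

lemma vs_pos (hk : IsCurv k) {t : ℝ} (h0 : 0 < t) (h1 : k = 1 → t ≤ Real.pi) : 0 < vs k t := by
  simpa [vs_zero hk] using vs_lt hk le_rfl h0 h1

/-! ### The unified linear model of a space form -/

/-- A unified linear model of a space form of curvature `k ∈ {1, 0, -1}`, embedded in `E × ℝ`. -/
structure SF (X : Type*) [MetricSpace X] (E : Type*) [NormedAddCommGroup E]
    [InnerProductSpace ℝ E] where
  k : ℝ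
  toFun : X → E × ℝ
  hk : IsCurv k
  mem : ∀ w : E × ℝ, (∃ x, toFun x = w) ↔
    (w.2 * w.2 + k * inner ℝ w.1 w.1 = 1 ∧ (k ≤ 0 → 0 < w.2))
  hd : ∀ x y, vs k (dist x y) = (inner ℝ (toFun x - toFun y).1 (toFun x - toFun y).1 +
    k * ((toFun x - toFun y).2 * (toFun x - toFun y).2)) / 2
  hpi : k = 1 → ∀ x y : X, dist x y ≤ Real.pi

namespace SF

variable {E : Type*} [NormedAddCommGroup E] [InnerProductSpace ℝ E]

instance : CoeFun (SF X E) (fun _ => X → E × ℝ) := ⟨SF.toFun⟩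

variable (M : SF X E)

/-- The metric form. -/
noncomputable def b (v w : E × ℝ) : ℝ := inner ℝ v.1 w.1 + M.k * (v.2 * w.2)

/-- The form defining the model quadric. -/
noncomputable def q (v w : E × ℝ) : ℝ := v.2 * w.2 + M.k * inner ℝ v.1 w.1

/-- Half the squared chord. -/
noncomputable def h (x y : X) : ℝ := M.b (M x - M y) (M x - M y) / 2

section forms
variable (u v w : E × ℝ) (a : ℝ)

lemma b_comm : M.b v w = M.b w v := by simp only [b, real_inner_comm, mul_comm]
lemma q_comm : M.q v w = M.q w v := by simp only [q, real_inner_comm, mul_comm]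
lemma b_add_left : M.b (u + v) w = M.b u w + M.b v w := by
  simp only [b, Prod.fst_add, Prod.snd_add, inner_add_left]; ring
lemma b_add_right : M.b u (v + w) = M.b u v + M.b u w := by
  simp only [b, Prod.fst_add, Prod.snd_add, inner_add_right]; ring
lemma b_sub_left : M.b (u - v) w = M.b u w - M.b v w := by
  simp only [b, Prod.fst_sub, Prod.snd_sub, inner_sub_left]; ring
lemma b_sub_right : M.b u (v - w) = M.b u v - M.b u w := by
  simp only [b, Prod.fst_sub, Prod.snd_sub, inner_sub_right]; ring
lemma b_smul_left : M.b (a • v) w = a * M.b v w := by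
  simp only [b, Prod.smul_fst, Prod.smul_snd, real_inner_smul_left, smul_eq_mul]; ring
lemma b_smul_right : M.b v (a • w) = a * M.b v w := by
  simp only [b, Prod.smul_fst, Prod.smul_snd, real_inner_smul_right, smul_eq_mul]; ring
lemma b_neg_left : M.b (-v) w = -M.b v w := by
  simp only [b, Prod.fst_neg, Prod.snd_neg, inner_neg_left]; ring
lemma b_neg_right : M.b v (-w) = -M.b v w := by
  simp only [b, Prod.fst_neg, Prod.snd_neg, inner_neg_right]; ring
lemma b_zero_left : M.b 0 w = 0 := by simp [b]
lemma q_add_left : M.q (u + v) w = M.q u w + M.q v w := by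
  simp only [q, Prod.fst_add, Prod.snd_add, inner_add_left]; ring
lemma q_add_right : M.q u (v + w) = M.q u v + M.q u w := by
  simp only [q, Prod.fst_add, Prod.snd_add, inner_add_right]; ring
lemma q_sub_left : M.q (u - v) w = M.q u w - M.q v w := by
  simp only [q, Prod.fst_sub, Prod.snd_sub, inner_sub_left]; ring
lemma q_sub_right : M.q u (v - w) = M.q u v - M.q u w := by
  simp only [q, Prod.fst_sub, Prod.snd_sub, inner_sub_right]; ring
lemma q_smul_left : M.q (a • v) w = a * M.q v w := by
  simp only [q, Prod.smul_fst, Prod.smul_snd, real_inner_smul_left, smul_eq_mul]; ring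
lemma q_smul_right : M.q v (a • w) = a * M.q v w := by
  simp only [q, Prod.smul_fst, Prod.smul_snd, real_inner_smul_right, smul_eq_mul]; ring
lemma q_neg_left : M.q (-v) w = -M.q v w := by
  simp only [q, Prod.fst_neg, Prod.snd_neg, inner_neg_left]; ring
lemma q_neg_right : M.q v (-w) = -M.q v w := by
  simp only [q, Prod.fst_neg, Prod.snd_neg, inner_neg_right]; ring
lemma q_zero_left : M.q 0 w = 0 := by simp [q]
lemma q_zero_right : M.q w 0 = 0 := by simp [q]

@[fun_prop]
lemma continuous_b {Y : Type*} [TopologicalSpace Y] {f g : Y → E × ℝ} (hf : Continuous f)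
    (hg : Continuous g) : Continuous fun y => M.b (f y) (g y) := by
  unfold b; fun_prop

@[fun_prop]
lemma continuous_q {Y : Type*} [TopologicalSpace Y] {f g : Y → E × ℝ} (hf : Continuous f)
    (hg : Continuous g) : Continuous fun y => M.q (f y) (g y) := by
  unfold q; fun_prop

lemma k_cube : M.k ^ 3 = M.k := by
  rcases M.hk with h | h | h <;> rw [h] <;> norm_num

lemma k_mul_b : M.k * M.b v w = M.k ^ 2 * M.q v w := by
  unfold b q; linear_combination (-inner ℝ v.1 w.1) * M.k_cube

lemma k_abs : |M.k| ≤ 1 := by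
  rcases M.hk with h | h | h <;> rw [h] <;> norm_num

lemma k_sq (hk : M.k ≠ 0) : M.k ^ 2 = 1 := by
  rcases M.hk with h | h | h
  · rw [h]; norm_num
  · exact absurd h hk
  · rw [h]; norm_num

lemma b_eq (hk : M.k ≠ 0) : M.b v w = M.k * M.q v w := by
  have h := M.k_mul_b v w
  refine mul_left_cancel₀ hk ?_
  rw [h]; ring

end forms

lemma q_self (x : X) : M.q (M x) (M x) = 1 := ((M.mem _).1 ⟨x, rfl⟩).1

lemma pos_snd (x : X) (h : M.k ≤ 0) : 0 < (M x).2 := ((M.mem _).1 ⟨x, rfl⟩).2 h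

lemma exists_pt {w : E × ℝ} (h1 : M.q w w = 1) (h2 : M.k ≤ 0 → 0 < w.2) : ∃ x, M x = w :=
  (M.mem w).2 ⟨h1, h2⟩

lemma h_eq_vs (x y : X) : M.h x y = vs M.k (dist x y) := (M.hd x y).symm

lemma h_nonneg (x y : X) : 0 ≤ M.h x y := by rw [h_eq_vs]; exact vs_nonneg _

lemma h_comm (x y : X) : M.h x y = M.h y x := by rw [h_eq_vs, h_eq_vs, dist_comm]

lemma h_self (x : X) : M.h x x = 0 := by simp [h, b_zero_left]

lemma hpi' (x y : X) : M.k = 1 → dist x y ≤ Real.pi := fun hk => M.hpi hk x y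

lemma h_eq_zero {x y : X} : M.h x y = 0 ↔ x = y := by
  constructor
  · intro h
    rw [h_eq_vs, ← vs_zero M.hk] at h
    exact dist_eq_zero.1 (vs_inj M.hk dist_nonneg le_rfl (M.hpi' x y)
      (fun _ => Real.pi_pos.le) h)
  · rintro rfl; exact M.h_self x

lemma injective : Function.Injective M := by
  intro x y hxy
  apply M.h_eq_zero.1
  simp [h, hxy, b_zero_left]

lemma dist_eq_of_h {x y x' y' : X} (hh : M.h x y = M.h x' y') : dist x y = dist x' y' := by
  rw [h_eq_vs, h_eq_vs] at hh
  exact vs_inj M.hk dist_nonneg dist_nonneg (M.hpi' _ _) (M.hpi' _ _) hh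

lemma dist_le_iff {x y : X} {r : ℝ} (hr : 0 ≤ r) (hr1 : M.k = 1 → r ≤ Real.pi) :
    dist x y ≤ r ↔ M.h x y ≤ vs M.k r := by
  rw [h_eq_vs, vs_le_iff M.hk dist_nonneg hr (M.hpi' _ _) hr1]

lemma dist_lt_iff {x y : X} {r : ℝ} (hr : 0 ≤ r) (hr1 : M.k = 1 → r ≤ Real.pi) :
    dist x y < r ↔ M.h x y < vs M.k r := by
  rw [h_eq_vs, vs_lt_iff M.hk dist_nonneg hr (M.hpi' _ _) hr1]

lemma k_mul_h (x y : X) : M.k * M.h x y = 1 - M.q (M x) (M y) := by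
  have h1 := M.q_self x
  have h2 := M.q_self y
  have hb := M.k_mul_b (M x - M y) (M x - M y)
  have e : M.q (M x - M y) (M x - M y) = 2 - 2 * M.q (M x) (M y) := by
    rw [q_sub_left, q_sub_right, q_sub_right, h1, h2, M.q_comm (M y)]; ring
  have e2 : M.k = 0 → M.q (M x) (M y) = 1 := by
    intro hk
    have p1 := M.pos_snd x hk.le
    have p2 := M.pos_snd y hk.le
    simp only [q, hk, zero_mul, add_zero] at h1 h2 ⊢
    nlinarith [mul_self_eq_one_iff.1 h1, mul_self_eq_one_iff.1 h2]
  unfold h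
  by_cases hk : M.k = 0
  · rw [e2 hk, hk]; ring
  · rw [e] at hb
    have : M.k ^ 2 = 1 := by
      have := M.k_cube
      field_simp at this; linarith
    rw [this] at hb; linarith

/-- The tangent space at `x`, as a predicate. -/
def Tan (x : X) (v : E × ℝ) : Prop := M.q (M x) v = 0

lemma snd_one (hk : M.k = 0) (x : X) : (M x).2 = 1 := by
  have h := M.q_self x
  have p := M.pos_snd x hk.le
  simp only [q, hk, zero_mul, add_zero] at h
  nlinarith

lemma tan_snd (hk : M.k = 0) {x : X} {v : E × ℝ} (hv : M.Tan x v) : v.2 = 0 := by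
  simpa [Tan, q, hk, M.snd_one hk x] using hv

lemma tan_b (hk : M.k ≠ 0) {x : X} {v : E × ℝ} : M.Tan x v ↔ M.b (M x) v = 0 := by
  unfold Tan
  rw [M.b_eq _ _ hk]; simp [hk]

lemma Tan.b_zero {M : SF X E} (hk : M.k ≠ 0) {x : X} {v : E × ℝ} (hv : M.Tan x v) :
    M.b (M x) v = 0 := (M.tan_b hk).1 hv

lemma Tan.add {M : SF X E} {x : X} {v w : E × ℝ} (hv : M.Tan x v) (hw : M.Tan x w) :
    M.Tan x (v + w) := by
  unfold Tan at *; rw [q_add_right, hv, hw, add_zero]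

lemma Tan.smul {M : SF X E} {x : X} {v : E × ℝ} (c : ℝ) (hv : M.Tan x v) :
    M.Tan x (c • v) := by
  unfold Tan at *; rw [q_smul_right, hv, mul_zero]

lemma Tan.neg {M : SF X E} {x : X} {v : E × ℝ} (hv : M.Tan x v) :
    M.Tan x (-v) := by
  unfold Tan at *; rw [q_neg_right, hv, neg_zero]

lemma Tan.sub {M : SF X E} {x : X} {v w : E × ℝ} (hv : M.Tan x v) (hw : M.Tan x w) :
    M.Tan x (v - w) := by
  unfold Tan at *; rw [q_sub_right, hv, hw, sub_zero]

/-- The squared Euclidean-type norm on the ambient space is controlled by the metric form on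
tangent vectors. -/
lemma tan_bound {x : X} {v : E × ℝ} (hv : M.Tan x v) :
    inner ℝ v.1 v.1 + v.2 * v.2 ≤ (1 + 2 * (M x).2 ^ 2) * M.b v v := by
  have hq := M.q_self x
  have hi : (0 : ℝ) ≤ inner ℝ v.1 v.1 := real_inner_self_nonneg
  rcases M.hk with hk | hk | hk
  · simp only [b, hk, one_mul]
    nlinarith [mul_nonneg (sq_nonneg (M x).2) hi, sq_nonneg ((M x).2 * v.2)]
  · have h2 := M.tan_snd hk hv
    have h3 := M.snd_one hk x
    simp only [b, hk, h2, h3]; nlinarith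
  · simp only [Tan, q, hk] at hq hv
    have p := M.pos_snd x (by rw [hk]; norm_num)
    have cs := real_inner_mul_inner_self_le (M x).1 v.1
    simp only [b, hk]
    have e1 : inner ℝ (M x).1 (M x).1 = (M x).2 * (M x).2 - 1 := by linarith
    have e2 : inner ℝ (M x).1 v.1 = (M x).2 * v.2 := by linarith
    rw [e1, e2] at cs
    have ha : 1 ≤ (M x).2 * (M x).2 := by
      have : (0 : ℝ) ≤ inner ℝ (M x).1 (M x).1 := real_inner_self_nonneg
      linarith
    have h1 : v.2 * v.2 ≤ inner ℝ v.1 v.1 := by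
      by_contra! hc
      have := mul_le_mul_of_nonneg_left hc.le (sub_nonneg.2 ha)
      nlinarith
    nlinarith

lemma tan_nonneg {x : X} {v : E × ℝ} (hv : M.Tan x v) : 0 ≤ M.b v v := by
  have h := M.tan_bound hv
  have hi : (0 : ℝ) ≤ inner ℝ v.1 v.1 := real_inner_self_nonneg
  by_contra! hc
  nlinarith [mul_self_nonneg v.2, sq_nonneg (M x).2]

lemma tan_eq_zero {x : X} {v : E × ℝ} (hv : M.Tan x v) (h0 : M.b v v = 0) : v = 0 := by
  have h := M.tan_bound hv
  have hi : (0 : ℝ) ≤ inner ℝ v.1 v.1 := real_inner_self_nonneg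
  rw [h0, mul_zero] at h
  have h1 : inner ℝ v.1 v.1 = 0 := by nlinarith [mul_self_nonneg v.2]
  have h2 : v.2 = 0 := by nlinarith [mul_self_nonneg v.2]
  exact Prod.ext (inner_self_eq_zero.1 h1) h2

lemma tan_pos {x : X} {v : E × ℝ} (hv : M.Tan x v) (h0 : v ≠ 0) : 0 < M.b v v :=
  (M.tan_nonneg hv).lt_of_ne fun h => h0 (M.tan_eq_zero hv h.symm)

lemma norm_sq_le (v : E × ℝ) : ‖v‖ ^ 2 ≤ inner ℝ v.1 v.1 + v.2 * v.2 := by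
  rw [real_inner_self_eq_norm_sq, Prod.norm_def]
  rcases max_choice ‖v.1‖ ‖v.2‖ with h | h <;> rw [h]
  · nlinarith [mul_self_nonneg v.2]
  · rw [Real.norm_eq_abs, sq_abs]; nlinarith [sq_nonneg ‖v.1‖]

lemma abs_b_le (v w : E × ℝ) : |M.b v w| ≤ 2 * ‖v‖ * ‖w‖ := by
  have h1 := abs_real_inner_le_norm v.1 w.1
  have hv1 := norm_fst_le v
  have hv2 := norm_snd_le v
  have hw1 := norm_fst_le w
  have hw2 := norm_snd_le w
  unfold b
  refine (abs_add_le _ _).trans ?_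
  have a1 : ‖v.1‖ * ‖w.1‖ ≤ ‖v‖ * ‖w‖ := by gcongr
  have a2 : |v.2| * |w.2| ≤ ‖v‖ * ‖w‖ := by
    rw [Real.norm_eq_abs] at hv2 hw2; gcongr
  have a3 : |M.k * (v.2 * w.2)| ≤ |v.2| * |w.2| := by
    rw [abs_mul, abs_mul]
    calc _ ≤ 1 * (|v.2| * |w.2|) := by gcongr; exact M.k_abs
      _ = _ := one_mul _
  linarith

/-- The tangential part of a chord. -/
lemma tan_chord (z x : X) : M.Tan x (M z - M x + (M.k * M.h z x) • M x) := by
  have h1 := M.k_mul_h z x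
  unfold Tan
  rw [q_add_right, q_sub_right, q_smul_right, M.q_self, M.q_comm, h1]; ring

lemma b_tan_chord (z x : X) :
    M.b (M z - M x + (M.k * M.h z x) • M x) (M z - M x + (M.k * M.h z x) • M x)
      = M.h z x * (1 + M.q (M z) (M x)) := by
  have h1 := M.k_mul_h z x
  by_cases hk : M.k = 0
  · have : M.q (M z) (M x) = 1 := by rw [hk] at h1; linarith
    rw [hk, this]; simp [h]; ring
  · have e : M.b (M z - M x) (M x) = - M.h z x := by
      rw [M.b_eq _ _ hk, q_sub_left, M.q_self]
      linear_combination M.k * h1 - M.h z x * M.k_sq hk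
    have e2 : M.b (M x) (M x) = M.k := by rw [M.b_eq _ _ hk, q_self, mul_one]
    have e3 : M.b (M z - M x) (M z - M x) = 2 * M.h z x := by unfold h; ring
    rw [b_add_left, b_add_right, b_add_right, b_smul_left, b_smul_left, b_smul_right,
      b_smul_right, M.b_comm (M x), e, e2, e3]
    linear_combination (-M.h z x) * h1 + (M.h z x) ^ 2 * M.k_cube

/-- Chord estimate. -/
lemma chord_bound (x : X) : ∃ C > 0, ∀ z, ‖M z - M x‖ ^ 2 ≤ C * (M.h z x * (1 + M.h z x)) := by
  refine ⟨2 * (1 + 2 * (M x).2 ^ 2) * 2 + 2 * ‖M x‖ ^ 2, by positivity, fun z => ?_⟩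
  have h1 := M.k_mul_h z x
  have hn := M.h_nonneg z x
  set v := M z - M x + (M.k * M.h z x) • M x with hv
  have hb := M.b_tan_chord z x
  have ht := M.tan_bound (M.tan_chord z x)
  have hns := norm_sq_le v
  rw [← hv] at hb ht
  rw [hb] at ht
  have e : M z - M x = v - (M.k * M.h z x) • M x := by rw [hv]; abel
  have hk := abs_le.1 M.k_abs
  have n1 : ‖M z - M x‖ ≤ ‖v‖ + M.h z x * ‖M x‖ := by
    rw [e]
    refine (norm_sub_le _ _).trans ?_
    rw [norm_smul, Real.norm_eq_abs, abs_mul, abs_of_nonneg hn]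
    have : |M.k| * M.h z x * ‖M x‖ ≤ 1 * M.h z x * ‖M x‖ := by gcongr; exact M.k_abs
    linarith
  have hq : 1 + M.q (M z) (M x) ≤ 2 * (1 + M.h z x) := by nlinarith
  have n2 : ‖v‖ ^ 2 ≤ (1 + 2 * (M x).2 ^ 2) * (2 * (M.h z x * (1 + M.h z x))) := by
    refine hns.trans (ht.trans (mul_le_mul_of_nonneg_left ?_ (by positivity)))
    linarith [mul_le_mul_of_nonneg_left hq hn]
  have n3 : ‖M z - M x‖ ^ 2 ≤ 2 * ‖v‖ ^ 2 + 2 * (M.h z x * ‖M x‖) ^ 2 := by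
    have := norm_nonneg (M z - M x)
    nlinarith [sq_nonneg (‖v‖ - M.h z x * ‖M x‖)]
  nlinarith [mul_nonneg (sq_nonneg ‖M x‖) hn]

lemma h_le_norm_sq (z x : X) : M.h z x ≤ ‖M z - M x‖ ^ 2 := by
  have := (abs_le.1 (M.abs_b_le (M z - M x) (M z - M x))).2
  unfold h; nlinarith

lemma tendsto_h {Y : Type*} {l : Filter Y} {f : Y → X} {x : X} :
    Tendsto (fun y => M.h (f y) x) l (nhds 0) ↔ Tendsto f l (nhds x) := by
  constructor
  · intro H
    rw [Metric.tendsto_nhds]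
    intro ε hε
    have hpos : 0 < vs M.k (min ε Real.pi) :=
      vs_pos M.hk (lt_min hε Real.pi_pos) fun _ => min_le_right _ _
    filter_upwards [H.eventually (gt_mem_nhds hpos)] with y hy
    exact ((M.dist_lt_iff (lt_min hε Real.pi_pos).le fun _ => min_le_right _ _).2 hy).trans_le
      (min_le_left _ _)
  · intro H
    have : Tendsto (fun y => vs M.k (dist (f y) x)) l (nhds (vs M.k 0)) :=
      ((continuous_vs M.hk).tendsto 0).comp (tendsto_iff_dist_tendsto_zero.1 H)
    rw [vs_zero M.hk] at this
    simpa only [h_eq_vs] using this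

lemma tendsto_iff {Y : Type*} {l : Filter Y} {f : Y → X} {x : X} :
    Tendsto (fun y => M (f y)) l (nhds (M x)) ↔ Tendsto f l (nhds x) := by
  rw [← M.tendsto_h]
  constructor
  · intro H
    have H2 := tendsto_iff_norm_sub_tendsto_zero.1 H
    refine squeeze_zero (fun y => M.h_nonneg _ _) (fun y => M.h_le_norm_sq _ _) ?_
    simpa using H2.pow 2
  · intro H
    obtain ⟨C, hC, hb⟩ := M.chord_bound x
    rw [tendsto_iff_norm_sub_tendsto_zero]
    have h2 : Tendsto (fun y => ‖M (f y) - M x‖ ^ 2) l (nhds 0) := by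
      refine squeeze_zero (fun y => sq_nonneg _) (fun y => hb _) ?_
      simpa using (H.mul (H.const_add 1)).const_mul C
    have h3 := h2.sqrt
    simpa [Real.sqrt_sq] using h3

lemma isInducing : Topology.IsInducing M := by
  rw [Topology.isInducing_iff_nhds]
  intro x
  apply le_antisymm
  · rw [← tendsto_iff_comap]; exact M.tendsto_iff.2 tendsto_id
  · have : Tendsto (fun y => M (id y)) (comap M (nhds (M x))) (nhds (M x)) := tendsto_comap
    exact M.tendsto_iff.1 this

lemma continuous : Continuous M := M.isInducing.continuous

lemma continuous_h (x : X) : Continuous fun z => M.h z x := by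
  have := M.continuous
  unfold h; fun_prop

end SF

end

lemma vs_sub {k : ℝ} (hk : IsCurv k) (u r : ℝ) :
    vs k (u - r) = vs k u + cs k u * vs k r - sn k u * sn k r := by
  by_cases h0 : k = 0
  · subst h0; simp [vs]; ring
  · have h1 := mul_vs hk (u - r)
    have h2 := mul_vs hk u
    have h3 := mul_vs hk r
    have h4 := cs_sub hk u r
    refine mul_left_cancel₀ h0 ?_
    linear_combination h1 - h2 - cs k u * h3 - h4

lemma exists_sn_eq {k : ℝ} (hk : IsCurv k) {β : ℝ} (hβ : k * β ^ 2 < 1) :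
    ∃ t, sn k t = β ∧ 0 < cs k t ∧ (k = 1 → |t| < Real.pi / 2) := by
  rcases hk with rfl | rfl | rfl
  · rw [one_mul, sq_lt_one_iff_abs_lt_one, abs_lt] at hβ
    refine ⟨Real.arcsin β, ?_, ?_, fun _ => ?_⟩
    · simpa using Real.sin_arcsin hβ.1.le hβ.2.le
    · rw [cs_one]
      exact Real.cos_pos_of_mem_Ioo ⟨Real.neg_pi_div_two_lt_arcsin.2 hβ.1,
        Real.arcsin_lt_pi_div_two.2 hβ.2⟩
    · exact abs_lt.2 ⟨Real.neg_pi_div_two_lt_arcsin.2 hβ.1, Real.arcsin_lt_pi_div_two.2 hβ.2⟩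
  · exact ⟨β, by simp, by simp, by simp⟩
  · exact ⟨Real.arsinh β, by simp, by rw [cs_neg_one]; exact Real.cosh_pos _, by norm_num⟩

namespace SF

variable {E : Type*} [NormedAddCommGroup E] [InnerProductSpace ℝ E]
variable (M : SF X E)

lemma kb_self (x : X) : M.k * M.b (M x) (M x) = M.k ^ 2 := by
  rw [k_mul_b, q_self, mul_one]

lemma kb_tan {x : X} {v : E × ℝ} (hv : M.Tan x v) : M.k * M.b (M x) v = 0 := by
  rw [k_mul_b, hv, mul_zero]

lemma kb_chord (z x : X) : M.k * M.b (M z - M x) (M x) = -(M.k * M.h z x) := by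
  rw [k_mul_b, q_sub_left, q_self]
  linear_combination (M.k ^ 2) * M.k_mul_h z x - M.h z x * M.k_cube

lemma b_self (hk : M.k ≠ 0) (x : X) : M.b (M x) (M x) = M.k := by
  rw [M.b_eq _ _ hk, q_self, mul_one]

lemma q_tan {x : X} {v : E × ℝ} (hv : M.Tan x v) (z : X) :
    M.q (M z) v = M.k * M.b (M z - M x) v := by
  by_cases hk : M.k = 0
  · simp [q, hk, M.tan_snd hk hv]
  · rw [M.b_eq _ _ hk, q_sub_left]
    unfold Tan at hv
    rw [hv]; linear_combination (-M.q (M z) v) * M.k_sq hk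

/-- A unit tangent vector at `x`. -/
structure UT (x : X) (v : E × ℝ) : Prop where
  tan : M.Tan x v
  unit : M.b v v = 1

variable {M} in
lemma UT.neg {x : X} {v : E × ℝ} (hv : M.UT x v) : M.UT x (-v) :=
  ⟨hv.tan.neg, by rw [b_neg_left, b_neg_right, hv.unit, neg_neg]⟩

variable {M} in
lemma UT.q_self {x : X} {v : E × ℝ} (hv : M.UT x v) : M.q v v = M.k := by
  by_cases hk : M.k = 0
  · simp [q, hk, M.tan_snd hk hv.tan]
  · have h1 := hv.unit
    rw [M.b_eq _ _ hk] at h1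
    linear_combination M.k * h1 - M.q v v * M.k_sq hk

lemma exists_exp {x : X} {v : E × ℝ} (hv : M.UT x v) (t : ℝ) :
    ∃ z, M z = cs M.k t • M x + sn M.k t • v := by
  apply M.exists_pt
  · rw [q_add_left, q_add_right, q_add_right, q_smul_left, q_smul_left, q_smul_left, q_smul_left,
      q_smul_right, q_smul_right, q_smul_right, q_smul_right, M.q_comm v, hv.tan, M.q_self,
      hv.q_self]
    linear_combination cs_sq M.hk t
  · intro hk0
    rcases M.hk with hk | hk | hk
    · norm_num [hk] at hk0
    · simp [hk, M.tan_snd hk hv.tan, M.snd_one hk]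
    · have hx := M.q_self x
      have hu := hv.unit
      have ht := hv.tan
      have p := M.pos_snd x hk0
      simp only [Tan, q, b, hk] at hx hu ht
      have cs := real_inner_mul_inner_self_le (M x).1 v.1
      have e1 : inner ℝ (M x).1 (M x).1 = (M x).2 * (M x).2 - 1 := by linarith
      have e2 : inner ℝ (M x).1 v.1 = (M x).2 * v.2 := by linarith
      have e3 : inner ℝ v.1 v.1 = 1 + v.2 * v.2 := by linarith
      rw [e1, e2, e3] at cs
      have h2 : |v.2| < (M x).2 := abs_lt_of_sq_lt_sq (by nlinarith) p.le
      simp only [hk, cs_neg_one, sn_neg_one, Prod.snd_add, Prod.smul_snd, smul_eq_mul]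
      have h3 : |Real.sinh t| < Real.cosh t :=
        abs_lt_of_sq_lt_sq (by rw [Real.cosh_sq]; linarith) (Real.cosh_pos t).le
      have h4 : |Real.sinh t * v.2| < Real.cosh t * (M x).2 := by
        rw [abs_mul]; exact mul_lt_mul'' h3 h2 (abs_nonneg _) (abs_nonneg _)
      linarith [(abs_lt.1 h4).1]

/-- Stewart's theorem. -/
lemma stewart {x y z : X} {a c s : ℝ} (hs : a • M x + c • M y = s • M z) (ha : 0 ≤ a)
    (hc : 0 ≤ c) (hs0 : 0 ≤ s) (w : X) :
    (a + c + s) * (a * M.h x w + c * M.h y w - s * M.h z w) = 2 * a * c * M.h x y := by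
  have hq : s ^ 2 = (a + c) ^ 2 - 2 * a * c * (M.k * M.h x y) := by
    have h1 : M.q (s • M z) (s • M z) = s ^ 2 := by
      rw [q_smul_left, q_smul_right, q_self]; ring
    rw [← h1, ← hs, M.k_mul_h x y]
    simp only [q_add_left, q_add_right, q_smul_left, q_smul_right, M.q_self, M.q_comm (M y) (M x)]
    ring
  have hb : ∀ v, a * M.b (M x) v + c * M.b (M y) v = s * M.b (M z) v := by
    intro v
    rw [← b_smul_left, ← b_smul_left, ← b_smul_left, ← hs, b_add_left]
  have hx := hb (M x)
  have hy := hb (M y)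
  have hz := hb (M z)
  have hw := hb (M w)
  unfold h
  simp only [b_sub_left, b_sub_right, M.b_comm (M w), M.b_comm (M y) (M x), M.b_comm (M z) (M x),
    M.b_comm (M z) (M y)] at *
  by_cases hk : M.k = 0
  · rw [hk] at hq
    have hq' : s = a + c := by
      have : s ^ 2 = (a + c) ^ 2 := by linarith
      exact (pow_left_inj₀ hs0 (by positivity) two_ne_zero).1 this
    subst hq'
    linear_combination (-2 * (a + c)) * hw + a * hx + c * hy + (a+c) * hz
  · have e := M.b_self hk
    have hq2 : M.h x y = M.k - M.b (M x) (M y) := by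
      unfold h
      simp only [b_sub_left, b_sub_right, M.b_comm (M y) (M x), e]; ring
    simp only [hq2, e] at *
    linear_combination (-2 * (a + c + s) / 2) * hw - M.k * hq +
      (2 * a * c * (M.k - M.b (M x) (M y))) * M.k_sq hk

variable [Nonempty X]

/-- The point of `X` represented by a vector of the model quadric. -/
noncomputable def pt (w : E × ℝ) : X := Function.invFun M w

lemma M_pt {w : E × ℝ} (hw : ∃ z, M z = w) : M (M.pt w) = w := Function.invFun_eq hw

lemma pt_M (x : X) : M.pt (M x) = x := M.injective (M.M_pt ⟨x, rfl⟩)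

/-- The exponential map along the unit vector `v`. -/
noncomputable def exp (x : X) (v : E × ℝ) (t : ℝ) : X := M.pt (cs M.k t • M x + sn M.k t • v)

lemma M_exp {x : X} {v : E × ℝ} (hv : M.UT x v) (t : ℝ) :
    M (M.exp x v t) = cs M.k t • M x + sn M.k t • v := M.M_pt (M.exists_exp hv t)

lemma exp_zero (x : X) (v : E × ℝ) : M.exp x v 0 = x := by
  unfold exp; rw [cs_zero M.hk, sn_zero M.hk, one_smul, zero_smul, add_zero, pt_M]

lemma continuous_exp {x : X} {v : E × ℝ} (hv : M.UT x v) : Continuous (M.exp x v) := by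
  rw [M.isInducing.continuous_iff]
  have h1 := continuous_cs M.hk
  have h2 := continuous_sn M.hk
  have : (M ∘ M.exp x v) = fun t => cs M.k t • M x + sn M.k t • v := by
    ext1 t; exact M.M_exp hv t
  rw [this]; fun_prop

/-- Law of cosines, in polarized form. -/
lemma h_exp {x : X} {v : E × ℝ} (hv : M.UT x v) (z : X) (t : ℝ) :
    M.h z (M.exp x v t) =
      vs M.k t + cs M.k t * M.h z x - sn M.k t * M.b (M z - M x) v := by
  have h1 := M.kb_chord z x
  have h2 := M.kb_self x
  have h3 := M.kb_tan hv.tan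
  have h4 := mul_vs M.hk t
  have h5 := sn_sq M.hk t
  have e : M z - M (M.exp x v t) = (M z - M x) + ((M.k * vs M.k t) • M x - sn M.k t • v) := by
    rw [M_exp _ hv, h4, sub_smul, one_smul]; abel
  have e0 : M.h z (M.exp x v t) = M.b (M z - M (M.exp x v t)) (M z - M (M.exp x v t)) / 2 := rfl
  have e1 : M.b (M z - M x) (M z - M x) = 2 * M.h z x := by unfold h; ring
  rw [e0, e]
  generalize M z - M x = w at *
  simp only [b_add_left, b_add_right, b_sub_left, b_sub_right, b_smul_left, b_smul_right, hv.unit,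
    M.b_comm (M x) w, M.b_comm v w, M.b_comm v (M x), e1]
  linear_combination (vs M.k t) * h1 + (M.k * vs M.k t ^ 2 / 2) * h2
    - (vs M.k t * sn M.k t) * h3 + (1 / 2) * h5 + (vs M.k t ^ 2 / 2) * M.k_cube
    - (M.h z x - vs M.k t / 2) * h4

lemma b_exp_sub {x : X} {v : E × ℝ} (hv : M.UT x v) {w : E × ℝ} (hw : M.Tan x w) (t : ℝ) :
    M.b (M (M.exp x v t) - M x) w = sn M.k t * M.b v w := by
  have h4 := mul_vs M.hk t
  have h3 := M.kb_tan hw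
  rw [M_exp _ hv, b_sub_left, b_add_left, b_smul_left, b_smul_left]
  linear_combination (M.b (M x) w) * h4 - vs M.k t * h3

lemma h_exp_exp {x : X} {v : E × ℝ} (hv : M.UT x v) (s t : ℝ) :
    M.h (M.exp x v s) (M.exp x v t) = vs M.k (s - t) := by
  have h0 : M.h (M.exp x v s) x = vs M.k s := by
    rw [h_comm, h_exp _ hv, h_self, sub_self, b_zero_left]; ring
  rw [h_exp _ hv, h0, b_exp_sub _ hv hv.tan, hv.unit, vs_sub M.hk]
  have h1 := mul_vs M.hk s
  have h2 := mul_vs M.hk t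
  linear_combination (-vs M.k t) * h1 + vs M.k s * h2

lemma dist_exp_exp {x : X} {v : E × ℝ} (hv : M.UT x v) {s t : ℝ}
    (hst : M.k = 1 → |s - t| ≤ Real.pi) :
    dist (M.exp x v s) (M.exp x v t) = |s - t| := by
  refine vs_inj M.hk dist_nonneg (abs_nonneg _) (M.hpi' _ _) hst ?_
  rw [vs_abs M.hk, ← h_eq_vs, h_exp_exp _ hv]

lemma dist_exp {x : X} {v : E × ℝ} (hv : M.UT x v) {t : ℝ} (h0 : 0 ≤ t)
    (ht : M.k = 1 → t ≤ Real.pi) : dist x (M.exp x v t) = t := by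
  have := M.dist_exp_exp hv (s := 0) (t := t)
    (by intro hk; rw [zero_sub, abs_neg, abs_of_nonneg h0]; exact ht hk)
  rwa [exp_zero, zero_sub, abs_neg, abs_of_nonneg h0] at this

/-- Velocity of the geodesic `exp x v` at time `t`. -/
noncomputable def vel (x : X) (v : E × ℝ) (t : ℝ) : E × ℝ :=
  (-(M.k * sn M.k t)) • M x + cs M.k t • v

lemma vel_UT {x : X} {v : E × ℝ} (hv : M.UT x v) (t : ℝ) : M.UT (M.exp x v t) (M.vel x v t) := by
  have h1 := cs_sq M.hk t
  have h2 := M.kb_self x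
  have h3 := M.kb_tan hv.tan
  have ht := hv.tan
  unfold Tan at ht
  constructor
  · unfold Tan vel
    rw [M_exp _ hv]
    simp only [q_add_left, q_add_right, q_smul_left, q_smul_right, M.q_self, hv.q_self, ht,
      M.q_comm v (M x)]
    ring
  · unfold vel
    simp only [b_add_left, b_add_right, b_smul_left, b_smul_right, hv.unit, M.b_comm v (M x)]
    linear_combination (M.k * sn M.k t ^ 2) * h2 - (2 * sn M.k t * cs M.k t) * h3 + h1
      + sn M.k t ^ 2 * M.k_cube

lemma exp_vel {x : X} {v : E × ℝ} (hv : M.UT x v) (s t : ℝ) :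
    M.exp (M.exp x v s) (M.vel x v s) t = M.exp x v (s + t) := by
  apply M.injective
  rw [M_exp _ (M.vel_UT hv s), M_exp _ hv, M_exp _ hv, cs_add M.hk, sn_add M.hk, vel]
  module

end SF

namespace SF

variable {E : Type*} [NormedAddCommGroup E] [InnerProductSpace ℝ E]
variable (M : SF X E)

section tangent
variable [Fact (2 ≤ Module.finrank ℝ E)]

lemma exists_UT_orth (x : X) (n : E × ℝ) : ∃ v, M.UT x v ∧ M.b v n = 0 := by
  have hE : 2 ≤ Module.finrank ℝ E := Fact.out
  have : FiniteDimensional ℝ E := FiniteDimensional.of_finrank_pos (by omega)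
  let f : (E × ℝ) →ₗ[ℝ] ℝ × ℝ :=
    { toFun := fun v => (M.q (M x) v, M.b v n)
      map_add' := fun v w => by simp [q_add_right, b_add_left]
      map_smul' := fun c v => by simp [q_smul_right, b_smul_left] }
  have hker : LinearMap.ker f ≠ ⊥ := by
    apply LinearMap.ker_ne_bot_of_finrank_lt
    simp only [Module.finrank_prod, Module.finrank_self]; omega
  obtain ⟨v, hv, hv0⟩ := (Submodule.ne_bot_iff _).1 hker
  have hv' : f v = 0 := hv
  have h1 : M.Tan x v := congrArg Prod.fst hv'
  have h2 : M.b v n = 0 := congrArg Prod.snd hv'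
  have hp := M.tan_pos h1 hv0
  have hs : 0 < √(M.b v v) := Real.sqrt_pos.2 hp
  refine ⟨(√(M.b v v))⁻¹ • v, ⟨h1.smul _, ?_⟩, by rw [b_smul_left, h2, mul_zero]⟩
  rw [b_smul_left, b_smul_right]
  field_simp
  exact (Real.sq_sqrt hp.le).symm

lemma exists_UT (x : X) : ∃ v, M.UT x v := by
  obtain ⟨v, hv, -⟩ := M.exists_UT_orth x 0
  exact ⟨v, hv⟩

end tangent

lemma UT_normalize {x : X} {v : E × ℝ} (hv : M.Tan x v) (h0 : v ≠ 0) :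
    M.UT x ((√(M.b v v))⁻¹ • v) := by
  have hp := M.tan_pos hv h0
  have hs : 0 < √(M.b v v) := Real.sqrt_pos.2 hp
  refine ⟨hv.smul _, ?_⟩
  rw [b_smul_left, b_smul_right]
  field_simp
  exact (Real.sq_sqrt hp.le).symm

/-- Polar coordinates around `x`. -/
lemma exists_log [Fact (2 ≤ Module.finrank ℝ E)] (x y : X) :
    ∃ v, M.UT x v ∧ M y = cs M.k (dist x y) • M x + sn M.k (dist x y) • v := by
  set D := dist x y with hD
  have hh : M.h y x = vs M.k D := by rw [h_eq_vs, dist_comm]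
  have h1 := M.k_mul_h y x
  have h2 := mul_vs M.hk D
  rw [hh] at h1
  have hq : M.q (M y) (M x) = cs M.k D := by linarith
  have hb := M.b_tan_chord y x
  have ht := M.tan_chord y x
  have e : M y - M x + (M.k * M.h y x) • M x = M y - cs M.k D • M x := by
    rw [hh, h2]; module
  rw [e] at hb ht
  rw [hh, hq, ← sn_sq M.hk] at hb
  by_cases hs : sn M.k D = 0
  · obtain ⟨v, hv⟩ := M.exists_UT x
    refine ⟨v, hv, ?_⟩
    rw [hs] at hb
    have := M.tan_eq_zero ht (by simpa using hb)
    rw [sub_eq_zero] at this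
    rw [hs, zero_smul, add_zero, this]
  · refine ⟨(sn M.k D)⁻¹ • (M y - cs M.k D • M x), ⟨ht.smul _, ?_⟩, ?_⟩
    · rw [b_smul_left, b_smul_right, hb]; field_simp
    · rw [smul_smul, mul_inv_cancel₀ hs, one_smul]; abel

lemma eq_of_smul {z z' : X} {s s' : ℝ} (hs : 0 < s) (hs' : 0 ≤ s') (h : s • M z = s' • M z') :
    z = z' := by
  have h1 : M.q (s • M z) (s • M z) = s ^ 2 := by rw [q_smul_left, q_smul_right, q_self]; ring
  have h2 : M.q (s' • M z') (s' • M z') = s' ^ 2 := by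
    rw [q_smul_left, q_smul_right, q_self]; ring
  rw [h, h2] at h1
  have : s' = s := (pow_left_inj₀ hs' hs.le two_ne_zero).1 h1
  subst this
  exact M.injective (smul_right_injective _ hs.ne' h)

/-- The open cone over the model quadric. -/
def Om : Set (E × ℝ) := {w | 0 < M.q w w ∧ (M.k ≤ 0 → 0 < w.2)}

lemma isOpen_Om : IsOpen M.Om := by
  have h1 : IsOpen {w : E × ℝ | 0 < M.q w w} :=
    isOpen_lt continuous_const (by fun_prop : Continuous fun w : E × ℝ => M.q w w)
  have h2 : IsOpen {w : E × ℝ | 0 < w.2} := isOpen_lt continuous_const continuous_snd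
  by_cases hk : M.k ≤ 0
  · convert h1.inter h2 using 1
    ext w; simp [Om, hk]
  · convert h1 using 1
    ext w; simp [Om, hk]

lemma smul_mem_Om {s : ℝ} (hs : 0 < s) (z : X) : s • M z ∈ M.Om := by
  refine ⟨?_, fun hk => ?_⟩
  · rw [q_smul_left, q_smul_right, q_self]; positivity
  · exact mul_pos hs (M.pos_snd z hk)

lemma mem_Om (z : X) : M z ∈ M.Om := by simpa using M.smul_mem_Om one_pos z

lemma exists_of_mem_Om {w : E × ℝ} (hw : w ∈ M.Om) : ∃ z, M z = (√(M.q w w))⁻¹ • w := by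
  have hs : 0 < √(M.q w w) := Real.sqrt_pos.2 hw.1
  apply M.exists_pt
  · rw [q_smul_left, q_smul_right]
    field_simp
    exact (Real.sq_sqrt hw.1.le).symm
  · intro hk
    exact mul_pos (inv_pos.2 hs) (hw.2 hk)

variable [Nonempty X]

/-- Radial projection of the cone onto the model quadric. -/
noncomputable def nrm (w : E × ℝ) : X := M.pt ((√(M.q w w))⁻¹ • w)

lemma M_nrm {w : E × ℝ} (hw : w ∈ M.Om) : M (M.nrm w) = (√(M.q w w))⁻¹ • w :=
  M.M_pt (M.exists_of_mem_Om hw)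

lemma smul_nrm {w : E × ℝ} (hw : w ∈ M.Om) : √(M.q w w) • M (M.nrm w) = w := by
  have hs : 0 < √(M.q w w) := Real.sqrt_pos.2 hw.1
  rw [M.M_nrm hw, smul_smul, mul_inv_cancel₀ hs.ne', one_smul]

lemma nrm_smul {s : ℝ} (hs : 0 < s) (z : X) : M.nrm (s • M z) = z := by
  have hw := M.smul_mem_Om hs z
  refine M.eq_of_smul (Real.sqrt_pos.2 hw.1) hs.le ?_
  rw [M.smul_nrm hw]

lemma nrm_M (z : X) : M.nrm (M z) = z := by simpa using M.nrm_smul one_pos z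

lemma continuousAt_nrm {w : E × ℝ} (hw : w ∈ M.Om) : ContinuousAt M.nrm w := by
  have hs : 0 < √(M.q w w) := Real.sqrt_pos.2 hw.1
  unfold ContinuousAt
  rw [← M.tendsto_iff, M.M_nrm hw]
  have h1 : Tendsto (fun w => (√(M.q w w))⁻¹ • w) (nhds w) (nhds ((√(M.q w w))⁻¹ • w)) := by
    have : Continuous fun w => √(M.q w w) := by fun_prop
    exact ((this.tendsto w).inv₀ hs.ne').smul tendsto_id
  refine h1.congr' ?_
  filter_upwards [M.isOpen_Om.mem_nhds hw] with w' hw'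
  exact (M.M_nrm hw').symm

lemma exists_foot {p y : X} {a : E × ℝ} (ha : M.UT p a) (hq : M.k = 1 → 0 < M.q (M y) (M p)) :
    ∃ (p₀ : X) (t : ℝ), M.UT p₀ a ∧ M.b (M p - M p₀) a = 0 ∧ y = M.exp p₀ a t ∧
      0 < cs M.k t ∧ sn M.k t = M.b (M y - M p) a ∧ (M.k = 1 → |t| < Real.pi / 2) ∧
      cs M.k t * M.q (M p₀) (M p) = M.q (M y) (M p) := by
  set β := M.b (M y - M p) a with hβ
  have hat := ha.tan
  have hqa := M.q_tan hat y
  rw [← hβ] at hqa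
  have hkβ : M.k * β ^ 2 < 1 := by
    rcases M.hk with hk | hk | hk
    · have hq' := hq hk
      set w := M y - β • a with hw
      have ha2 := ha.q_self
      have e1 : M.q w w = 1 - β ^ 2 := by
        rw [hw]
        simp only [q_sub_left, q_sub_right, q_smul_left, q_smul_right, M.q_self,
          M.q_comm a, hqa, ha2, hk]
        ring
      have e2 : M.q w (M p) = M.q (M y) (M p) := by
        rw [hw, q_sub_left, q_smul_left, M.q_comm a, hat]; ring
      have e3 : 0 < M.q w w := by
        have hw0 : w ≠ 0 := by
          intro h0; rw [h0, q_zero_left] at e2; linarith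
        simp only [q, hk, one_mul]
        by_contra! hc
        have hi : (0 : ℝ) ≤ inner ℝ w.1 w.1 := real_inner_self_nonneg
        exact hw0 (Prod.ext (inner_self_eq_zero.1 (by nlinarith [mul_self_nonneg w.2] :
          inner ℝ w.1 w.1 = 0)) (mul_self_eq_zero.1 (by nlinarith [mul_self_nonneg w.2])))
      rw [hk]; linarith
    · rw [hk]; norm_num
    · rw [hk]; nlinarith [sq_nonneg β]
  obtain ⟨t, ht, hct, hpi⟩ := exists_sn_eq M.hk hkβ
  have hcs := cs_sq M.hk t
  rw [ht] at hcs
  set w := M y - β • a with hw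
  have ha2 := ha.q_self
  have e1 : M.q w w = cs M.k t ^ 2 := by
    rw [hw]
    simp only [q_sub_left, q_sub_right, q_smul_left, q_smul_right, M.q_self, M.q_comm a, hqa, ha2]
    linear_combination -hcs
  have e2 : M.q w (M p) = M.q (M y) (M p) := by
    rw [hw, q_sub_left, q_smul_left, M.q_comm a, hat]; ring
  have hwOm : w ∈ M.Om := by
    refine ⟨by rw [e1]; positivity, fun hk0 => ?_⟩
    rcases M.hk with hk | hk | hk
    · norm_num [hk] at hk0
    · simp [hw, M.tan_snd hk hat, M.snd_one hk]
    · have hqp := M.k_mul_h y p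
      have hnn := M.h_nonneg y p
      have hp2 := M.pos_snd p hk0
      have hpp := M.q_self p
      have hww : 0 < M.q w w := by rw [e1]; positivity
      have hwp : 0 < M.q w (M p) := by rw [e2]; rw [hk] at hqp; linarith
      simp only [q, hk] at hpp hww hwp
      by_contra! hc
      have cs := real_inner_mul_inner_self_le w.1 (M p).1
      have hi : (0 : ℝ) ≤ inner ℝ w.1 w.1 := real_inner_self_nonneg
      have hi' : (0 : ℝ) ≤ inner ℝ (M p).1 (M p).1 := real_inner_self_nonneg
      have h1 : w.2 * (M p).2 ≤ 0 := mul_nonpos_of_nonpos_of_nonneg hc hp2.le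
      have h2 : inner ℝ w.1 (M p).1 < w.2 * (M p).2 := by linarith
      have h3 : (w.2 * (M p).2) ^ 2 < inner ℝ w.1 (M p).1 ^ 2 := by nlinarith
      have h4 : inner ℝ w.1 w.1 * inner ℝ (M p).1 (M p).1 ≤ w.2 * w.2 * ((M p).2 * (M p).2) := by
        apply mul_le_mul <;> nlinarith
      nlinarith
  set p₀ := M.nrm w with hp₀
  have hM : cs M.k t • M p₀ = w := by
    have := M.smul_nrm hwOm
    rwa [e1, Real.sqrt_sq hct.le] at this
  have hta : M.Tan p₀ a := by
    have : cs M.k t * M.q (M p₀) a = 0 := by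
      rw [← q_smul_left, hM, hw, q_sub_left, q_smul_left, hqa, ha2]; ring
    exact (mul_eq_zero.1 this).resolve_left hct.ne'
  have hu : M.UT p₀ a := ⟨hta, ha.unit⟩
  have hqe : y = M.exp p₀ a t := by
    apply M.injective
    rw [M_exp _ hu, hM, ht, hw]; abel
  refine ⟨p₀, t, hu, ?_, hqe, hct, ht, hpi, ?_⟩
  · have h1 := M.b_exp_sub hu hta t
    rw [ha.unit, mul_one, ht, hβ, ← hqe] at h1
    have : M p - M p₀ = (M y - M p₀) - (M y - M p) := by abel
    rw [this, b_sub_left, h1, sub_self]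
  · rw [← q_smul_left, hM, e2]

/-- Distances in Fermi coordinates. -/
lemma h_fermi {p p₀ : X} {a : E × ℝ} (ha : M.UT p a) (ha₀ : M.UT p₀ a)
    (h0 : M.b (M p - M p₀) a = 0) (u r : ℝ) :
    M.h (M.exp p₀ a u) (M.exp p a r) = vs M.k (u - r) + cs M.k u * cs M.k r * M.h p p₀ := by
  have h1 : M.b (M (M.exp p a r) - M p₀) a = sn M.k r := by
    have := M.b_exp_sub ha ha.tan r
    rw [ha.unit, mul_one] at this
    rw [← this, ← sub_add_sub_cancel (M (M.exp p a r)) (M p) (M p₀), b_add_left, h0, add_zero]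
  have h2 : M.b (M p₀ - M p) a = 0 := by rw [← neg_sub, b_neg_left, h0, neg_zero]
  rw [h_comm, h_exp _ ha₀, h1, h_comm _ _ p₀, h_exp _ ha, h2, vs_sub M.hk, M.h_comm p₀]
  ring

/-- The generalized ball through `x` with inner normal `n` and boundary curvature `κ`. -/
def D (κ : ℝ) (x : X) (n : E × ℝ) : Set X := {z | κ * M.h z x ≤ M.b (M z - M x) n}

lemma mem_D {κ : ℝ} {x : X} {n : E × ℝ} {z : X} :
    z ∈ M.D κ x n ↔ κ * M.h z x ≤ M.b (M z - M x) n := Iff.rfl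

lemma D_anti {κ κ' : ℝ} (hκ : κ ≤ κ') (x : X) (n : E × ℝ) : M.D κ' x n ⊆ M.D κ x n :=
  fun z hz => (mul_le_mul_of_nonneg_right hκ (M.h_nonneg z x)).trans hz

lemma isClosed_D (κ : ℝ) (x : X) (n : E × ℝ) : IsClosed (M.D κ x n) := by
  have := M.continuous
  exact isClosed_le (by have := M.continuous_h x; fun_prop) (by fun_prop)

lemma mem_interior_D {κ : ℝ} {x : X} {n : E × ℝ} {z : X} (hz : κ * M.h z x < M.b (M z - M x) n) :
    z ∈ interior (M.D κ x n) := by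
  have := M.continuous
  have ho : IsOpen {z | κ * M.h z x < M.b (M z - M x) n} :=
    isOpen_lt (by have := M.continuous_h x; fun_prop) (by fun_prop)
  have hs : {z | κ * M.h z x < M.b (M z - M x) n} ⊆ M.D κ x n := by
    intro z hz
    have hz : κ * M.h z x < M.b (M z - M x) n := hz
    exact hz.le
  exact interior_maximal hs ho hz

lemma self_mem_D (κ : ℝ) (x : X) (n : E × ℝ) : x ∈ M.D κ x n := by
  simp [D, h_self, b_zero_left]

lemma dist_exp_le_iff {x : X} {n : E × ℝ} (hn : M.UT x n) {ρ : ℝ} (h0 : 0 < ρ)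
    (h1 : M.k = 1 → ρ < Real.pi) (z : X) :
    dist z (M.exp x n ρ) ≤ ρ ↔ z ∈ M.D (cs M.k ρ / sn M.k ρ) x n := by
  have hs := sn_pos M.hk h0 h1
  rw [M.dist_le_iff h0.le fun hk => (h1 hk).le, h_exp _ hn, D, mem_ofPred_eq, div_mul_eq_mul_div,
    div_le_iff₀ hs]
  constructor <;> intro h <;> nlinarith

lemma dist_exp_lt_iff {x : X} {n : E × ℝ} (hn : M.UT x n) {ρ : ℝ} (h0 : 0 < ρ)
    (h1 : M.k = 1 → ρ < Real.pi) (z : X) :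
    dist z (M.exp x n ρ) < ρ ↔ cs M.k ρ / sn M.k ρ * M.h z x < M.b (M z - M x) n := by
  have hs := sn_pos M.hk h0 h1
  rw [M.dist_lt_iff h0.le fun hk => (h1 hk).le, h_exp _ hn, div_mul_eq_mul_div, div_lt_iff₀ hs]
  constructor <;> intro h <;> nlinarith

lemma closedBall_eq_D {x : X} {n : E × ℝ} (hn : M.UT x n) {ρ : ℝ} (h0 : 0 < ρ)
    (h1 : M.k = 1 → ρ < Real.pi) :
    closedBall (M.exp x n ρ) ρ = M.D (cs M.k ρ / sn M.k ρ) x n :=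
  Set.ext fun z => M.dist_exp_le_iff hn h0 h1 z

/-! ### Convexity -/

variable [Fact (2 ≤ Module.finrank ℝ E)]

lemma sn_smul_exp {x : X} {v : E × ℝ} (hv : M.UT x v) (D t : ℝ) :
    sn M.k (D - t) • M x + sn M.k t • M (M.exp x v D) = sn M.k D • M (M.exp x v t) := by
  rw [M_exp _ hv, M_exp _ hv, sn_sub M.hk]
  module

/-- Convexity, in terms of linear combinations in the model. -/
lemma mem_of_combo {K : Set X} (hK : GConvex K) {x y z : X} (hx : x ∈ K) (hy : y ∈ K)
    {a c s : ℝ} (ha : 0 ≤ a) (hc : 0 ≤ c) (hs : 0 < s) (hz : a • M x + c • M y = s • M z) :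
    z ∈ K := by
  obtain ⟨v, hv, hlog⟩ := M.exists_log x y
  set D := dist x y with hD
  have hye : y = M.exp x v D := M.injective (by rw [M_exp _ hv, hlog])
  by_cases hxy : x = y
  · subst hxy
    rw [← add_smul] at hz
    rwa [M.eq_of_smul hs (add_nonneg ha hc) hz.symm]
  have hD0 : 0 < D := dist_pos.2 hxy
  have hDpi := M.hpi' x y
  by_cases hpi : M.k = 1 ∧ D = Real.pi
  · rw [hlog, hpi.1, hpi.2] at hz
    simp only [cs_one, Real.cos_pi, sn_one, Real.sin_pi] at hz
    have hlog' : M y = -M x := by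
      rw [hlog, hpi.1, hpi.2]; simp
    rcases le_total c a with h | h
    · have : s • M z = (a - c) • M x := by rw [← hz]; module
      rwa [M.eq_of_smul hs (sub_nonneg.2 h) this]
    · have : s • M z = (c - a) • M y := by rw [← hz, hlog']; module
      rwa [M.eq_of_smul hs (sub_nonneg.2 h) this]
  have hDlt : M.k = 1 → D < Real.pi := fun hk => (hDpi hk).lt_of_ne fun h => hpi ⟨hk, h⟩
  have hsD := sn_pos M.hk hD0 hDlt
  have hcont : Continuous fun t => a * sn M.k t - c * sn M.k (D - t) := by
    have := continuous_sn M.hk; fun_prop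
  obtain ⟨t, ⟨ht0, htD⟩, ht⟩ : (0 : ℝ) ∈ (fun t => a * sn M.k t - c * sn M.k (D - t)) '' Icc 0 D := by
    apply intermediate_value_Icc hD0.le hcont.continuousOn
    simp only [sub_zero, sub_self, sn_zero M.hk, mul_zero, zero_sub, sub_zero]
    exact ⟨neg_nonpos.2 (mul_nonneg hc hsD.le), mul_nonneg ha hsD.le⟩
  simp only at ht
  have hsn1 : 0 ≤ sn M.k t := by
    rcases ht0.eq_or_lt with h | h
    · rw [← h, sn_zero M.hk]
    · exact (sn_pos M.hk h fun hk => htD.trans_lt (hDlt hk)).le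
  have hsn2 : 0 ≤ sn M.k (D - t) := by
    rcases htD.eq_or_lt with h | h
    · rw [← h, sub_self, sn_zero M.hk]
    · exact (sn_pos M.hk (sub_pos.2 h) fun hk => by linarith [hDlt hk]).le
  set z' := M.exp x v t with hz'
  have hcomb := M.sn_smul_exp hv D t
  rw [← hye, ← hz'] at hcomb
  have hzz : z = z' := by
    rcases ht0.eq_or_lt with h | h
    · have hpos : 0 < sn M.k (D - t) := by rwa [← h, sub_zero]
      refine M.eq_of_smul (mul_pos hpos hs) (mul_nonneg ha hsD.le) ?_
      rw [mul_smul, ← hz, mul_smul, ← hcomb, smul_add, smul_add, smul_smul, smul_smul, smul_smul,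
        smul_smul, mul_comm _ c, sub_eq_zero.1 ht, mul_comm a]
    · have hpos : 0 < sn M.k t := sn_pos M.hk h fun hk => htD.trans_lt (hDlt hk)
      refine M.eq_of_smul (mul_pos hpos hs) (mul_nonneg hc hsD.le) ?_
      rw [mul_smul, ← hz, mul_smul, ← hcomb, smul_add, smul_add, smul_smul, smul_smul, smul_smul,
        smul_smul, mul_comm _ a, sub_eq_zero.1 ht, mul_comm c (sn M.k t)]
  rw [hzz]
  have hd1 : dist x z' = t := M.dist_exp hv ht0 fun hk => htD.trans (hDpi hk)
  have hd2 : dist z' y = D - t := by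
    rw [hye, hz', M.dist_exp_exp hv, abs_sub_comm, abs_of_nonneg (sub_nonneg.2 htD)]
    intro hk
    rw [abs_sub_comm, abs_of_nonneg (sub_nonneg.2 htD)]
    linarith [hDpi hk]
  refine hK x hx y hy z' ⟨by unfold Btw; rw [hd1, hd2]; linarith, fun w hw hxw => ?_⟩
  have hwy : dist y w = dist y z' := by
    unfold Btw at hw; rw [dist_comm y w, dist_comm y z']; linarith
  have s1 := M.stewart hcomb hsn2 hsn1 hsD.le w
  have s2 := M.stewart hcomb hsn2 hsn1 hsD.le z'
  rw [M.h_eq_vs x w, hxw, M.h_eq_vs y w, hwy, ← h_eq_vs, ← h_eq_vs] at s1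
  rw [h_self] at s2
  have : M.h z' w = 0 := by
    have h3 : (sn M.k (D - t) + sn M.k t + sn M.k D) * (sn M.k D * M.h z' w) = 0 := by linarith
    have h4 : 0 < sn M.k (D - t) + sn M.k t + sn M.k D := by linarith
    simpa [h4.ne', hsD.ne'] using h3
  exact (M.h_eq_zero.1 this).symm

/-- A point on an open segment towards an interior point is interior. -/
lemma mem_interior_of_combo {K : Set X} (hK : GConvex K) {x z z' : X} (hz : z ∈ K)
    (hz' : z' ∈ interior K) {a c s : ℝ} (ha : 0 ≤ a) (hc : 0 < c) (hs : 0 < s)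
    (hx : a • M z + c • M z' = s • M x) : x ∈ interior K := by
  rw [mem_interior_iff_mem_nhds] at hz' ⊢
  have e : s • M x - a • M z = c • M z' := by rw [← hx]; abel
  have hcont : Tendsto (fun x' => s • M x' - a • M z) (nhds x) (nhds (c • M z')) := by
    rw [← e]
    have := M.continuous
    exact Continuous.tendsto (by fun_prop) x
  have hOm := M.smul_mem_Om hc z'
  have h1 := hcont.eventually (M.isOpen_Om.mem_nhds hOm)
  have h2 : Tendsto (fun x' => M.nrm (s • M x' - a • M z)) (nhds x) (nhds z') := by
    have := (M.continuousAt_nrm hOm).tendsto.comp hcont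
    rwa [M.nrm_smul hc] at this
  filter_upwards [h1, h2.eventually hz'] with x' h1 h2
  have h1 : s • M x' - a • M z ∈ M.Om := h1
  have h2 : M.nrm (s • M x' - a • M z) ∈ K := h2
  refine M.mem_of_combo hK hz h2 ha (Real.sqrt_nonneg (M.q (s • M x' - a • M z)
    (s • M x' - a • M z))) hs ?_
  rw [M.smul_nrm h1]; abel

end SF

namespace SF

variable {E : Type*} [NormedAddCommGroup E] [InnerProductSpace ℝ E]
variable (M : SF X E)

/-! ### Congruences in the linear model -/

/-- The linear map `F` represents the congruence `f` in the model. -/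
structure Cong (f : X ≃ᵢ X) (F : E × ℝ →ₗ[ℝ] E × ℝ) : Prop where
  map : ∀ x, M (f x) = F (M x)
  q : ∀ v w, M.q (F v) (F w) = M.q v w
  b : ∀ v w, (M.k = 0 → v.2 = 0) → (M.k = 0 → w.2 = 0) → M.b (F v) (F w) = M.b v w

section cong
variable {M}

lemma Cong.tan {f : X ≃ᵢ X} {F : E × ℝ →ₗ[ℝ] E × ℝ} (hf : M.Cong f F) {x : X} {v : E × ℝ}
    (hv : M.Tan x v) : M.Tan (f x) (F v) := by
  unfold Tan; rw [hf.map, hf.q]; exact hv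

lemma Cong.b_tan {f : X ≃ᵢ X} {F : E × ℝ →ₗ[ℝ] E × ℝ} (hf : M.Cong f F) {x y : X}
    {v w : E × ℝ} (hv : M.Tan x v) (hw : M.Tan y w) : M.b (F v) (F w) = M.b v w :=
  hf.b _ _ (fun hk => M.tan_snd hk hv) (fun hk => M.tan_snd hk hw)

lemma chord_snd (hk : M.k = 0) (z x : X) : (M z - M x).2 = 0 := by
  simp [M.snd_one hk]

lemma Cong.b_sub {f : X ≃ᵢ X} {F : E × ℝ →ₗ[ℝ] E × ℝ} (hf : M.Cong f F) {x y : X}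
    {v : E × ℝ} (hv : M.Tan x v) (z : X) :
    M.b (M (f z) - M (f y)) (F v) = M.b (M z - M y) v := by
  rw [hf.map, hf.map, ← map_sub]
  exact hf.b _ _ (fun hk => M.chord_snd hk _ _) (fun hk => M.tan_snd hk hv)

lemma Cong.UT {f : X ≃ᵢ X} {F : E × ℝ →ₗ[ℝ] E × ℝ} (hf : M.Cong f F) {x : X} {v : E × ℝ}
    (hv : M.UT x v) : M.UT (f x) (F v) :=
  ⟨hf.tan hv.tan, by rw [hf.b_tan hv.tan hv.tan, hv.unit]⟩

lemma h_isom (f : X ≃ᵢ X) (x y : X) : M.h (f x) (f y) = M.h x y := by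
  rw [h_eq_vs, h_eq_vs, f.dist_eq]

lemma Cong.trans {f g : X ≃ᵢ X} {F G : E × ℝ →ₗ[ℝ] E × ℝ} (hf : M.Cong f F) (hg : M.Cong g G) :
    M.Cong (f.trans g) (G ∘ₗ F) where
  map x := by simp [hf.map, hg.map]
  q v w := by simp [hf.q, hg.q]
  b v w hv hw := by
    have key : ∀ v : E × ℝ, (M.k = 0 → v.2 = 0) → (M.k = 0 → (F v).2 = 0) := by
      intro v hv hk
      have := hf.q v v
      simpa [SF.q, hk, hv hk] using this
    simp only [LinearMap.comp_apply]
    rw [hg.b _ _ (key v hv) (key w hw), hf.b _ _ hv hw]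

lemma Cong.refl : M.Cong (IsometryEquiv.refl X) LinearMap.id := ⟨fun _ => rfl, fun _ _ => rfl,
  fun _ _ _ _ => rfl⟩

lemma Cong.mem_D {f : X ≃ᵢ X} {F : E × ℝ →ₗ[ℝ] E × ℝ} (hf : M.Cong f F) {x : X} {v : E × ℝ}
    (hv : M.Tan x v) {κ : ℝ} {z : X} : f z ∈ M.D κ (f x) (F v) ↔ z ∈ M.D κ x v := by
  have : Nonempty X := ⟨x⟩
  rw [SF.mem_D, SF.mem_D, h_isom, hf.b_sub hv]

lemma Cong.image_D {f : X ≃ᵢ X} {F : E × ℝ →ₗ[ℝ] E × ℝ} (hf : M.Cong f F) {x : X} {v : E × ℝ}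
    (hv : M.Tan x v) {κ : ℝ} : f '' M.D κ x v = M.D κ (f x) (F v) := by
  ext z
  constructor
  · rintro ⟨z, hz, rfl⟩; exact (hf.mem_D hv).2 hz
  · intro hz
    refine ⟨f.symm z, (hf.mem_D hv).1 ?_, f.apply_symm_apply z⟩
    rwa [f.apply_symm_apply]

end cong

/-! ### Reflections -/

/-- The affine functional vanishing on the mirror. -/
noncomputable def mu (a : E × ℝ) (c : ℝ) : E × ℝ →ₗ[ℝ] ℝ where
  toFun v := M.b v a - v.2 * c
  map_add' v w := by rw [b_add_left, Prod.snd_add]; ring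
  map_smul' s v := by rw [b_smul_left, Prod.smul_snd, smul_eq_mul, RingHom.id_apply, smul_eq_mul]; ring

lemma mu_apply (a : E × ℝ) (c : ℝ) (v : E × ℝ) : M.mu a c v = M.b v a - v.2 * c := rfl

/-- Data of a mirror hyperplane. -/
structure Mirror (a : E × ℝ) (c : ℝ) : Prop where
  pos : 0 < M.b a a
  snd : M.k = 0 → a.2 = 0
  off : M.k ≠ 0 → c = 0
  ne : ∃ z, M.mu a c (M z) ≠ 0

/-- The linear reflection. -/
noncomputable def lrefl (a : E × ℝ) (c : ℝ) : E × ℝ →ₗ[ℝ] E × ℝ :=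
  LinearMap.id - (LinearMap.toSpanSingleton ℝ _ a) ∘ₗ ((2 / M.b a a) • M.mu a c)

lemma lrefl_apply (a : E × ℝ) (c : ℝ) (v : E × ℝ) :
    M.lrefl a c v = v - (2 / M.b a a * M.mu a c v) • a := by
  simp [lrefl]

section mirror
variable {M} {a : E × ℝ} {c : ℝ}

lemma Mirror.mu_self (h : M.Mirror a c) : M.mu a c a = M.b a a := by
  rw [mu_apply]
  by_cases hk : M.k = 0
  · rw [h.snd hk]; ring
  · rw [h.off hk]; ring

lemma Mirror.mu_lrefl (h : M.Mirror a c) (v : E × ℝ) :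
    M.mu a c (M.lrefl a c v) = -M.mu a c v := by
  have := h.pos.ne'
  rw [lrefl_apply, map_sub, map_smul, h.mu_self, smul_eq_mul]
  field_simp
  ring

lemma Mirror.lrefl_lrefl (h : M.Mirror a c) (v : E × ℝ) :
    M.lrefl a c (M.lrefl a c v) = v := by
  rw [lrefl_apply, h.mu_lrefl, lrefl_apply]; module

lemma Mirror.q_left (h : M.Mirror a c) (v : E × ℝ) : M.q v a = M.k * M.mu a c v := by
  rw [mu_apply]
  by_cases hk : M.k = 0
  · simp [SF.q, hk, h.snd hk]
  · rw [h.off hk, M.b_eq _ _ hk]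
    linear_combination (-M.q v a) * M.k_sq hk

lemma Mirror.q_lrefl (h : M.Mirror a c) (v w : E × ℝ) :
    M.q (M.lrefl a c v) (M.lrefl a c w) = M.q v w := by
  have := h.pos.ne'
  have h1 := h.q_left a
  rw [h.mu_self] at h1
  rw [lrefl_apply, lrefl_apply]
  simp only [q_sub_left, q_sub_right, q_smul_left, q_smul_right, M.q_comm a w, h.q_left v,
    h.q_left w, h1]
  field_simp
  ring

lemma Mirror.b_lrefl (h : M.Mirror a c) (v w : E × ℝ) (hv : M.k = 0 → v.2 = 0)
    (hw : M.k = 0 → w.2 = 0) : M.b (M.lrefl a c v) (M.lrefl a c w) = M.b v w := by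
  have := h.pos.ne'
  have key : ∀ v : E × ℝ, (M.k = 0 → v.2 = 0) → M.b v a = M.mu a c v := by
    intro v hv
    rw [mu_apply]
    by_cases hk : M.k = 0
    · rw [hv hk]; ring
    · rw [h.off hk]; ring
  rw [lrefl_apply, lrefl_apply]
  simp only [b_sub_left, b_sub_right, b_smul_left, b_smul_right, M.b_comm a w, key v hv, key w hw]
  field_simp
  ring

lemma Mirror.exists_pt (h : M.Mirror a c) (z : X) : ∃ z', M z' = M.lrefl a c (M z) := by
  apply M.exists_pt
  · rw [h.q_lrefl, q_self]
  · intro hk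
    by_contra! hc
    rcases M.hk with hk1 | hk1 | hk1
    · rw [hk1] at hk; norm_num at hk
    · rw [lrefl_apply, Prod.snd_sub, Prod.smul_snd, h.snd hk1, M.snd_one hk1] at hc
      norm_num at hc
    · set w := M.lrefl a c (M z) with hw
      have hq : M.q w w = 1 := by rw [hw, h.q_lrefl, q_self]
      have hi : (0 : ℝ) ≤ inner ℝ w.1 w.1 := real_inner_self_nonneg
      have hw2 : w.2 ≠ 0 := by
        intro h0
        simp only [SF.q, h0, hk1] at hq
        linarith
      obtain ⟨z', hz'⟩ := M.exists_pt (w := -w) (by rw [q_neg_left, q_neg_right, hq, neg_neg])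
        (fun _ => by rw [Prod.snd_neg]; exact neg_pos.2 (lt_of_le_of_ne hc hw2))
      have h1 := M.k_mul_h z z'
      have h2 := M.h_nonneg z z'
      rw [hz', q_neg_right, hw, lrefl_apply, q_sub_right, q_smul_right, q_self, h.q_left, hk1] at h1
      have h3 : 0 < 2 / M.b a a := div_pos two_pos h.pos
      nlinarith [mul_nonneg h3.le (mul_self_nonneg (M.mu a c (M z)))]

variable [Nonempty X]

/-- The reflection in a mirror. -/
noncomputable def Mirror.refl (h : M.Mirror a c) : X ≃ᵢ X :=
  have hM : ∀ z, M (M.pt (M.lrefl a c (M z))) = M.lrefl a c (M z) := fun z => M.M_pt (h.exists_pt z)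
  have hinv : ∀ z, M.pt (M.lrefl a c (M (M.pt (M.lrefl a c (M z))))) = z := fun z => by
    rw [hM, h.lrefl_lrefl, pt_M]
  IsometryEquiv.mk ⟨fun z => M.pt (M.lrefl a c (M z)), fun z => M.pt (M.lrefl a c (M z)), hinv,
    hinv⟩ <| Isometry.of_dist_eq fun z w => M.dist_eq_of_h <| by
      show M.h (M.pt _) (M.pt _) = _
      unfold SF.h
      rw [hM, hM, ← map_sub, h.b_lrefl _ _ (fun hk => M.chord_snd hk _ _)
        (fun hk => M.chord_snd hk _ _)]

lemma Mirror.M_refl (h : M.Mirror a c) (z : X) : M (h.refl z) = M.lrefl a c (M z) :=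
  M.M_pt (h.exists_pt z)

lemma Mirror.cong (h : M.Mirror a c) : M.Cong h.refl (M.lrefl a c) :=
  ⟨h.M_refl, h.q_lrefl, h.b_lrefl⟩

lemma Mirror.refl_refl (h : M.Mirror a c) (z : X) : h.refl (h.refl z) = z := by
  apply M.injective
  rw [h.M_refl, h.M_refl, h.lrefl_lrefl]

lemma Mirror.mu_refl (h : M.Mirror a c) (z : X) :
    M.mu a c (M (h.refl z)) = -M.mu a c (M z) := by rw [h.M_refl, h.mu_lrefl]

lemma Mirror.refl_eq_self (h : M.Mirror a c) {z : X} : h.refl z = z ↔ M.mu a c (M z) = 0 := by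
  constructor
  · intro hz
    have := h.mu_refl z
    rw [hz] at this
    linarith
  · intro hz
    apply M.injective
    rw [h.M_refl, lrefl_apply, hz]
    simp

lemma continuous_mu (M : SF X E) (a : E × ℝ) (c : ℝ) : Continuous fun z => M.mu a c (M z) := by
  have := M.continuous
  simp only [mu_apply]
  fun_prop

lemma Mirror.isReflection (h : M.Mirror a c) : IsReflection h.refl := by
  have hc := M.continuous_mu a c
  obtain ⟨z, hz⟩ := h.ne
  refine ⟨IsometryEquiv.ext fun z => h.refl_refl z, fun he => hz ?_, fun hp => ?_⟩
  · rw [← h.refl_eq_self, he]; rfl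
  · have hp := hp {z | 0 < M.mu a c (M z)} {z | M.mu a c (M z) < 0}
      (isOpen_lt continuous_const hc) (isOpen_lt hc continuous_const)
      (fun z hz => ((lt_or_gt_of_ne (fun h0 => hz (h.refl_eq_self.2 h0))).symm))
    have hz' : h.refl z ≠ z := fun h0 => hz (h.refl_eq_self.1 h0)
    have hz'' : h.refl (h.refl z) ≠ h.refl z := fun h0 => hz' ((h.refl_refl z).symm.trans h0).symm
    have hmu := h.mu_refl z
    obtain ⟨w, -, hw1, hw2⟩ : ({z : X | h.refl z ≠ z} ∩
        ({z | 0 < M.mu a c (M z)} ∩ {z | M.mu a c (M z) < 0})).Nonempty := by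
      rcases lt_or_gt_of_ne hz with h1 | h1
      · exact hp ⟨h.refl z, hz'', by show 0 < M.mu a c (M (h.refl z)); linarith⟩ ⟨z, hz', h1⟩
      · exact hp ⟨z, hz', h1⟩ ⟨h.refl z, hz'', by show M.mu a c (M (h.refl z)) < 0; linarith⟩
    exact lt_asymm (show 0 < M.mu a c (M w) from hw1) hw2

end mirror

/-! ### Special mirrors -/

lemma mu_tan {x : X} {a : E × ℝ} (ha : M.Tan x a) (z : X) :
    M.mu a (M.b (M x) a) (M z) = M.b (M z - M x) a := by
  rw [mu_apply, b_sub_left]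
  by_cases hk : M.k = 0
  · rw [M.snd_one hk, one_mul]
  · rw [ha.b_zero hk]; ring

lemma mirror_tan [Nonempty X] {x : X} {a : E × ℝ} (ha : M.UT x a) :
    M.Mirror a (M.b (M x) a) where
  pos := by rw [ha.unit]; exact one_pos
  snd hk := M.tan_snd hk ha.tan
  off hk := ha.tan.b_zero hk
  ne := by
    refine ⟨M.exp x a 1, ?_⟩
    rw [M.mu_tan ha.tan, M.b_exp_sub ha ha.tan, ha.unit, mul_one]
    exact (sn_pos M.hk one_pos fun _ => by linarith [Real.pi_gt_three]).ne'

lemma lrefl_tan [Nonempty X] {x : X} {a v : E × ℝ} (ha : M.UT x a) {y : X} (hv : M.Tan y v) :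
    M.lrefl a (M.b (M x) a) v = v - (2 * M.b v a) • a := by
  rw [lrefl_apply, ha.unit, mu_apply]
  by_cases hk : M.k = 0
  · rw [M.tan_snd hk hv]; simp
  · rw [ha.tan.b_zero hk]; simp

lemma mirror_tan_self [Nonempty X] {x : X} {a : E × ℝ} (ha : M.UT x a) :
    (M.mirror_tan ha).refl x = x := by
  rw [Mirror.refl_eq_self, M.mu_tan ha.tan, sub_self, b_zero_left]

/-- Half the difference of the squared norms. -/
noncomputable def off (x y : X) : ℝ := M.b (M x + M y) (M x - M y) / 2

lemma mu_swap (x y z : X) : M.mu (M x - M y) (M.off x y) (M z) = M.h z y - M.h z x := by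
  have key : (M z).2 * M.off x y = M.off x y := by
    by_cases hk : M.k = 0
    · rw [M.snd_one hk, one_mul]
    · have : M.off x y = 0 := by
        unfold off
        simp only [b_add_left, b_sub_right, M.b_self hk, M.b_comm (M y) (M x)]
        ring
      rw [this, mul_zero]
  rw [mu_apply, key]
  unfold off h
  simp only [b_add_left, b_sub_right, b_sub_left, M.b_comm (M y) (M x), M.b_comm _ (M z)]
  ring

lemma mirror_swap {x y : X} (hxy : x ≠ y) : M.Mirror (M x - M y) (M.off x y) where
  pos := by
    have h1 : 0 < M.h x y := (M.h_nonneg x y).lt_of_ne fun h0 => hxy (M.h_eq_zero.1 h0.symm)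
    unfold h at h1; linarith
  snd hk := M.chord_snd hk _ _
  off hk := by
    unfold off
    simp only [b_add_left, b_sub_right, M.b_self hk, M.b_comm (M y) (M x)]
    ring
  ne := by
    refine ⟨x, ?_⟩
    rw [mu_swap, h_self, sub_zero]
    exact fun h0 => hxy (M.h_eq_zero.1 h0)

variable [Nonempty X]

lemma mirror_swap_apply {x y : X} (hxy : x ≠ y) : (M.mirror_swap hxy).refl x = y := by
  apply M.injective
  have h1 := (M.mirror_swap hxy).pos
  rw [Mirror.M_refl, lrefl_apply, mu_swap, h_self, sub_zero]
  unfold h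
  have : 2 / M.b (M x - M y) (M x - M y) * (M.b (M x - M y) (M x - M y) / 2) = 1 := by
    field_simp
  rw [this, one_smul]; abel

end SF

namespace SF

variable {E : Type*} [NormedAddCommGroup E] [InnerProductSpace ℝ E]
variable (M : SF X E)

lemma mem_Om_one (hk : M.k = 1) {w : E × ℝ} : w ∈ M.Om ↔ w ≠ 0 := by
  have hi : (0 : ℝ) ≤ inner ℝ w.1 w.1 := real_inner_self_nonneg
  constructor
  · rintro ⟨h, -⟩ rfl
    simp [q_zero_left] at h
  · intro h
    refine ⟨?_, fun h0 => by rw [hk] at h0; norm_num at h0⟩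
    by_contra! hc
    simp only [q, hk, one_mul] at hc
    exact h (Prod.ext (inner_self_eq_zero.1 (by nlinarith [mul_self_nonneg w.2] :
      inner ℝ w.1 w.1 = 0)) (mul_self_eq_zero.1 (by nlinarith [mul_self_nonneg w.2])))

lemma mem_Om_zero (hk : M.k = 0) {w : E × ℝ} : w ∈ M.Om ↔ 0 < w.2 := by
  constructor
  · rintro ⟨-, h⟩; exact h hk.le
  · intro h
    refine ⟨?_, fun _ => h⟩
    simp only [q, hk, zero_mul, add_zero]; positivity

lemma mem_Om_neg (hk : M.k = -1) {w : E × ℝ} : w ∈ M.Om ↔ ‖w.1‖ < w.2 := by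
  have hk0 : M.k ≤ 0 := by rw [hk]; norm_num
  have hn := norm_nonneg w.1
  have e : M.q w w = w.2 ^ 2 - ‖w.1‖ ^ 2 := by
    simp only [q, hk, real_inner_self_eq_norm_sq]; ring
  constructor
  · rintro ⟨h, h2⟩
    have h2 := h2 hk0
    rw [e] at h
    exact (abs_lt_of_sq_lt_sq' (by linarith) h2.le).2
  · intro h
    refine ⟨?_, fun _ => hn.trans_lt h⟩
    rw [e]; nlinarith

lemma smul_Om {s : ℝ} (hs : 0 < s) {w : E × ℝ} (hw : w ∈ M.Om) : s • w ∈ M.Om := by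
  refine ⟨?_, fun hk => mul_pos hs (hw.2 hk)⟩
  rw [q_smul_left, q_smul_right]
  have := hw.1
  positivity

lemma add_Om (hk : M.k ≤ 0) {w w' : E × ℝ} (hw : w ∈ M.Om) (hw' : w' ∈ M.Om) :
    w + w' ∈ M.Om := by
  rcases M.hk with h | h | h
  · rw [h] at hk; norm_num at hk
  · rw [mem_Om_zero _ h] at *
    exact add_pos hw hw'
  · rw [mem_Om_neg _ h] at *
    exact (norm_add_le _ _).trans_lt (add_lt_add hw hw')

lemma combo_Om {x y : X} {a c : ℝ} (ha : 0 ≤ a) (hc : 0 ≤ c) (h0 : a • M x + c • M y ≠ 0) :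
    a • M x + c • M y ∈ M.Om := by
  by_cases hk : M.k ≤ 0
  · rcases ha.eq_or_lt with rfl | ha
    · rcases hc.eq_or_lt with rfl | hc
      · simp at h0
      · simpa using M.smul_mem_Om hc y
    · rcases hc.eq_or_lt with rfl | hc
      · simpa using M.smul_mem_Om ha x
      · exact M.add_Om hk (M.smul_mem_Om ha x) (M.smul_mem_Om hc y)
  · rcases M.hk with h | h | h
    · exact (M.mem_Om_one h).2 h0
    · exact absurd h.le hk
    · rw [h] at hk; norm_num at hk

variable [Nonempty X]
variable {M}

lemma isPreconnected_side (a : E × ℝ) (c : ℝ) :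
    IsPreconnected {z | 0 < M.mu a c (M z)} := by
  have hconv : Convex ℝ {w : E × ℝ | w ∈ M.Om ∧ 0 < M.mu a c w} := by
    have key : {w : E × ℝ | w ∈ M.Om ∧ 0 < M.mu a c w} =
        {w : E × ℝ | (M.k ≤ 0 → w ∈ M.Om) ∧ 0 < M.mu a c w} := by
      ext w
      refine and_congr_left fun hw => ⟨fun h _ => h, fun hO => ?_⟩
      by_cases hk : M.k ≤ 0
      · exact hO hk
      · rcases M.hk with h | h | h
        · refine (M.mem_Om_one h).2 fun h0 => ?_
          rw [h0, map_zero] at hw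
          exact lt_irrefl _ hw
        · exact absurd h.le hk
        · rw [h] at hk; norm_num at hk
    rw [key, convex_iff_forall_pos]
    rintro w ⟨hw1, hw2⟩ w' ⟨hw1', hw2'⟩ s t hs ht -
    refine ⟨fun hk => M.add_Om hk (M.smul_Om hs (hw1 hk)) (M.smul_Om ht (hw1' hk)), ?_⟩
    rw [map_add, map_smul, map_smul, smul_eq_mul, smul_eq_mul]
    positivity
  have himg : {z | 0 < M.mu a c (M z)} = M.nrm '' {w : E × ℝ | w ∈ M.Om ∧ 0 < M.mu a c w} := by
    ext z
    constructor
    · intro hz; exact ⟨M z, ⟨M.mem_Om z, hz⟩, M.nrm_M z⟩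
    · rintro ⟨w, ⟨hw, hw2⟩, rfl⟩
      show 0 < M.mu a c (M (M.nrm w))
      rw [M.M_nrm hw, map_smul, smul_eq_mul]
      exact mul_pos (inv_pos.2 (Real.sqrt_pos.2 hw.1)) hw2
  rw [himg]
  exact hconv.isPreconnected.image _ fun w hw => (M.continuousAt_nrm hw.1).continuousWithinAt

lemma Mirror.neg {a : E × ℝ} {c : ℝ} (h : M.Mirror a c) : M.Mirror (-a) (-c) where
  pos := by rw [b_neg_left, b_neg_right, neg_neg]; exact h.pos
  snd hk := by simp [h.snd hk]
  off hk := by simp [h.off hk]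
  ne := by
    obtain ⟨z, hz⟩ := h.ne
    refine ⟨z, fun h0 => hz ?_⟩
    rw [mu_apply, b_neg_right] at h0
    rw [mu_apply]; linarith

lemma Mirror.mu_neg {a : E × ℝ} {c : ℝ} (v : E × ℝ) : M.mu (-a) (-c) v = -M.mu a c v := by
  rw [mu_apply, mu_apply, b_neg_right]; ring

lemma Mirror.subset_closure {a : E × ℝ} {c : ℝ} (h : M.Mirror a c) :
    {z | M.mu a c (M z) = 0} ⊆ closure {z | 0 < M.mu a c (M z)} := by
  intro z (hz : M.mu a c (M z) = 0)
  have ht : M.Tan z a := by unfold Tan; rw [h.q_left, hz, mul_zero]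
  have h0 : a ≠ 0 := by
    rintro rfl
    have := h.pos
    rw [b_zero_left] at this
    exact lt_irrefl _ this
  have hu := M.UT_normalize ht h0
  set u := (√(M.b a a))⁻¹ • a with hu'
  have hs := Real.sqrt_pos.2 h.pos
  have hcont := M.continuous_exp hu
  have hlim : Tendsto (M.exp z u) (nhdsWithin 0 (Ioi 0)) (nhds z) := by
    have := hcont.tendsto 0
    rw [exp_zero] at this
    exact this.mono_left nhdsWithin_le_nhds
  refine mem_closure_of_tendsto hlim ?_
  filter_upwards [Ioo_mem_nhdsGT (zero_lt_one' ℝ)] with t ht'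
  show 0 < M.mu a c (M (M.exp z u t))
  rw [M_exp _ hu, map_add, map_smul, hz, map_smul, hu', map_smul, h.mu_self, smul_zero, zero_add]
  have := sn_pos M.hk ht'.1 fun _ => by linarith [ht'.2, Real.pi_gt_three]
  have := h.pos
  simp only [smul_eq_mul]
  positivity

lemma Mirror.isPreconnected_compl {a : E × ℝ} {c : ℝ} (h : M.Mirror a c) {N : Set X}
    (hN : {z | M.mu a c (M z) ≠ 0} ⊆ N) {z₀ : X} (hz₀ : z₀ ∈ N) (h0 : M.mu a c (M z₀) = 0) :
    IsPreconnected N := by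
  set A := {z | 0 < M.mu a c (M z)} with hA
  set B := {z | 0 < M.mu (-a) (-c) (M z)} with hB
  set H := {z | M.mu a c (M z) = 0} with hH
  have hAN : A ⊆ N := fun z (hz : 0 < M.mu a c (M z)) => hN hz.ne'
  have hBN : B ⊆ N := fun z (hz : 0 < M.mu (-a) (-c) (M z)) => hN (by
    rw [mu_neg] at hz
    show M.mu a c (M z) ≠ 0
    linarith)
  have hcA : H ⊆ closure A := h.subset_closure
  have hcB : H ⊆ closure B := by
    intro z (hz : M.mu a c (M z) = 0)
    apply h.neg.subset_closure
    show M.mu (-a) (-c) (M z) = 0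
    rw [mu_neg, hz, neg_zero]
  have h1 : IsPreconnected (A ∪ (N ∩ H)) :=
    (isPreconnected_side a c).subset_closure subset_union_left
      (union_subset _root_.subset_closure (inter_subset_right.trans hcA))
  have h2 : IsPreconnected (B ∪ (N ∩ H)) :=
    (isPreconnected_side (-a) (-c)).subset_closure subset_union_left
      (union_subset _root_.subset_closure (inter_subset_right.trans hcB))
  have h3 := h1.union z₀ (Or.inr ⟨hz₀, h0⟩) (Or.inr ⟨hz₀, h0⟩) h2
  convert h3 using 1
  ext z
  constructor
  · intro hz
    rcases lt_trichotomy (M.mu a c (M z)) 0 with h4 | h4 | h4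
    · right; left
      show 0 < M.mu (-a) (-c) (M z)
      rw [mu_neg]; linarith
    · left; right; exact ⟨hz, h4⟩
    · left; left; exact h4
  · rintro ((hz | hz) | (hz | hz))
    · exact hAN hz
    · exact hz.1
    · exact hBN hz
    · exact hz.1

lemma reflection_unique {τ : X ≃ᵢ X} (hτ : IsReflection τ) {x y : X} (hxy : x ≠ y)
    (h : τ x = y) : τ = (M.mirror_swap hxy).refl := by
  have hm := M.mirror_swap hxy
  have hττ : ∀ z, τ (τ z) = z := fun z => DFunLike.congr_fun hτ.1 z
  have hfix : ∀ z, M.mu (M x - M y) (M.off x y) (M z) = 0 → τ z = z := by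
    by_contra! hc
    obtain ⟨z₀, h0, hz₀⟩ := hc
    refine hτ.2.2 (hm.isPreconnected_compl (N := {z | τ z ≠ z}) ?_ hz₀ h0)
    intro z (hz : M.mu (M x - M y) (M.off x y) (M z) ≠ 0) (hτz : τ z = z)
    apply hz
    rw [mu_swap, ← M.h_isom τ z x, hτz, h, sub_self]
  set σ := (M.mirror_swap hxy).refl with hσ
  have hσ1 : σ x = y := M.mirror_swap_apply hxy
  have hη : ∀ z, τ (σ z) = z := by
    intro z
    by_contra hz
    set z' := τ (σ z) with hz'
    set φ := M.mu (M z' - M z) (M.off z' z) with hφ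
    have hφ0 : ∀ p, τ (σ p) = p → φ (M p) = 0 := by
      intro p hp
      rw [hφ, mu_swap]
      have h1 := M.h_isom τ (σ p) (σ z)
      rw [hp, h_isom] at h1
      rw [h1, sub_self]
    have hσfix : ∀ p, M.mu (M x - M y) (M.off x y) (M p) = 0 → τ (σ p) = p := by
      intro p hp
      have := (M.mirror_swap hxy).refl_eq_self.2 hp
      rw [← hσ] at this
      rw [this, hfix p hp]
    have hsym : ∀ p, φ (M p + M (σ p)) = 0 := by
      intro p
      by_cases h0 : M p + M (σ p) = 0
      · rw [h0, map_zero]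
      have hO : M p + M (σ p) ∈ M.Om := by
        simpa using M.combo_Om (x := p) (y := σ p) zero_le_one zero_le_one (by simpa using h0)
      rw [← M.smul_nrm hO, map_smul, hφ0 _ (hσfix _ ?_), smul_zero]
      rw [M.M_nrm hO, map_smul, map_add, hm.mu_refl, add_neg_cancel, smul_zero]
    have hlin : ∀ p, φ (M p) = 1 / M.b (M x - M y) (M x - M y) *
        M.mu (M x - M y) (M.off x y) (M p) * φ (M x - M y) := by
      intro p
      have h1 := hsym p
      have hp := hm.pos
      rw [hm.M_refl, lrefl_apply, map_add, map_sub, map_smul, smul_eq_mul] at h1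
      field_simp at h1 ⊢
      linarith
    have hx0 : φ (M x) = 0 := hφ0 x (by rw [hσ1, ← h, hττ])
    have hmx : M.mu (M x - M y) (M.off x y) (M x) ≠ 0 := by
      rw [mu_swap, h_self, sub_zero]
      exact fun h0 => hxy (M.h_eq_zero.1 h0)
    have ha : φ (M x - M y) = 0 := by
      have h1 := hlin x
      rw [hx0] at h1
      have hp := hm.pos.ne'
      rcases mul_eq_zero.1 h1.symm with h2 | h2
      · exact absurd h2 (mul_ne_zero (one_div_ne_zero hp) hmx)
      · exact h2
    have hz0 : φ (M z) = 0 := by rw [hlin, ha, mul_zero]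
    rw [hφ, mu_swap, h_self, zero_sub, neg_eq_zero] at hz0
    exact hz (M.h_eq_zero.1 hz0).symm
  ext z
  have := hη (σ z)
  rw [hσ, (M.mirror_swap hxy).refl_refl] at this
  exact this

end SF

namespace SF

variable {E : Type*} [NormedAddCommGroup E] [InnerProductSpace ℝ E]
variable (M : SF X E) [Nonempty X]

/-- Products of `n` reflections, together with their linear representatives. -/
inductive RProd : ℕ → (X ≃ᵢ X) → (E × ℝ →ₗ[ℝ] E × ℝ) → Prop
  | refl : RProd 0 (IsometryEquiv.refl X) LinearMap.id
  | snoc {n : ℕ} {f : X ≃ᵢ X} {F : E × ℝ →ₗ[ℝ] E × ℝ} {a : E × ℝ} {c : ℝ} (h : M.Mirror a c) :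
      RProd n f F → RProd (n + 1) (f.trans h.refl) (M.lrefl a c ∘ₗ F)

variable {M}

lemma RProd.cong {n : ℕ} {f : X ≃ᵢ X} {F : E × ℝ →ₗ[ℝ] E × ℝ} (hf : M.RProd n f F) :
    M.Cong f F := by
  induction hf with
  | refl => exact Cong.refl
  | snoc h _ ih => exact ih.trans h.cong

lemma RProd.trans {m n : ℕ} {f g : X ≃ᵢ X} {F G : E × ℝ →ₗ[ℝ] E × ℝ} (hf : M.RProd m f F)
    (hg : M.RProd n g G) : M.RProd (m + n) (f.trans g) (G ∘ₗ F) := by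
  induction hg with
  | refl => exact hf
  | snoc h _ ih => exact ih.snoc h

lemma RProd.mirror {a : E × ℝ} {c : ℝ} (h : M.Mirror a c) : M.RProd 1 h.refl (M.lrefl a c) :=
  RProd.refl.snoc h

lemma foldr_trans (l : List (X ≃ᵢ X)) (g : X ≃ᵢ X) :
    l.foldr IsometryEquiv.trans g = (l.foldr IsometryEquiv.trans (IsometryEquiv.refl X)).trans g := by
  induction l with
  | nil => rfl
  | cons σ l ih => rw [List.foldr_cons, List.foldr_cons, ih]; rfl

lemma RProd.exists_list {n : ℕ} {f : X ≃ᵢ X} {F : E × ℝ →ₗ[ℝ] E × ℝ} (hf : M.RProd n f F) :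
    ∃ l : List (X ≃ᵢ X), (∀ σ ∈ l, IsReflection σ) ∧ l.length = n ∧
      f = l.foldr IsometryEquiv.trans (IsometryEquiv.refl X) := by
  induction hf with
  | refl => exact ⟨[], by simp, rfl, rfl⟩
  | snoc h _ ih =>
    obtain ⟨l, h1, h2, h3⟩ := ih
    refine ⟨l ++ [h.refl], ?_, by simp [h2], ?_⟩
    · intro σ hσ
      rcases List.mem_append.1 hσ with hσ | hσ
      · exact h1 σ hσ
      · rw [List.mem_singleton.1 hσ]; exact h.isReflection
    · rw [List.foldr_append, foldr_trans, h3]; rfl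

lemma RProd.op {n : ℕ} {f : X ≃ᵢ X} {F : E × ℝ →ₗ[ℝ] E × ℝ} (hf : M.RProd n f F)
    (hn : Even n) : OrientationPreserving f := by
  obtain ⟨l, h1, h2, h3⟩ := hf.exists_list
  exact ⟨l, h1, by rwa [h2], h3⟩

/-! ### Transitivity on frames -/

variable (M)

lemma exists_tan_refl {y : X} {v v' : E × ℝ} (hv : M.Tan y v) (hv' : M.Tan y v')
    (hb : M.b v v = M.b v' v') (hne : v ≠ v') :
    ∃ f F, M.RProd 1 f F ∧ f y = y ∧ F v = v' ∧ ∀ w, M.Tan y w → M.b w (v - v') = 0 → F w = w := by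
  have ht := hv.sub hv'
  have h0 := sub_ne_zero.2 hne
  have hu := M.UT_normalize ht h0
  have hp := M.tan_pos ht h0
  have hs := Real.sqrt_pos.2 hp
  have hss := Real.sq_sqrt hp.le
  set s := √(M.b (v - v') (v - v'))
  have e : M.b (v - v') (v - v') = 2 * M.b v (v - v') := by
    simp only [b_sub_left, b_sub_right, M.b_comm v' v]; linarith
  refine ⟨_, _, RProd.mirror (M.mirror_tan hu), M.mirror_tan_self hu, ?_, ?_⟩
  · rw [M.lrefl_tan hu hv, b_smul_right, smul_smul]
    have : 2 * (s⁻¹ * M.b v (v - v')) * s⁻¹ = 1 := by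
      field_simp; linarith
    rw [this, one_smul]; abel
  · intro w hw h
    rw [M.lrefl_tan hu hw, b_smul_right, h]; simp

lemma exists_frame {x y : X} {n m : E × ℝ} (hn : M.UT x n) (hm : M.UT y m) :
    ∃ i f F, M.RProd i f F ∧ f x = y ∧ F n = m := by
  obtain ⟨i, f, F, hf, hx⟩ : ∃ i f F, M.RProd i f F ∧ f x = y := by
    by_cases hxy : x = y
    · exact ⟨_, _, _, RProd.refl, hxy⟩
    · exact ⟨_, _, _, RProd.mirror (M.mirror_swap hxy), M.mirror_swap_apply hxy⟩
  have hn' := hf.cong.UT hn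
  rw [hx] at hn'
  by_cases hnm : F n = m
  · exact ⟨i, f, F, hf, hx, hnm⟩
  · obtain ⟨g, G, hg, h1, h2, -⟩ := M.exists_tan_refl hn'.tan hm.tan (hn'.unit.trans hm.unit.symm) hnm
    exact ⟨_, _, _, hf.trans hg, by simp [hx, h1], by simp [h2]⟩

variable [Fact (2 ≤ Module.finrank ℝ E)]

lemma exists_frame_refl {y : X} {m : E × ℝ} (hm : M.UT y m) :
    ∃ f F, M.RProd 1 f F ∧ f y = y ∧ F m = m := by
  obtain ⟨w, hw, hwm⟩ := M.exists_UT_orth y m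
  refine ⟨_, _, RProd.mirror (M.mirror_tan hw), M.mirror_tan_self hw, ?_⟩
  rw [M.lrefl_tan hw hm.tan, b_comm, hwm]; simp

lemma exists_frame_odd {x y : X} {n m : E × ℝ} (hn : M.UT x n) (hm : M.UT y m) :
    ∃ i f F, Odd i ∧ M.RProd i f F ∧ f x = y ∧ F n = m := by
  obtain ⟨i, f, F, hf, hx, hF⟩ := M.exists_frame hn hm
  rcases Nat.even_or_odd i with hi | hi
  · obtain ⟨g, G, hg, h1, h2⟩ := M.exists_frame_refl hm
    exact ⟨_, _, _, hi.add_one, hf.trans hg, by simp [hx, h1], by simp [hF, h2]⟩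
  · exact ⟨i, f, F, hi, hf, hx, hF⟩

lemma exists_rotation {x : X} {n v w : E × ℝ} (hn : M.UT x n) (hv : M.UT x v) (hw : M.UT x w)
    (hvn : M.b v n = 0) (hwn : M.b w n = 0) (hvw : M.b v w = 0) (θ : ℝ) :
    ∃ i f F, Even i ∧ M.RProd i f F ∧ f x = x ∧ F n = n ∧
      F v = Real.cos θ • v + Real.sin θ • w := by
  set v' := Real.cos θ • v + Real.sin θ • w with hv'
  by_cases hne : v = v'
  · exact ⟨0, _, _, Even.zero, RProd.refl, rfl, rfl, hne⟩
  have ht : M.Tan x v' := (hv.tan.smul _).add (hw.tan.smul _)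
  have hb : M.b v v = M.b v' v' := by
    simp only [hv', b_add_left, b_add_right, b_smul_left, b_smul_right, hv.unit, hw.unit, hvw,
      M.b_comm w v]
    linear_combination -Real.sin_sq_add_cos_sq θ
  obtain ⟨g, G, hg, h1, h2, h3⟩ := M.exists_tan_refl hv.tan ht hb hne
  refine ⟨_, _, _, even_two, (RProd.mirror (M.mirror_tan hw)).trans hg, ?_, ?_, ?_⟩
  · rw [IsometryEquiv.trans_apply, M.mirror_tan_self hw, h1]
  · rw [LinearMap.comp_apply, M.lrefl_tan hw hn.tan, M.b_comm n, hwn, mul_zero, zero_smul, sub_zero]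
    refine h3 n hn.tan ?_
    rw [b_comm]
    simp only [hv', b_sub_left, b_add_left, b_smul_left, hvn, hwn]; ring
  · rw [LinearMap.comp_apply, M.lrefl_tan hw hv.tan, hvw, mul_zero, zero_smul, sub_zero, h2]

end SF

lemma eventually_vs_lt {k : ℝ} (hk : IsCurv k) (κ : ℝ) {β : ℝ} (hβ : 0 < β) :
    ∀ᶠ t in nhdsWithin (0 : ℝ) (Ioi 0), κ * vs k t < β * sn k t := by
  have h1 : Tendsto (fun t => β * cs k (t / 2) - κ * sn k (t / 2)) (nhds 0) (nhds β) := by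
    have h2 := continuous_cs hk
    have h3 := continuous_sn hk
    have : Continuous fun t => β * cs k (t / 2) - κ * sn k (t / 2) := by fun_prop
    simpa [cs_zero hk, sn_zero hk] using this.tendsto 0
  filter_upwards [nhdsWithin_le_nhds (h1.eventually (lt_mem_nhds hβ)),
    Ioo_mem_nhdsGT (zero_lt_one' ℝ)] with t h ht
  have hs : 0 < sn k (t / 2) := sn_pos hk (half_pos ht.1) fun _ => by
    linarith [ht.2, Real.pi_gt_three]
  have e : sn k t = 2 * sn k (t / 2) * cs k (t / 2) := by
    have := sn_add hk (t / 2) (t / 2)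
    rw [add_halves] at this
    rw [this]; ring
  rw [e, vs]
  nlinarith

lemma frontier_of_mem {K : Set X} {x : X} (h1 : x ∈ K) (h2 : x ∉ interior K) : x ∈ frontier K :=
  ⟨subset_closure h1, h2⟩

namespace SF

variable {E : Type*} [NormedAddCommGroup E] [InnerProductSpace ℝ E]
variable (M : SF X E)

/-- `n` is the inner unit normal of `K` at `x`, where `K` contains a ball touching at `x`. -/
structure IsNormal (K : Set X) (x : X) (n : E × ℝ) : Prop where
  ut : M.UT x n
  sup : K ⊆ M.D 0 x n
  inner : ∃ κ, 1 < κ ∧ M.D κ x n ⊆ K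

/-- `K` is strictly curved at `x`. -/
def SC (K : Set X) (x : X) (n : E × ℝ) : Prop :=
  ∃ κ > 0, ∀ᶠ z in nhds x, z ∈ K → z ∈ M.D κ x n

variable [Nonempty X] [Fact (2 ≤ Module.finrank ℝ E)]

lemma mem_D_zero {x z : X} {n : E × ℝ} : z ∈ M.D 0 x n ↔ 0 ≤ M.b (M z - M x) n := by
  rw [mem_D, zero_mul]

lemma eventually_exp_mem_D {x : X} {u n : E × ℝ} (hu : M.UT x u) (hn : M.UT x n)
    (h : 0 < M.b u n) (κ : ℝ) :
    ∀ᶠ t in nhdsWithin (0 : ℝ) (Ioi 0), M.exp x u t ∈ interior (M.D κ x n) := by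
  filter_upwards [eventually_vs_lt M.hk κ h] with t ht
  apply M.mem_interior_D
  rw [M.b_exp_sub hu hn.tan, h_comm, h_exp _ hu, h_self, sub_self, b_zero_left, mul_zero, mul_zero,
    add_zero, sub_zero]
  linarith

lemma eventually_sn_pos : ∀ᶠ t in nhdsWithin (0 : ℝ) (Ioi 0), 0 < sn M.k t := by
  filter_upwards [Ioo_mem_nhdsGT (zero_lt_one' ℝ)] with t ht
  exact sn_pos M.hk ht.1 fun _ => by linarith [ht.2, Real.pi_gt_three]

lemma tendsto_exp_zero {x : X} {u : E × ℝ} (hu : M.UT x u) :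
    Tendsto (M.exp x u) (nhdsWithin 0 (Ioi 0)) (nhds x) := by
  have := (M.continuous_exp hu).tendsto 0
  rw [exp_zero] at this
  exact this.mono_left nhdsWithin_le_nhds

/-- Two locally tangent convex pieces share the normal. -/
lemma normal_unique_of_subset {A : Set X} {x : X} {n n' : E × ℝ} {κ : ℝ} (hn : M.UT x n)
    (hn' : M.UT x n') (hA : M.D κ x n ⊆ A) (hA' : ∀ᶠ z in nhds x, z ∈ A → z ∈ M.D 0 x n') :
    n = n' := by
  by_contra hne
  have ht := hn.tan.sub hn'.tan
  have h0 := sub_ne_zero.2 hne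
  have hp := M.tan_pos ht h0
  have hu := M.UT_normalize ht h0
  have hs := Real.sqrt_pos.2 hp
  set s := √(M.b (n - n') (n - n'))
  have e : M.b (n - n') (n - n') = 2 - 2 * M.b n n' := by
    simp only [b_sub_left, b_sub_right, M.b_comm n' n, hn.unit, hn'.unit]; ring
  have e1 : 0 < M.b (s⁻¹ • (n - n')) n := by
    rw [b_smul_left, b_sub_left, hn.unit, M.b_comm n' n]
    exact mul_pos (inv_pos.2 hs) (by linarith)
  have e2 : M.b (s⁻¹ • (n - n')) n' < 0 := by
    rw [b_smul_left, b_sub_left, hn'.unit]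
    exact mul_neg_of_pos_of_neg (inv_pos.2 hs) (by linarith)
  obtain ⟨t, h1, h2, h3⟩ := ((M.eventually_exp_mem_D hu hn e1 κ).and
    (((M.tendsto_exp_zero hu).eventually hA').and M.eventually_sn_pos)).exists
  have h4 := h2 (hA (interior_subset h1))
  rw [mem_D_zero, M.b_exp_sub hu hn'.tan] at h4
  nlinarith

variable {M}

lemma IsNormal.mem {K : Set X} {x : X} {n : E × ℝ} (h : M.IsNormal K x n) : x ∈ K := by
  obtain ⟨κ, -, hκ⟩ := h.inner
  exact hκ (M.self_mem_D κ x n)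

lemma IsNormal.not_mem_interior {K : Set X} {x : X} {n : E × ℝ} (h : M.IsNormal K x n) :
    x ∉ interior K := by
  intro hx
  have h1 := (M.tendsto_exp_zero h.ut.neg).eventually (mem_interior_iff_mem_nhds.1 hx)
  obtain ⟨t, h1, h2⟩ := (h1.and M.eventually_sn_pos).exists
  have h1 : M.exp x (-n) t ∈ K := h1
  have h3 := h.sup h1
  rw [mem_D_zero, M.b_exp_sub h.ut.neg h.ut.tan, b_neg_left, h.ut.unit] at h3
  linarith

lemma IsNormal.frontier {K : Set X} {x : X} {n : E × ℝ} (h : M.IsNormal K x n) :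
    x ∈ frontier K := frontier_of_mem h.mem h.not_mem_interior

lemma IsNormal.unique {K : Set X} {x : X} {n n' : E × ℝ} (h : M.IsNormal K x n)
    (h' : M.IsNormal K x n') : n = n' := by
  obtain ⟨κ, -, hκ⟩ := h.inner
  exact M.normal_unique_of_subset h.ut h'.ut hκ (Eventually.of_forall h'.sup)

lemma IsNormal.image {K : Set X} {x : X} {n : E × ℝ} (h : M.IsNormal K x n) {f : X ≃ᵢ X}
    {F : E × ℝ →ₗ[ℝ] E × ℝ} (hf : M.Cong f F) : M.IsNormal (f '' K) (f x) (F n) where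
  ut := hf.UT h.ut
  sup := by rw [← hf.image_D h.ut.tan]; exact image_mono h.sup
  inner := by
    obtain ⟨κ, h1, hκ⟩ := h.inner
    refine ⟨κ, h1, ?_⟩
    rw [← hf.image_D h.ut.tan]; exact image_mono hκ

lemma SC.image {K : Set X} {x : X} {n : E × ℝ} (h : M.SC K x n) (hn : M.Tan x n) {f : X ≃ᵢ X}
    {F : E × ℝ →ₗ[ℝ] E × ℝ} (hf : M.Cong f F) : M.SC (f '' K) (f x) (F n) := by
  obtain ⟨κ, h0, hκ⟩ := h
  refine ⟨κ, h0, ?_⟩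
  have e : nhds (f x) = Filter.map f (nhds x) := (f.toHomeomorph.map_nhds_eq x).symm
  rw [e, eventually_map]
  filter_upwards [hκ] with z hz hfz
  rw [hf.mem_D hn]
  obtain ⟨w, hw, hwz⟩ := hfz
  exact hz (f.injective hwz ▸ hw)

lemma SC.congr {K L : Set X} {x : X} {n : E × ℝ} (h : M.SC K x n)
    (hKL : ∀ᶠ z in nhds x, (z ∈ K ↔ z ∈ L)) : M.SC L x n := by
  obtain ⟨κ, h0, hκ⟩ := h
  refine ⟨κ, h0, ?_⟩
  filter_upwards [hκ, hKL] with z h1 h2 h3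
  exact h1 (h2.2 h3)

variable (M)

lemma exists_normal {K : Set X} (hK : GConvex K) (hball : CondBallInside K) {x : X}
    (hx : x ∈ frontier K) : ∃ n, M.IsNormal K x n := by
  obtain ⟨ε, hε, p, hp, hxp⟩ := hball x hx
  have hd : dist x p = ε := hxp
  obtain ⟨n, hn, hlog⟩ := M.exists_log x p
  rw [hd] at hlog
  have hpe : p = M.exp x n ε := M.injective (by rw [M_exp _ hn, hlog])
  have hεpi : M.k = 1 → ε < Real.pi := by
    intro hk
    refine lt_of_le_of_ne (hd ▸ M.hpi' x p hk) fun he => ?_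
    have : K = univ := by
      refine eq_univ_of_forall fun z => hp ?_
      rw [mem_closedBall, he]
      exact M.hpi' z p hk
    rw [this, frontier_univ] at hx
    exact hx
  rw [hpe, M.closedBall_eq_D hn hε hεpi] at hp
  set κ := max (cs M.k ε / sn M.k ε) 2
  have hκ : M.D κ x n ⊆ K := (M.D_anti (le_max_left _ _) x n).trans hp
  refine ⟨n, hn, fun z hz => ?_, κ, lt_of_lt_of_le one_lt_two (le_max_right _ _), hκ⟩
  rw [mem_D_zero]
  by_contra! hb
  obtain ⟨u, hu, hz'⟩ := M.exists_log x z
  set d := dist x z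
  have hze : z = M.exp x u d := M.injective (by rw [M_exp _ hu, hz'])
  rw [hze, M.b_exp_sub hu hn.tan] at hb
  have hd0 : 0 < d := by
    refine dist_nonneg.lt_of_ne fun h0 => ?_
    rw [show d = 0 from h0.symm, sn_zero M.hk, zero_mul] at hb
    exact lt_irrefl _ hb
  have hdpi : M.k = 1 → d < Real.pi := by
    intro hk
    refine lt_of_le_of_ne (M.hpi' x z hk) fun he => ?_
    rw [show d = Real.pi from he, hk] at hb
    simp at hb
  have hsd := sn_pos M.hk hd0 hdpi
  have hun : 0 < M.b (-u) n := by rw [b_neg_left]; nlinarith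
  obtain ⟨t, h1, h2, h3⟩ : ∃ t, M.exp x (-u) t ∈ interior (M.D κ x n) ∧ 0 < sn M.k t ∧
      0 < sn M.k (t + d) := by
    have h4 : ∀ᶠ t in nhdsWithin (0 : ℝ) (Ioi 0), 0 < sn M.k (t + d) := by
      have := continuous_sn M.hk
      have h5 : Continuous fun t => sn M.k (t + d) := by fun_prop
      have h6 := h5.tendsto 0
      rw [zero_add] at h6
      exact nhdsWithin_le_nhds (h6.eventually (lt_mem_nhds hsd))
    exact ((M.eventually_exp_mem_D hu.neg hn hun κ).and (M.eventually_sn_pos.and h4)).exists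
  have hxi : x ∈ interior K := by
    refine M.mem_interior_of_combo hK hz (interior_mono hκ h1) h2.le hsd h3 ?_
    rw [hze, M_exp _ hu, M_exp _ hu.neg, sn_add M.hk]
    module
  exact hx.2 hxi

lemma GConvex_image {K : Set X} (hK : GConvex K) (f : X ≃ᵢ X) : GConvex (f '' K) := by
  rintro _ ⟨x, hx, rfl⟩ _ ⟨y, hy, rfl⟩ z ⟨h1, h2⟩
  refine ⟨f.symm z, hK x hx y hy _ ⟨?_, fun w hw hd => ?_⟩, f.apply_symm_apply z⟩
  · unfold Btw at *
    rw [← f.dist_eq x, ← f.dist_eq _ y, f.apply_symm_apply, h1, f.dist_eq]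
  · unfold Btw at *
    rw [f.eq_symm_apply.2 (h2 (f w) ?_ ?_)]
    · rw [f.dist_eq, f.dist_eq, f.dist_eq, hw]
    · rw [f.dist_eq, hd, ← f.dist_eq, f.apply_symm_apply]

end SF

namespace SF

variable {E : Type*} [NormedAddCommGroup E] [InnerProductSpace ℝ E]
variable (M : SF X E) [Nonempty X]

lemma vel_exp_neg {y : X} {m : E × ℝ} (hm : M.UT y m) (r : ℝ) :
    M.vel (M.exp y m r) (M.vel y m r) (-r) = m := by
  have h := cs_sq M.hk r
  rw [vel, M_exp _ hm, vel, cs_neg M.hk, sn_neg M.hk]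
  calc _ = (cs M.k r ^ 2 + M.k * sn M.k r ^ 2) • m := by module
    _ = m := by rw [h, one_smul]

lemma q_exp {p : X} {a : E × ℝ} (ha : M.UT p a) (t : ℝ) :
    M.q (M (M.exp p a t)) (M p) = cs M.k t := by
  rw [M_exp _ ha, q_add_left, q_smul_left, q_smul_left, q_self, M.q_comm a, ha.tan]; ring

lemma exp_neg {p : X} {a : E × ℝ} (ha : M.UT p a) (t : ℝ) : M.exp p (-a) t = M.exp p a (-t) := by
  apply M.injective
  rw [M_exp _ ha.neg, M_exp _ ha, cs_neg M.hk, sn_neg M.hk]; module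

lemma b_vel {p : X} {a : E × ℝ} (ha : M.UT p a) (w : X) (r : ℝ) :
    M.b (M w - M (M.exp p a (-r))) (M.vel p a (-r)) =
      sn M.k r * M.q (M w) (M p) + cs M.k r * M.b (M w - M p) a := by
  have h1 := M.kb_chord w p
  have h2 := M.k_mul_h w p
  have h3 := M.b_exp_sub ha ha.tan (-r)
  have h4 := M.kb_chord (M.exp p a (-r)) p
  have h5 := M.k_mul_h (M.exp p a (-r)) p
  rw [M.q_exp ha] at h5
  rw [ha.unit] at h3
  have e : M w - M (M.exp p a (-r)) = (M w - M p) - (M (M.exp p a (-r)) - M p) := by abel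
  rw [e, vel]
  generalize M (M.exp p a (-r)) - M p = v at *
  simp only [b_sub_left, b_add_right, b_smul_right, cs_neg M.hk, sn_neg M.hk, h3] at *
  linear_combination sn M.k r * h1 - sn M.k r * h4 - sn M.k r * h2 + sn M.k r * h5

lemma refl_exp {p : X} {a : E × ℝ} (ha : M.UT p a) (t : ℝ) :
    (M.mirror_tan ha).refl (M.exp p a t) = M.exp p a (-t) := by
  apply M.injective
  rw [Mirror.M_refl, lrefl_apply, M.mu_tan ha.tan, M.b_exp_sub ha ha.tan, M_exp _ ha, M_exp _ ha,
    ha.unit, cs_neg M.hk, sn_neg M.hk]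
  module

lemma refl_vel {p : X} {a : E × ℝ} (ha : M.UT p a) (r : ℝ) :
    M.lrefl a (M.b (M p) a) (M.vel p a (-r)) = M.vel p (-a) (-r) := by
  have h := M.kb_tan ha.tan
  rw [M.lrefl_tan ha (M.vel_UT ha (-r)).tan, vel, vel, b_add_left, b_smul_left, b_smul_left,
    ha.unit, sn_neg M.hk, cs_neg M.hk, show -(M.k * -sn M.k r) * M.b (M p) a = 0 by
      linear_combination sn M.k r * h]
  module

/-- A ball of radius `r` in a piece that is curved at least like the inball at its lowest
point does not lie below the inball. -/
lemma inball_side {p p₀ : X} {a : E × ℝ} (ha : M.UT p a) (ha₀ : M.UT p₀ a)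
    (h0 : M.b (M p - M p₀) a = 0) {t r κ : ℝ}
    (hu : M.exp p₀ a (-(t + r)) ∈ M.D κ (M.exp p a (-r)) (M.vel p a (-r))) :
    sn M.k t + κ * vs M.k t +
      cs M.k (t + r) * M.h p p₀ * (κ * cs M.k r + M.k * sn M.k r) ≤ 0 := by
  rw [mem_D, M.b_vel ha, M.h_fermi ha ha₀ h0] at hu
  have e1 : M.q (M (M.exp p₀ a (-(t + r)))) (M p) = cs M.k (t + r) * (1 - M.k * M.h p p₀) := by
    have h2 : M.q a (M p) = 0 := by rw [M.q_comm]; exact ha.tan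
    rw [M_exp _ ha₀, q_add_left, q_smul_left, q_smul_left, h2, cs_neg M.hk, M.h_comm]
    linear_combination cs M.k (t + r) * M.k_mul_h p₀ p
  have e2 : M.b (M (M.exp p₀ a (-(t + r))) - M p) a = - sn M.k (t + r) := by
    have h1 := M.b_exp_sub ha₀ ha₀.tan (-(t + r))
    rw [ha.unit, mul_one, sn_neg M.hk] at h1
    rw [← h1, ← sub_sub_sub_cancel_right _ _ (M p₀), b_sub_left, h0, sub_zero]
  have e3 : sn M.k t = sn M.k (t + r) * cs M.k r - cs M.k (t + r) * sn M.k r := by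
    rw [← sn_sub M.hk, add_sub_cancel_right]
  rw [e1, e2, show -(t + r) - -r = -t by ring, vs_neg M.hk, cs_neg M.hk, cs_neg M.hk] at hu
  rw [e3]
  linarith

/-- The inball of a lens is unique. -/
lemma inball_center {p : X} {a : E × ℝ} (ha : M.UT p a) {A B : Set X} {r κ₁ κ₂ : ℝ}
    (hA : A ∩ B ⊆ M.D κ₁ (M.exp p a (-r)) (M.vel p a (-r)))
    (hB : A ∩ B ⊆ M.D κ₂ (M.exp p (-a) (-r)) (M.vel p (-a) (-r)))
    (hr : 0 < r) (hr2 : r ≤ Real.pi) (h1 : 0 < κ₁) (h1' : 0 < κ₁ * cs M.k r + M.k * sn M.k r) (h2 : 0 ≤ κ₂)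
    (h2' : 0 ≤ κ₂ * cs M.k r + M.k * sn M.k r)
    (hq : ∀ z ∈ A ∩ B, 0 < M.q (M z) (M p)) {z : X} (hz : closedBall z r ⊆ A ∩ B) : z = p := by
  have key : ∀ a : E × ℝ, M.UT p a → ∀ κ, 0 ≤ κ → 0 ≤ κ * cs M.k r + M.k * sn M.k r →
      A ∩ B ⊆ M.D κ (M.exp p a (-r)) (M.vel p a (-r)) → ∀ p₀ t, M.UT p₀ a →
      M.b (M p - M p₀) a = 0 → z = M.exp p₀ a (-t) → 0 ≤ sn M.k t → 0 < M.q (M p₀) (M p) →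
      sn M.k t = 0 ∧ (0 < κ → 0 < κ * cs M.k r + M.k * sn M.k r → z = p) := by
    intro a ha κ h h' hD p₀ t ha₀ h0 hz' ht hq0
    have hmem : M.exp p₀ a (-(t + r)) ∈ A ∩ B := by
      refine hz ?_
      have hd : -(t + r) - -t = -r := by ring
      rw [mem_closedBall, hz', M.dist_exp_exp ha₀, hd, abs_neg, abs_of_pos hr]
      rw [hd, abs_neg, abs_of_pos hr]
      exact fun _ => hr2
    have hcs : 0 < cs M.k (t + r) := by
      have h3 := hq _ hmem
      have h2 : M.q a (M p) = 0 := by rw [M.q_comm]; exact ha.tan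
      rw [M_exp _ ha₀, q_add_left, q_smul_left, q_smul_left, h2, cs_neg M.hk, mul_zero, add_zero] at h3
      exact pos_of_mul_pos_left h3 hq0.le
    have h4 := M.inball_side ha ha₀ h0 (hD hmem)
    have h5 := vs_nonneg (k := M.k) t
    have h6 := M.h_nonneg p p₀
    have h7 : 0 ≤ κ * vs M.k t := by positivity
    have h8 : 0 ≤ cs M.k (t + r) * M.h p p₀ * (κ * cs M.k r + M.k * sn M.k r) := by positivity
    refine ⟨by linarith, fun hκ hκ' => ?_⟩
    have h9 : vs M.k t = 0 := by
      have : κ * vs M.k t = 0 := by linarith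
      exact (mul_eq_zero.1 this).resolve_left hκ.ne'
    have h10 : M.h p p₀ = 0 := by
      have : M.h p p₀ * (cs M.k (t + r) * (κ * cs M.k r + M.k * sn M.k r)) = 0 := by linarith
      exact (mul_eq_zero.1 this).resolve_right (by positivity)
    rw [← M.h_eq_zero, M.h_eq_zero.1 h10, hz', h_comm, h_exp _ ha₀, h_self, vs_neg M.hk, h9,
      sub_self, b_zero_left]
    ring
  have hzS : z ∈ A ∩ B := hz (mem_closedBall_self hr.le)
  have hqz := hq z hzS
  obtain ⟨p₀, t, ha₀, h0, hzt, hct, hst, -, hcq⟩ := M.exists_foot ha (y := z) fun _ => hqz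
  have hq0 : 0 < M.q (M p₀) (M p) := pos_of_mul_pos_right (hcq ▸ hqz) hct.le
  rcases le_total (sn M.k t) 0 with h | h
  · refine (key a ha κ₁ h1.le h1'.le hA p₀ (-t) ha₀ h0 (by rw [neg_neg]; exact hzt) ?_ hq0).2 h1 h1'
    rw [sn_neg M.hk]; linarith
  · have h3 := (key (-a) ha.neg κ₂ h2 h2' hB p₀ t ha₀.neg (by rw [b_neg_right, h0, neg_zero])
      (by rw [M.exp_neg ha₀, neg_neg]; exact hzt) h hq0).1
    exact (key a ha κ₁ h1.le h1'.le hA p₀ (-t) ha₀ h0 (by rw [neg_neg]; exact hzt)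
      (by rw [sn_neg M.hk, h3, neg_zero]) hq0).2 h1 h1'

end SF

namespace SF

variable {E : Type*} [NormedAddCommGroup E] [InnerProductSpace ℝ E]
variable (M : SF X E) [Nonempty X]

lemma eventually_radius {κ : ℝ} (hκ : 0 < κ) :
    ∀ᶠ r in nhdsWithin (0 : ℝ) (Ioi 0), 0 < κ * cs M.k r + M.k * sn M.k r := by
  have h1 := continuous_cs M.hk
  have h2 := continuous_sn M.hk
  have : Continuous fun r => κ * cs M.k r + M.k * sn M.k r := by fun_prop
  have := this.tendsto 0
  simp only [cs_zero M.hk, sn_zero M.hk, mul_one, mul_zero, add_zero] at this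
  exact nhdsWithin_le_nhds (this.eventually (lt_mem_nhds hκ))

variable [Fact (2 ≤ Module.finrank ℝ E)]

lemma lens_small {K : Set X} (hK : GConvex K) {y : X} {m : E × ℝ} (nK : M.IsNormal K y m)
    (sK : M.SC K y m) {δ : ℝ} (hδ : 0 < δ) :
    ∀ᶠ r in nhdsWithin (0 : ℝ) (Ioi 0), ∀ T : Set X, GConvex T → y ∈ T →
      (∀ w ∈ T, 0 ≤ sn M.k r * M.q (M w) (M (M.exp y m r)) -
        cs M.k r * M.b (M w - M (M.exp y m r)) (M.vel y m r)) → ∀ w ∈ K ∩ T, dist w y < δ := by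
  obtain ⟨κ, hκ, hsc⟩ := sK
  obtain ⟨δ₀, hδ₀, hloc⟩ := Metric.eventually_nhds_iff.1 hsc
  have hπ := Real.pi_gt_three
  set δ₁ := min δ₀ 1
  have hδ₁ : 0 < δ₁ := lt_min hδ₀ one_pos
  set δ' := min δ δ₁ / 2
  have hδ' : 0 < δ' := half_pos (lt_min hδ hδ₁)
  have hd1 : δ' < δ := (half_lt_self (lt_min hδ hδ₁)).trans_le (min_le_left _ _)
  have hd2 : δ' < δ₁ := (half_lt_self (lt_min hδ hδ₁)).trans_le (min_le_right _ _)
  have hd3 : δ₁ ≤ 1 := min_le_right _ _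
  have hv : 0 < κ * vs M.k δ' := mul_pos hκ (vs_pos M.hk hδ' fun _ => by linarith)
  have hev : ∀ᶠ r in nhdsWithin (0 : ℝ) (Ioi 0),
      2 * sn M.k r * (1 + vs M.k 2) < κ * vs M.k δ' := by
    have h2 := continuous_sn M.hk
    have : Continuous fun r => 2 * sn M.k r * (1 + vs M.k 2) := by fun_prop
    have := this.tendsto 0
    simp only [sn_zero M.hk, mul_zero, zero_mul] at this
    exact nhdsWithin_le_nhds (this.eventually (gt_mem_nhds hv))
  filter_upwards [hev, Ioo_mem_nhdsGT (zero_lt_one' ℝ), M.eventually_sn_pos]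
    with r hr1 hr2 hsr T hT hyT hTw
  have hcr : 0 < cs M.k r := cs_pos M.hk hr2.1.le fun _ => by linarith [hr2.2]
  set p := M.exp y m r
  set a := M.vel y m r
  have ha : M.UT p a := M.vel_UT nK.ut r
  have hy : M.exp p a (-r) = y := by rw [M.exp_vel nK.ut, add_neg_cancel, exp_zero]
  have hm : M.vel p a (-r) = m := M.vel_exp_neg nK.ut r
  have hb : ∀ w, M.b (M w - M y) m = sn M.k r * M.q (M w) (M p) + cs M.k r * M.b (M w - M p) a := by
    intro w
    have := M.b_vel ha w r
    rwa [hy, hm] at this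
  have hα : ∀ w ∈ K ∩ T, 0 ≤ M.q (M w) (M p) := by
    intro w hw
    have h1 := nK.sup hw.1
    rw [mem_D_zero, hb] at h1
    have h2 := hTw w hw.2
    have : 0 ≤ sn M.k r * M.q (M w) (M p) := by linarith
    exact nonneg_of_mul_nonneg_right this hsr
  have near : ∀ w ∈ K ∩ T, dist w y < δ₁ → dist w y < δ' := by
    intro w hw hd
    have h1 : w ∈ M.D κ y m := hloc (hd.trans_le (min_le_left _ _)) hw.1
    rw [mem_D, hb] at h1
    have h2 := hTw w hw.2
    have h3 : M.h w p ≤ vs M.k 2 := by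
      rw [← M.dist_le_iff zero_le_two fun _ => by linarith]
      have h4 : dist y p = r := M.dist_exp nK.ut hr2.1.le fun _ => by linarith [hr2.2]
      linarith [dist_triangle w y p, hr2.2]
    have h4 := M.h_nonneg w p
    have h5 : M.q (M w) (M p) ≤ 1 + M.h w p := by
      have h6 := M.k_mul_h w p
      rcases M.hk with hk | hk | hk <;> rw [hk] at h6 <;> linarith
    have h6 : M.q (M w) (M p) ≤ 1 + vs M.k 2 := h5.trans (by linarith)
    rw [M.dist_lt_iff hδ'.le fun _ => by linarith]
    have h7 : sn M.k r * M.q (M w) (M p) ≤ sn M.k r * (1 + vs M.k 2) :=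
      mul_le_mul_of_nonneg_left h6 hsr.le
    exact lt_of_mul_lt_mul_left (by linarith) hκ.le
  intro w hw
  by_contra! hfar
  have hD : δ₁ ≤ dist y w := by
    by_contra! h
    rw [dist_comm] at h
    linarith [near w hw h]
  obtain ⟨v, hv, hlog⟩ := M.exists_log y w
  set D := dist y w
  have hwe : w = M.exp y v D := M.injective (by rw [M_exp _ hv, hlog])
  have hDπ : M.k = 1 → D < Real.pi := by
    intro hk
    refine lt_of_le_of_ne (M.hpi' y w hk) fun he => ?_
    have h1 := hα w hw
    rw [hlog, show D = Real.pi from he, hk] at h1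
    have h2 := M.q_exp nK.ut r
    rw [M.q_comm] at h2
    simp [q_neg_left, p, h2] at h1
    linarith
  have hz : M.exp y v δ' ∈ K ∩ T := by
    have e := M.sn_smul_exp hv D δ'
    rw [← hwe] at e
    have h1 := (sn_pos M.hk (show 0 < D - δ' by linarith) fun h => by linarith [hDπ h]).le
    have h2 := (sn_pos M.hk hδ' fun h => by linarith [hDπ h]).le
    have h3 := sn_pos M.hk (show 0 < D by linarith) hDπ
    exact ⟨M.mem_of_combo hK nK.mem hw.1 h1 h2 h3 e, M.mem_of_combo hT hyT hw.2 h1 h2 h3 e⟩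
  have hdz : dist (M.exp y v δ') y = δ' := by
    rw [dist_comm, M.dist_exp hv hδ'.le fun _ => by linarith]
  have := near _ hz (by rw [hdz]; exact hd2)
  linarith

end SF

namespace SF

variable {E : Type*} [NormedAddCommGroup E] [InnerProductSpace ℝ E]
variable (M : SF X E) [Nonempty X] [Fact (2 ≤ Module.finrank ℝ E)]

lemma eventually_curv_lt (κ : ℝ) :
    ∀ᶠ r in nhdsWithin (0 : ℝ) (Ioi 0), κ < cs M.k r / sn M.k r := by
  have h1 := continuous_cs M.hk
  have h2 := continuous_sn M.hk
  have : Continuous fun r => cs M.k r - κ * sn M.k r := by fun_prop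
  have := this.tendsto 0
  simp only [cs_zero M.hk, sn_zero M.hk, mul_zero, sub_zero] at this
  filter_upwards [nhdsWithin_le_nhds (this.eventually (lt_mem_nhds one_pos)), M.eventually_sn_pos]
    with r h3 h4
  rw [lt_div_iff₀ h4]; linarith

lemma q_eq_cs (x y : X) : M.q (M x) (M y) = cs M.k (dist x y) := by
  have h1 := M.k_mul_h x y
  have h2 := mul_vs M.hk (dist x y)
  rw [h_eq_vs] at h1; linarith

lemma mem_interior_of_mem_D {A : Set X} {κ κ' : ℝ} {x z : X} {n : E × ℝ} (hκ : κ < κ')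
    (hA : M.D κ x n ⊆ A) (hz : z ∈ M.D κ' x n) (hzx : z ≠ x) : z ∈ interior A := by
  refine interior_mono hA (M.mem_interior_D ?_)
  rw [mem_D] at hz
  have h1 : 0 < M.h z x := (M.h_nonneg z x).lt_of_ne fun h0 => hzx (M.h_eq_zero.1 h0.symm)
  nlinarith

/-- If all thin lenses cut from `K` and `L` at a common boundary point with common normal are
symmetric, the germs of `K` and `L` agree. -/
lemma lens {K L : Set X} (hK : GConvex K) (hL : GConvex L) {y : X} {m : E × ℝ}
    (nK : M.IsNormal K y m) (nL : M.IsNormal L y m) (sK : M.SC K y m)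
    (sL : M.k = -1 → M.SC L y m)
    (hS : ∃ ε > 0, ∀ (a : E × ℝ) (c : ℝ) (σ : M.Mirror a c),
      (interior (σ.refl '' K ∩ L)).Nonempty → diam (σ.refl '' K ∩ L) < ε →
      ∀ p r, HasUniqueInball (σ.refl '' K ∩ L) p r →
        frontier (σ.refl '' K ∩ L) ∩ sphere p r = {σ.refl y, y} →
        σ.refl y ∈ interior L → y ∈ interior (σ.refl '' K) → IsMidpoint p (σ.refl y) y →
        SymmetricWrtPerpBisector (σ.refl '' K ∩ L) (σ.refl y) y) :
    ∀ᶠ z in nhds y, (z ∈ K ↔ z ∈ L) := by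
  obtain ⟨ε, hε, hS⟩ := hS
  obtain ⟨κ₁, hκ₁, hsc⟩ := id sK
  obtain ⟨δ₁, hδ₁, hloc⟩ := Metric.eventually_nhds_iff.1 hsc
  obtain ⟨κ₂, hκ₂, hκ₂', hscL⟩ : ∃ κ₂, 0 ≤ κ₂ ∧ (M.k = -1 → 0 < κ₂) ∧
      ∀ᶠ z in nhds y, z ∈ L → z ∈ M.D κ₂ y m := by
    by_cases hk : M.k = -1
    · obtain ⟨κ, h1, h2⟩ := sL hk
      exact ⟨κ, h1.le, fun _ => h1, h2⟩
    · exact ⟨0, le_rfl, fun h => absurd h hk, Eventually.of_forall nL.sup⟩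
  obtain ⟨δ₂, hδ₂, hlocL⟩ := Metric.eventually_nhds_iff.1 hscL
  obtain ⟨κ₃, -, hK₃⟩ := nK.inner
  obtain ⟨κ₄, -, hL₄⟩ := nL.inner
  have hπ := Real.pi_gt_three
  obtain ⟨δ, hδ, e1, e2, e3, e4⟩ : ∃ δ > 0, 2 * δ < ε ∧ δ ≤ δ₁ ∧ 2 * δ ≤ δ₂ ∧ δ ≤ 1 / 4 := by
    refine ⟨min (ε / 3) (min δ₁ (min (δ₂ / 2) (1 / 4))), by positivity, ?_, ?_, ?_, ?_⟩
    · linarith [min_le_left (ε / 3) (min δ₁ (min (δ₂ / 2) (1 / 4)))]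
    · exact (min_le_right _ _).trans (min_le_left _ _)
    · linarith [(min_le_right (ε / 3) (min δ₁ (min (δ₂ / 2) (1 / 4)))).trans
        ((min_le_right _ _).trans (min_le_left _ _))]
    · exact (min_le_right _ _).trans ((min_le_right _ _).trans (min_le_right _ _))
  have hev2 : ∀ᶠ r in nhdsWithin (0 : ℝ) (Ioi 0), 0 ≤ κ₂ * cs M.k r + M.k * sn M.k r := by
    by_cases hk : M.k = -1
    · exact (M.eventually_radius (hκ₂' hk)).mono fun r h => h.le
    · filter_upwards [M.eventually_sn_pos, M.eventually_radius one_pos,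
        Ioo_mem_nhdsGT (zero_lt_one' ℝ)] with r h1 h2 h3
      have h4 := cs_pos M.hk h3.1.le fun _ => by linarith [h3.2]
      have : 0 ≤ M.k := by
        rcases M.hk with h | h | h
        · linarith
        · exact h.ge
        · exact absurd h hk
      positivity
  obtain ⟨r, hr1, hr2, hr3, hr4, hr5, hr6, hr7⟩ := ((M.lens_small hK nK sK hδ).and
    ((M.eventually_radius hκ₁).and (hev2.and ((M.eventually_curv_lt κ₃).and
    ((M.eventually_curv_lt κ₄).and (M.eventually_sn_pos.and
      (Ioo_mem_nhdsGT (half_pos hδ)))))))).exists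
  have hr0 : 0 < r := hr7.1
  have hr8 : 2 * r < δ := by linarith [hr7.2]
  set p := M.exp y m r with hp
  set a := M.vel y m r with ha_def
  have ha : M.UT p a := M.vel_UT nK.ut r
  have hy : M.exp p a (-r) = y := by rw [M.exp_vel nK.ut, add_neg_cancel, exp_zero]
  have hm : M.vel p a (-r) = m := M.vel_exp_neg nK.ut r
  set hM := M.mirror_tan ha
  set σ := hM.refl
  set x := M.exp p (-a) (-r) with hx
  set n := M.vel p (-a) (-r) with hn
  have hσy : σ y = x := by rw [← hy, M.refl_exp ha, hx, M.exp_neg ha]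
  have hσm : M.lrefl a (M.b (M p) a) m = n := by rw [← hm, M.refl_vel ha]
  have hσσ : ∀ z, σ (σ z) = z := hM.refl_refl
  have hσx : σ x = y := by rw [← hσy, hσσ]
  have hpx : M.exp x n r = p := by rw [M.exp_vel ha.neg, neg_add_cancel, exp_zero]
  have hxy_dist : dist x y = 2 * r := by
    have : r - -r = 2 * r := by ring
    rw [← hy, hx, M.exp_neg ha, neg_neg, M.dist_exp_exp ha] <;> rw [this, abs_of_pos (by linarith)]
    intro _; linarith
  have hxy : x ≠ y := by
    intro h; rw [h, dist_self] at hxy_dist; linarith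
  have hnU : M.UT x n := M.vel_UT ha.neg (-r)
  have hrπ : M.k = 1 → r < Real.pi := fun _ => by linarith
  have hBy := M.closedBall_eq_D nK.ut hr0 hrπ
  have hBx := M.closedBall_eq_D hnU hr0 hrπ
  rw [hpx] at hBx
  have hD : ∀ κ, σ '' M.D κ y m = M.D κ x n := fun κ => by
    rw [hM.cong.image_D nK.ut.tan, hσm]; exact congrArg (fun z => M.D κ z n) hσy
  have hσK₃ : M.D κ₃ x n ⊆ σ '' K := by rw [← hD]; exact image_mono hK₃
  have hmem : ∀ {A : Set X} {z}, z ∈ σ '' A ↔ σ z ∈ A := by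
    intro A z
    constructor
    · rintro ⟨w, hw, rfl⟩; rwa [hσσ]
    · exact fun h => ⟨σ z, h, hσσ z⟩
  set S := σ '' K ∩ L with hSdef
  have hball : closedBall p r ⊆ S := by
    refine subset_inter ?_ ?_
    · rw [hBx]; exact (M.D_anti hr4.le x n).trans hσK₃
    · rw [hBy]; exact (M.D_anti hr5.le y m).trans hL₄
  have hxB : x ∈ closedBall p r := by rw [hBx]; exact M.self_mem_D _ _ _
  have hyB : y ∈ closedBall p r := by rw [hBy]; exact M.self_mem_D _ _ _
  have intL : ∀ z ∈ closedBall p r, z ≠ y → z ∈ interior L := fun z hz hzy =>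
    M.mem_interior_of_mem_D hr5 hL₄ (hBy ▸ hz) hzy
  have intK : ∀ z ∈ closedBall p r, z ≠ x → z ∈ interior (σ '' K) := fun z hz hzx =>
    M.mem_interior_of_mem_D hr4 hσK₃ (hBx ▸ hz) hzx
  have nσ : M.IsNormal (σ '' K) x n := by
    have := nK.image hM.cong
    rw [hσm] at this
    exact hσy ▸ this
  have hdx : dist x p = r := by rw [← hpx]; exact M.dist_exp hnU hr0.le fun h => (hrπ h).le
  have hdy : dist y p = r := M.dist_exp nK.ut hr0.le fun h => (hrπ h).le
  have small : ∀ z ∈ S, dist (σ z) y < δ := by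
    intro z hz
    refine hr1 (σ '' L) (GConvex_image hL σ) ?_ ?_ (σ z) ⟨hmem.1 hz.1, mem_image_of_mem _ hz.2⟩
    · rw [hmem, hσy]; exact (hball hxB).2
    · rintro w hw
      have h1 : w ∈ M.D 0 x n := by rw [← hD]; exact image_mono nL.sup hw
      rw [mem_D_zero, hx, hn, M.b_vel ha.neg, b_neg_right] at h1
      linarith
  have small' : ∀ z ∈ S, dist z x < δ := by
    intro z hz
    rw [← σ.dist_eq, hσx]; exact small z hz
  have hq : ∀ z ∈ S, 0 < M.q (M z) (M p) := by
    intro z hz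
    rw [q_eq_cs]
    refine cs_pos M.hk dist_nonneg fun _ => ?_
    linarith [small' z hz, dist_triangle z x p]
  have hS1 : S ⊆ M.D κ₁ x n := by
    intro z hz
    rw [← hD, hmem]
    exact hloc ((small z hz).trans_le e2) (hmem.1 hz.1)
  have hS2 : S ⊆ M.D κ₂ y m := by
    intro z hz
    refine hlocL ?_ hz.2
    linarith [small' z hz, dist_triangle z x y]
  have center : ∀ z, closedBall z r ⊆ S → z = p := by
    intro z hz
    refine M.inball_center (κ₁ := κ₁) (κ₂ := κ₂) ha.neg (A := σ '' K) (B := L) hS1 ?_ hr0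
      (by linarith) hκ₁ hr2 hκ₂ hr3 hq hz
    rw [neg_neg, hy, hm]; exact hS2
  have big : ∀ z s, closedBall z s ⊆ S → s ≤ r := by
    intro z s hz
    by_contra! hs
    have := center z ((closedBall_subset_closedBall hs.le).trans hz)
    subst this
    refine nL.not_mem_interior (interior_mono (hz.trans inter_subset_right) ?_)
    exact ball_subset_interior_closedBall (by rw [mem_ball, hdy]; exact hs)
  have hyx := hxy.symm
  have hinb : HasUniqueInball S p r :=
    ⟨⟨hr0.le, hball, big⟩, fun z s hz =>
      center z ((closedBall_subset_closedBall (hz.2.2 p r hball)).trans hz.2.1)⟩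
  have hfr : frontier S ∩ sphere p r = {σ y, y} := by
    rw [hσy]
    ext z
    simp only [mem_inter_iff, mem_insert_iff, mem_singleton_iff]
    constructor
    · rintro ⟨h1, h2⟩
      by_contra! h
      have h3 := sphere_subset_closedBall h2
      apply h1.2
      rw [interior_inter]
      exact ⟨intK z h3 h.1, intL z h3 h.2⟩
    · rintro (rfl | rfl)
      · exact ⟨frontier_of_mem (hball hxB) fun h =>
          nσ.not_mem_interior (interior_mono inter_subset_left h), hdx⟩
      · exact ⟨frontier_of_mem (hball hyB) fun h =>
          nL.not_mem_interior (interior_mono inter_subset_right h), hdy⟩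
  have hint : (interior S).Nonempty :=
    ⟨p, ball_subset_interior_closedBall.trans (interior_mono hball) (mem_ball_self hr0)⟩
  have hdiam : diam S < ε := by
    refine lt_of_le_of_lt (diam_le_of_subset_closedBall hδ.le (x := x) ?_) e1
    exact fun z hz => (small' z hz).le
  have hyK := intK y hyB hyx
  have hxL := intL x hxB hxy
  obtain ⟨τ, hτ, hτy, hτS⟩ := hS a _ hM hint hdiam p r hinb hfr
    (by change σ y ∈ _; rw [hσy]; exact hxL) hyK (by
      change IsMidpoint p (σ y) y
      rw [hσy]
      refine ⟨?_, ?_⟩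
      · rw [Btw, hdx, dist_comm p y, hdy, hxy_dist]; ring
      · rw [hdx, dist_comm p y, hdy])
  have hτσ : τ = σ :=
    (M.reflection_unique hτ hxy (by rw [← hσy]; exact hτy)).trans
      (M.reflection_unique hM.isReflection hxy hσx).symm
  have hSS : σ '' S = S := hτσ ▸ hτS
  have hyσL : y ∈ interior (σ '' L) := by
    have h : σ.toHomeomorph '' interior L = interior (σ.toHomeomorph '' L) :=
      σ.toHomeomorph.image_interior L
    have h' : σ '' interior L = interior (σ '' L) := h
    rw [← h', hmem, hσy]; exact hxL
  filter_upwards [mem_interior_iff_mem_nhds.1 hyK, mem_interior_iff_mem_nhds.1 hyσL] with z h1 h2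
  constructor
  · intro h
    have : z ∈ σ '' S := hmem.2 ⟨mem_image_of_mem _ h, hmem.1 h2⟩
    exact (hSS ▸ this).2
  · intro h
    have : z ∈ S := ⟨h1, h⟩
    rw [← hSS, hmem] at this
    have h3 := hmem.1 this.1
    rwa [hσσ] at h3

end SF

namespace SF

variable {E : Type*} [NormedAddCommGroup E] [InnerProductSpace ℝ E]
variable (M : SF X E) [Nonempty X] [Fact (2 ≤ Module.finrank ℝ E)]

lemma inner_ball_normal {K : Set X} {x : X} {n : E × ℝ} (hn : M.IsNormal K x n) :
    ∃ κ > 0, ∀ᶠ z in nhds x, ∀ m, M.IsNormal K z m →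
      1 - M.b n m ≤ κ * M.b (M x - M z) m := by
  obtain ⟨κ₀, -, hκ₀⟩ := hn.inner
  obtain ⟨ρ, h1, h2, h3⟩ := ((M.eventually_curv_lt κ₀).and (M.eventually_sn_pos.and
    (Ioo_mem_nhdsGT (one_half_pos (α := ℝ))))).exists
  have hπ := Real.pi_gt_three
  have h4 : 0 < cs M.k ρ := cs_pos M.hk h3.1.le fun _ => by linarith [h3.2]
  refine ⟨cs M.k ρ / sn M.k ρ, div_pos h4 h2, ?_⟩
  filter_upwards [ball_mem_nhds x (one_half_pos (α := ℝ))] with z hz m hm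
  set p := M.exp x n ρ with hp
  have hdp : dist x p = ρ := M.dist_exp hn.ut h3.1.le fun _ => by linarith [h3.2]
  have hball : closedBall p ρ ⊆ K := by
    rw [hp, M.closedBall_eq_D hn.ut h3.1 fun _ => by linarith [h3.2]]
    exact (M.D_anti h1.le x n).trans hκ₀
  rw [mem_ball] at hz
  obtain ⟨p₀, t, h5, h6, h7, h8, h9, h10, -⟩ := M.exists_foot (y := p) hm.ut fun hk => by
    rw [q_eq_cs]
    refine cs_pos M.hk dist_nonneg fun _ => ?_
    linarith [dist_triangle p x z, dist_comm p x, dist_comm x z, h3.2]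
  have h11 : M.exp p₀ m (t - ρ) ∈ K := by
    refine hball ?_
    rw [mem_closedBall, h7, M.dist_exp_exp h5] <;>
      rw [show t - ρ - t = -ρ by ring, abs_neg, abs_of_pos h3.1]
    intro _; linarith [h3.2]
  have h12 := hm.sup h11
  rw [mem_D_zero] at h12
  have h13 : M.b (M (M.exp p₀ m (t - ρ)) - M z) m = sn M.k (t - ρ) := by
    have e : M (M.exp p₀ m (t - ρ)) - M z = (M (M.exp p₀ m (t - ρ)) - M p₀) - (M z - M p₀) := by
      abel
    rw [e, b_sub_left, h6, M.b_exp_sub h5 h5.tan, h5.unit]; ring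
  rw [h13] at h12
  have h14 : ρ ≤ t := by
    by_contra! h
    have : 0 < sn M.k (ρ - t) := sn_pos M.hk (by linarith) fun hk => by
      linarith [(abs_lt.1 (h10 hk)).1, h3.2]
    rw [show ρ - t = -(t - ρ) by ring, sn_neg M.hk] at this
    linarith
  have h15 : sn M.k ρ ≤ sn M.k t := by
    have e1 := sn_add M.hk ((t + ρ) / 2) ((t - ρ) / 2)
    have e2 := sn_sub M.hk ((t + ρ) / 2) ((t - ρ) / 2)
    rw [show (t + ρ) / 2 + (t - ρ) / 2 = t by ring] at e1
    rw [show (t + ρ) / 2 - (t - ρ) / 2 = ρ by ring] at e2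
    have e3 : 0 < cs M.k ((t + ρ) / 2) := cs_pos M.hk (by linarith [h3.1]) fun hk => by
      linarith [(abs_lt.1 (h10 hk)).2, h3.2]
    have e4 : 0 ≤ sn M.k ((t - ρ) / 2) := by
      rcases h14.eq_or_lt with h | h
      · rw [h, sub_self, zero_div, sn_zero M.hk]
      · exact (sn_pos M.hk (by linarith) fun hk => by
          linarith [(abs_lt.1 (h10 hk)).2, h3.1]).le
    have := mul_nonneg e3.le e4
    linarith
  rw [h9] at h15
  have e : M.b (M p - M z) m = cs M.k ρ * M.b (M x - M z) m + sn M.k ρ * M.b n m := by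
    have e1 := M.kb_tan hm.ut.tan
    have e2 := mul_vs M.hk ρ
    rw [hp, M_exp _ hn.ut, b_sub_left, b_add_left, b_smul_left, b_smul_left, b_sub_left]
    linear_combination (-vs M.k ρ) * e1 + M.b (M z) m * e2
  rw [e] at h15
  rw [div_mul_eq_mul_div, le_div_iff₀ h2]
  linarith

lemma IsNormal.lipschitz {K : Set X} {x : X} {n : E × ℝ} (hn : M.IsNormal K x n) :
    ∃ C, ∀ᶠ z in nhds x, ∀ m, M.IsNormal K z m → ‖m - n‖ ≤ C * ‖M z - M x‖ := by
  obtain ⟨κ, hκ, hev⟩ := M.inner_ball_normal hn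
  set T := 1 + 2 * (M x).2 ^ 2
  have hT : 1 ≤ T := by nlinarith [sq_nonneg (M x).2]
  have hx0 := norm_nonneg (M x)
  refine ⟨32 * T * κ, ?_⟩
  have hnear : ∀ᶠ z in nhds x, ‖M z - M x‖ < 1 / (32 * T * (1 + ‖M x‖)) := by
    have := (M.continuous.sub continuous_const).norm.tendsto x (f := fun z => ‖M z - M x‖)
    simp only [sub_self, norm_zero] at this
    exact this.eventually (gt_mem_nhds (by positivity))
  filter_upwards [hev, hnear] with z h1 h2 m hm
  replace h1 := h1 m hm
  set δ := ‖M z - M x‖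
  set η := ‖m - n‖
  have hδ : 0 ≤ δ := norm_nonneg _
  have hη : 0 ≤ η := norm_nonneg _
  set β := M.b (M x - M z) m with hβ
  have hβ0 : 0 ≤ β := M.mem_D_zero.1 (hm.sup hn.mem)
  have hβ1 : β ≤ 2 * δ * η := by
    have e1 := M.mem_D_zero.1 (hn.sup hm.mem)
    have e2 : β = M.b (M x - M z) (m - n) - M.b (M z - M x) n := by
      rw [hβ, b_sub_right, b_sub_left, b_sub_left, b_sub_left]; ring
    have e3 := (abs_le.1 (M.abs_b_le (M x - M z) (m - n))).2
    rw [norm_sub_rev] at e3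
    linarith
  set w := m - n - (M.k * β) • M x with hw
  have hqm : M.q (M x) m = M.k * β := M.q_tan hm.ut.tan x
  have hwt : M.Tan x w := by
    have : M.q (M x) n = 0 := hn.ut.tan
    rw [Tan, hw, q_sub_right, q_sub_right, q_smul_right, this, hqm, q_self]; ring
  have hbw : M.b w w = 2 * (1 - M.b n m) - M.k * β ^ 2 := by
    have e1 : M.k * M.b (M x) m = M.k ^ 2 * (M.k * β) := by rw [← hqm, k_mul_b]
    have e2 := M.kb_tan hn.ut.tan
    have e3 := M.kb_self x
    have e4 := M.k_cube
    rw [hw]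
    simp only [b_sub_left, b_sub_right, b_smul_left, b_smul_right, hn.ut.unit, hm.ut.unit]
    rw [M.b_comm m n, M.b_comm n (M x), M.b_comm m (M x)]
    linear_combination (-2 * β) * e1 + (2 * β) * e2 + β ^ 2 * M.k * e3 + (- β ^ 2) * e4
  have hk := abs_le.1 M.k_abs
  have hβ2 : β ^ 2 ≤ 4 * δ ^ 2 * η ^ 2 :=
    (pow_le_pow_left₀ hβ0 hβ1 2).trans_eq (by ring)
  have hbw' : M.b w w ≤ 4 * κ * δ * η + 4 * δ ^ 2 * η ^ 2 := by
    have : 2 * (κ * β) ≤ 2 * (κ * (2 * δ * η)) := by gcongr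
    nlinarith [sq_nonneg β]
  have hw2 : ‖w‖ ^ 2 ≤ T * (4 * κ * δ * η + 4 * δ ^ 2 * η ^ 2) :=
    (norm_sq_le w).trans ((M.tan_bound hwt).trans (mul_le_mul_of_nonneg_left hbw' (by linarith)))
  have hηw : η ≤ ‖w‖ + β * ‖M x‖ := by
    have : m - n = w + (M.k * β) • M x := by rw [hw]; abel
    calc η = ‖w + (M.k * β) • M x‖ := by rw [← this]
      _ ≤ ‖w‖ + ‖(M.k * β) • M x‖ := norm_add_le _ _
      _ ≤ _ := by
        rw [norm_smul, norm_mul, Real.norm_eq_abs, Real.norm_eq_abs, abs_of_nonneg hβ0]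
        nlinarith [M.k_abs, mul_nonneg hβ0 hx0]
  rw [lt_div_iff₀ (by positivity)] at h2
  have t1 : 0 ≤ δ * ‖M x‖ := mul_nonneg hδ hx0
  have t2 : 0 ≤ (T - 1) * δ := mul_nonneg (sub_nonneg.2 hT) hδ
  have t3 : 0 ≤ (T - 1) * δ * ‖M x‖ := mul_nonneg t2 hx0
  have s1 : δ * ‖M x‖ ≤ 1 / 4 := by linarith
  have s2 : δ * T ≤ 1 / 32 := by linarith
  have s3 : 32 * T * δ ^ 2 ≤ 1 := by nlinarith
  have s4 : β * ‖M x‖ ≤ η / 2 := by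
    calc β * ‖M x‖ ≤ 2 * δ * η * ‖M x‖ := by gcongr
      _ = 2 * η * (δ * ‖M x‖) := by ring
      _ ≤ 2 * η * (1 / 4) := by gcongr
      _ = η / 2 := by ring
  have s5 : η ≤ 2 * ‖w‖ := by linarith
  have s6 : η ^ 2 ≤ 4 * ‖w‖ ^ 2 := (pow_le_pow_left₀ hη s5 2).trans_eq (by ring)
  have s7 : η ^ 2 ≤ 32 * T * κ * δ * η := by nlinarith [sq_nonneg η]
  rcases hη.eq_or_lt with h | h
  · rw [← h]; positivity
  · refine le_of_mul_le_mul_right ?_ h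
    rw [← sq]; exact s7

end SF

/-- A pointwise Lipschitz map on an open set is differentiable at some point. -/
lemma exists_differentiableAt {V W : Type*} [NormedAddCommGroup V] [NormedSpace ℝ V]
    [FiniteDimensional ℝ V] [NormedAddCommGroup W] [NormedSpace ℝ W] [FiniteDimensional ℝ W]
    {U : Set V} (hU : IsOpen U) (hne : U.Nonempty) {f : V → W}
    (hf : ∀ w ∈ U, ∃ C, ∀ᶠ w' in nhds w, ‖f w' - f w‖ ≤ C * ‖w' - w‖) :
    ∃ w ∈ U, DifferentiableAt ℝ f w := by
  obtain ⟨w₀, hw₀⟩ := hne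
  obtain ⟨r, hr, hrU⟩ := Metric.isOpen_iff.1 hU w₀ hw₀
  have hcont : ∀ w ∈ U, ContinuousAt f w := by
    intro w hw
    obtain ⟨C, hC⟩ := hf w hw
    rw [ContinuousAt, tendsto_iff_norm_sub_tendsto_zero]
    have : Tendsto (fun w' => C * ‖w' - w‖) (nhds w) (nhds 0) := by
      have : Continuous fun w' => C * ‖w' - w‖ := by fun_prop
      simpa using this.tendsto w
    exact squeeze_zero' (Eventually.of_forall fun _ => norm_nonneg _) hC this
  set F : ℕ → Set V := fun m => {w | ∀ w' ∈ ball w₀ r, dist w' w < 1 / (m + 1) →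
    ‖f w' - f w‖ ≤ m * ‖w' - w‖} with hF
  set B := closedBall w₀ (r / 2)
  have hBU : B ⊆ ball w₀ r := closedBall_subset_ball (by linarith)
  have hclosed : ∀ m, IsClosed {w : B | (w : V) ∈ F m} := by
    intro m
    rw [← isSeqClosed_iff_isClosed]
    intro u x hu hx
    have hx' : Tendsto (fun i => (u i : V)) atTop (nhds (x : V)) :=
      (continuous_subtype_val.tendsto x).comp hx
    have hfx : Tendsto (fun i => f (u i)) atTop (nhds (f x)) :=
      (hcont x (hrU (hBU x.2))).tendsto.comp hx'
    intro w' hw' hd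
    have h1 : ∀ᶠ i in atTop, dist w' (u i) < 1 / ((m : ℝ) + 1) :=
      (tendsto_const_nhds.dist hx').eventually (gt_mem_nhds hd)
    exact le_of_tendsto_of_tendsto (tendsto_const_nhds.sub hfx).norm
      ((tendsto_const_nhds.sub hx').norm.const_mul _) (h1.mono fun i hi => hu i w' hw' hi)
  have hcover : ⋃ m, {w : B | (w : V) ∈ F m} = univ := by
    refine eq_univ_of_forall fun w => ?_
    obtain ⟨C, hC⟩ := hf w (hrU (hBU w.2))
    obtain ⟨δ, hδ, h⟩ := Metric.eventually_nhds_iff.1 hC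
    obtain ⟨m₁, hm₁⟩ := exists_nat_gt C
    obtain ⟨m₂, hm₂⟩ := exists_nat_one_div_lt hδ
    refine mem_iUnion.2 ⟨max m₁ m₂, fun w' _ hd => ?_⟩
    refine (h (hd.trans (lt_of_le_of_lt ?_ hm₂))).trans ?_
    · apply one_div_le_one_div_of_le (by positivity)
      have : (m₂ : ℝ) ≤ ((max m₁ m₂ : ℕ) : ℝ) := by exact_mod_cast le_max_right _ _
      linarith
    · have : (m₁ : ℝ) ≤ ((max m₁ m₂ : ℕ) : ℝ) := by exact_mod_cast le_max_left _ _
      exact mul_le_mul_of_nonneg_right (by linarith) (norm_nonneg _)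
  have : Nonempty B := ⟨⟨w₀, mem_closedBall_self (by linarith)⟩⟩
  have hBc : IsClosed B := isClosed_closedBall
  have : CompleteSpace V := FiniteDimensional.complete ℝ V
  have : CompleteSpace B := hBc.completeSpace_coe
  obtain ⟨m, hm⟩ := nonempty_interior_of_iUnion_of_closed hclosed hcover
  obtain ⟨w₁, hw₁⟩ := hm
  rw [mem_interior_iff_mem_nhds, nhds_subtype_eq_comap, mem_comap] at hw₁
  obtain ⟨t, ht, htF⟩ := hw₁
  obtain ⟨s, hs, hst⟩ := Metric.mem_nhds_iff.1 ht
  obtain ⟨w₂, hw₂, hw₂'⟩ : ∃ w₂ ∈ ball w₀ (r / 2), w₂ ∈ ball (w₁ : V) s := by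
    have : (w₁ : V) ∈ closure (ball w₀ (r / 2)) := by
      rw [closure_ball _ (by linarith : r / 2 ≠ 0)]; exact w₁.2
    obtain ⟨b, hb, hb'⟩ := Metric.mem_closure_iff.1 this s hs
    exact ⟨b, hb, by rwa [mem_ball']⟩
  obtain ⟨ρ, hρ, hρ'⟩ := Metric.isOpen_iff.1 (isOpen_ball.inter isOpen_ball) w₂ ⟨hw₂, hw₂'⟩
  set ρ' := min ρ (1 / (2 * ((m : ℝ) + 1)))
  have hρ'0 : 0 < ρ' := lt_min hρ (by positivity)
  have hsub : ball w₂ ρ' ⊆ ball w₀ (r / 2) ∩ ball (w₁ : V) s :=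
    (ball_subset_ball (min_le_left _ _)).trans hρ'
  have hlip : LipschitzOnWith m f (ball w₂ ρ') := by
    refine LipschitzOnWith.of_dist_le_mul fun x hx y hy => ?_
    have hyB : y ∈ B := ball_subset_closedBall (hsub hy).1
    have h1 : y ∈ F m := htF (a := ⟨y, hyB⟩) (hst (hsub hy).2)
    have h2 := h1 x (hBU (ball_subset_closedBall (hsub hx).1)) (by
      have h3 := dist_triangle_right x y w₂
      have h4 : ρ' ≤ 1 / (2 * ((m : ℝ) + 1)) := min_le_right _ _
      have h5 : 1 / (2 * ((m : ℝ) + 1)) + 1 / (2 * ((m : ℝ) + 1)) = 1 / ((m : ℝ) + 1) := by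
        field_simp; norm_num
      rw [mem_ball] at hx hy
      linarith)
    rw [dist_eq_norm, dist_eq_norm]
    simpa using h2
  let : MeasurableSpace V := borel V
  have : BorelSpace V := ⟨rfl⟩
  have hae := hlip.ae_differentiableWithinAt_of_mem (μ := MeasureTheory.Measure.addHaar)
  have hpos : (MeasureTheory.Measure.addHaar (G := V)) (ball w₂ ρ') ≠ 0 :=
    (Metric.measure_ball_pos _ _ hρ'0).ne'
  obtain ⟨w, hw, hd⟩ := (MeasureTheory.frequently_ae_mem_iff.2 hpos).and_eventually hae |>.exists
  exact ⟨w, hrU (hBU (ball_subset_closedBall (hsub hw).1)),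
    (hd hw).differentiableAt (isOpen_ball.mem_nhds hw)⟩

namespace SF

variable {E : Type*} [NormedAddCommGroup E] [InnerProductSpace ℝ E]
variable (M : SF X E) [Nonempty X] [Fact (2 ≤ Module.finrank ℝ E)]

/-- The cone over a subset of the model. -/
def cone (K : Set X) : Set (E × ℝ) := {w | w = 0 ∨ w ∈ M.Om ∧ M.nrm w ∈ K}

lemma zero_notMem_Om : (0 : E × ℝ) ∉ M.Om := by
  intro h
  have := h.1
  rw [q_zero_left] at this
  exact lt_irrefl _ this

lemma sqrt_q_pos {w : E × ℝ} (hw : w ∈ M.Om) : 0 < √(M.q w w) := Real.sqrt_pos.2 hw.1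

lemma convex_cone {K : Set X} (hK : GConvex K) : Convex ℝ (M.cone K) := by
  have key : ∀ w ∈ M.cone K, ∃ x ∈ insert (M.nrm w) K, ∃ s : ℝ, 0 ≤ s ∧ w = s • M x ∧
      (s ≠ 0 → x ∈ K) := by
    rintro w (rfl | ⟨h1, h2⟩)
    · exact ⟨_, mem_insert _ _, 0, le_rfl, by simp, fun h => absurd rfl h⟩
    · exact ⟨_, mem_insert _ _, _, (M.sqrt_q_pos h1).le, (M.smul_nrm h1).symm, fun _ => h2⟩
  have comb : ∀ {x y : X} {a c : ℝ}, x ∈ K → y ∈ K → 0 ≤ a → 0 ≤ c →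
      a • M x + c • M y ∈ M.cone K := by
    intro x y a c hx hy ha hc
    by_cases h0 : a • M x + c • M y = 0
    · exact Or.inl h0
    · have h1 := M.combo_Om ha hc h0
      exact Or.inr ⟨h1, M.mem_of_combo hK hx hy ha hc (M.sqrt_q_pos h1) (M.smul_nrm h1).symm⟩
  intro w hw w' hw' a c ha hc hac
  obtain ⟨x, -, s, hs, rfl, hx⟩ := key w hw
  obtain ⟨y, -, t, ht, rfl, hy⟩ := key w' hw'
  rw [smul_smul, smul_smul]
  by_cases h1 : a * s = 0
  · by_cases h2 : c * t = 0
    · left; simp [h1, h2]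
    · have hy' := hy (right_ne_zero_of_mul h2)
      have := comb hy' hy' le_rfl (mul_nonneg hc ht)
      rw [h1, zero_smul]
      rwa [zero_smul] at this
  · have hx' := hx (right_ne_zero_of_mul h1)
    by_cases h2 : c * t = 0
    · have := comb hx' hx' (mul_nonneg ha hs) le_rfl
      rw [h2, zero_smul]
      rwa [zero_smul] at this
    · exact comb hx' (hy (right_ne_zero_of_mul h2)) (mul_nonneg ha hs) (mul_nonneg hc ht)

lemma cone_mem_nhds {K : Set X} {w : E × ℝ} (hw : w ∈ M.Om) (h : M.nrm w ∈ interior K) :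
    M.cone K ∈ nhds w := by
  filter_upwards [M.isOpen_Om.mem_nhds hw,
    (M.continuousAt_nrm hw).eventually (isOpen_interior.mem_nhds h)] with w' h1 h2
  exact Or.inr ⟨h1, interior_subset h2⟩

lemma nrm_mem_frontier {K : Set X} (hK : IsClosed K) {w : E × ℝ} (hw : w ∈ M.Om)
    (h : w ∈ frontier (M.cone K)) : M.nrm w ∈ frontier K := by
  by_cases hm : M.nrm w ∈ K
  · exact frontier_of_mem hm fun hi => h.2 (mem_interior_iff_mem_nhds.2 (M.cone_mem_nhds hw hi))
  · exfalso
    obtain ⟨w', h1, h2⟩ := mem_closure_iff_nhds.1 h.1 _ (inter_mem (M.isOpen_Om.mem_nhds hw)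
      ((M.continuousAt_nrm hw).eventually (hK.isOpen_compl.mem_nhds hm)))
    rcases h2 with rfl | h2
    · exact M.zero_notMem_Om h1.1
    · exact h1.2 h2.2

lemma smul_mem_frontier_cone {K : Set X} (hK : IsClosed K) {x : X} (hx : x ∈ frontier K) {s : ℝ}
    (hs : 0 < s) : s • M x ∈ frontier (M.cone K) := by
  have hm : s • M x ∈ M.cone K :=
    Or.inr ⟨M.smul_mem_Om hs x, by rw [M.nrm_smul hs]; exact hK.frontier_subset hx⟩
  refine ⟨_root_.subset_closure hm, fun hi => hx.2 ?_⟩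
  have hc : ContinuousAt (fun z => s • M z) x := (M.continuous.const_smul s).continuousAt
  rw [mem_interior_iff_mem_nhds] at hi ⊢
  filter_upwards [hc.eventually hi] with z hz
  rcases hz with hz | hz
  · exact absurd (hz ▸ M.smul_mem_Om hs z) M.zero_notMem_Om
  · rw [M.nrm_smul hs] at hz; exact hz.2

lemma exists_chart {K : Set X} (hK : IsClosed K) (hc : GConvex K) (hint : (interior K).Nonempty)
    {x₀ : X} (hx₀ : x₀ ∈ frontier K) :
    ∃ (U : Set (E × ℝ)) (Z : E × ℝ → X), IsOpen U ∧ M x₀ ∈ U ∧ Z (M x₀) = x₀ ∧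
      (∀ w ∈ U, Z w ∈ frontier K) ∧
      (∀ w ∈ U, ∃ C, ∀ᶠ w' in nhds w, ‖M (Z w') - M (Z w)‖ ≤ C * ‖w' - w‖) ∧
      ∀ w ∈ U, ∃ s > (0 : ℝ), ∀ x ∈ frontier K, Z (w + s • (M x - M (Z w))) = x := by
  obtain ⟨o, ho⟩ := hint
  set C : Set (E × ℝ) := (fun v => M o + v) ⁻¹' M.cone K with hC
  have hconv : Convex ℝ C := (M.convex_cone hc).translate_preimage_right _
  have hC0 : C ∈ nhds 0 := by
    have : ContinuousAt (fun v => M o + v) 0 := by fun_prop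
    refine this.preimage_mem_nhds ?_
    rw [add_zero]
    exact M.cone_mem_nhds (M.mem_Om o) (by rwa [M.nrm_M])
  have hfr : ∀ v, v ∈ frontier C ↔ M o + v ∈ frontier (M.cone K) := by
    intro v
    have := (Homeomorph.addLeft (M o)).preimage_frontier (M.cone K)
    exact (Set.ext_iff.1 this v).symm
  set g : E × ℝ → ℝ := fun w => gauge C (w - M o) with hg
  have hgc : Continuous g := (continuous_gauge hconv hC0).comp (continuous_id.sub continuous_const)
  have hg1 : ∀ x ∈ frontier K, ∀ s : ℝ, 0 < s → gauge C (s • M x - M o) = 1 := by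
    intro x hx s hs
    rw [gauge_eq_one_iff_mem_frontier hconv hC0, hfr]
    have := M.smul_mem_frontier_cone hK hx hs
    simpa using this
  set u : E × ℝ → E × ℝ := fun w => M o + (g w)⁻¹ • (w - M o) with hu
  set U : Set (E × ℝ) := {w | 0 < g w} ∩ u ⁻¹' M.Om with hU
  have hpos : IsOpen {w | 0 < g w} := isOpen_lt continuous_const hgc
  have huc : ContinuousOn u {w | 0 < g w} := by
    refine continuousOn_const.add ((hgc.continuousOn.inv₀ fun w hw => ne_of_gt hw).smul ?_)
    fun_prop
  have hUo : IsOpen U := huc.isOpen_inter_preimage hpos M.isOpen_Om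
  have hgx : g (M x₀) = 1 := by
    have := hg1 x₀ hx₀ 1 one_pos
    rwa [one_smul] at this
  have hux : u (M x₀) = M x₀ := by simp [hu, hgx]
  refine ⟨U, fun w => M.nrm (u w), hUo, ⟨?_, ?_⟩, ?_, ?_, ?_, ?_⟩
  · change 0 < g (M x₀); rw [hgx]; exact one_pos
  · rw [mem_preimage, hux]; exact M.mem_Om _
  · change M.nrm (u (M x₀)) = x₀
    rw [hux, M.nrm_M]
  · intro w hw
    have h1 : 0 < g w := hw.1
    refine M.nrm_mem_frontier hK hw.2 ?_
    rw [← hfr, ← gauge_eq_one_iff_mem_frontier hconv hC0, gauge_smul_of_nonneg (inv_pos.2 h1).le,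
      smul_eq_mul]
    exact inv_mul_cancel₀ h1.ne'
  · intro w hw
    have h1 : 0 < g w := hw.1
    set Φ : (E × ℝ) × ℝ → E × ℝ := fun p =>
      (√(M.q (M o + p.2⁻¹ • (p.1 - M o)) (M o + p.2⁻¹ • (p.1 - M o))))⁻¹ •
        (M o + p.2⁻¹ • (p.1 - M o)) with hΦ
    have hΦd : DifferentiableAt ℝ Φ (w, g w) := by
      have d1 : DifferentiableAt ℝ (fun p : (E × ℝ) × ℝ => M o + p.2⁻¹ • (p.1 - M o)) (w, g w) := by
        have a1 : DifferentiableAt ℝ (fun p : (E × ℝ) × ℝ => p.2⁻¹) (w, g w) :=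
          differentiableAt_snd.fun_inv h1.ne'
        have a2 : DifferentiableAt ℝ (fun p : (E × ℝ) × ℝ => p.1 - M o) (w, g w) :=
          differentiableAt_fst.sub_const _
        exact (a1.fun_smul a2).const_add _
      have d2 : DifferentiableAt ℝ (fun p : (E × ℝ) × ℝ =>
          M.q (M o + p.2⁻¹ • (p.1 - M o)) (M o + p.2⁻¹ • (p.1 - M o))) (w, g w) := by
        unfold q
        have d3 := d1.fst
        have d4 := d1.snd
        exact (d4.mul d4).add ((d3.inner ℝ d3).const_mul _)
      have hp : 0 < M.q (u w) (u w) := hw.2.1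
      exact ((d2.sqrt hp.ne').inv (Real.sqrt_pos.2 hp).ne').smul d1
    obtain ⟨c, hcO⟩ := hΦd.hasFDerivAt.isBigO_sub.bound
    obtain ⟨r, hlip⟩ := hconv.lipschitz_gauge hC0
    set R : ℝ := max 1 r
    refine ⟨|c| * R, ?_⟩
    have hcg : ContinuousAt (fun w' => (w', g w')) w := (continuous_id.prodMk hgc).continuousAt
    filter_upwards [hcg.eventually hcO, hUo.mem_nhds hw] with w' h2 h3
    rw [M.M_nrm hw.2, M.M_nrm h3.2]
    have e1 : ‖g w' - g w‖ ≤ r * ‖w' - w‖ := by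
      have := hlip.dist_le_mul (w' - M o) (w - M o)
      rw [dist_eq_norm, dist_eq_norm, sub_sub_sub_cancel_right] at this
      exact this
    have e2 : ‖((w', g w') : (E × ℝ) × ℝ) - (w, g w)‖ ≤ R * ‖w' - w‖ := by
      rw [Prod.mk_sub_mk, Prod.norm_mk]
      refine max_le ?_ (e1.trans (by gcongr; exact le_max_right _ _))
      exact le_mul_of_one_le_left (norm_nonneg _) (le_max_left _ _)
    calc _ ≤ c * ‖((w', g w') : (E × ℝ) × ℝ) - (w, g w)‖ := h2
      _ ≤ |c| * (R * ‖w' - w‖) := by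
        refine mul_le_mul (le_abs_self c) e2 (norm_nonneg _) (abs_nonneg c)
      _ = _ := by ring
  · intro w hw
    have h1 : 0 < g w := hw.1
    set μ := √(M.q (u w) (u w)) with hμ
    have hμ0 : 0 < μ := M.sqrt_q_pos hw.2
    have hμu : μ • M (M.nrm (u w)) = u w := M.smul_nrm hw.2
    refine ⟨g w * μ, by positivity, fun x hx => ?_⟩
    have e1 : w + (g w * μ) • (M x - M (M.nrm (u w))) - M o = g w • (μ • M x - M o) := by
      have e3 : g w • (g w)⁻¹ • (w - M o) = w - M o := smul_inv_smul₀ h1.ne' _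
      have e2 : g w • u w = g w • M o + (w - M o) := by rw [hu]; simp only [smul_add, e3]
      rw [smul_sub, mul_smul, mul_smul, hμu, e2, smul_sub]
      abel
    have e2 : g (w + (g w * μ) • (M x - M (M.nrm (u w)))) = g w := by
      change gauge C (w + (g w * μ) • (M x - M (M.nrm (u w))) - M o) = g w
      rw [e1, gauge_smul_of_nonneg h1.le, hg1 x hx μ hμ0, smul_eq_mul, mul_one]
    change M.nrm (M o + (g (w + (g w * μ) • (M x - M (M.nrm (u w)))))⁻¹ •
      (w + (g w * μ) • (M x - M (M.nrm (u w))) - M o)) = x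
    rw [e2, e1, inv_smul_smul₀ h1.ne', add_sub_cancel, M.nrm_smul hμ0]

end SF

lemma IsMidpoint.symm {p x y : X} (h : IsMidpoint p x y) : IsMidpoint p y x := by
  obtain ⟨h1, h2⟩ := h
  unfold Btw at h1
  refine ⟨?_, ?_⟩
  · unfold Btw
    rw [dist_comm y p, dist_comm p x, dist_comm y x]
    linarith
  · rw [dist_comm y p, dist_comm p x]
    exact h2.symm

lemma SymmetricWrtPerpBisector.symm {S : Set X} {a b : X} (h : SymmetricWrtPerpBisector S a b) :
    SymmetricWrtPerpBisector S b a := by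
  obtain ⟨σ, h1, rfl, h2⟩ := h
  exact ⟨σ, h1, DFunLike.congr_fun h1.1 a, h2⟩

lemma T6Cond3.symm {K L : Set X} (h : T6Cond3 K L) : T6Cond3 L K := by
  intro x hx y hy
  obtain ⟨ε, hε, H⟩ := h y hy x hx
  refine ⟨ε, hε, fun φ ψ hφ hψ => ?_⟩
  rw [inter_comm, pair_comm]
  intro h1 h2 p r h3 h4 h5 h6 h7
  exact (H ψ φ hψ hφ h1 h2 p r h3 h4 h6 h5 h7.symm).symm

namespace SF

variable {E : Type*} [NormedAddCommGroup E] [InnerProductSpace ℝ E]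
variable (M : SF X E) [Nonempty X] [Fact (2 ≤ Module.finrank ℝ E)]

lemma germ_odd {K L : Set X} (hK : GConvex K) (hL : GConvex L) (h3 : T6Cond3 K L) {x y : X}
    {n m : E × ℝ} (nK : M.IsNormal K x n) (nL : M.IsNormal L y m) (sK : M.SC K x n)
    (sL : M.k = -1 → M.SC L y m) {i : ℕ} {g : X ≃ᵢ X} {G : E × ℝ →ₗ[ℝ] E × ℝ} (hi : Odd i)
    (hg : M.RProd i g G) (hx : g x = y) (hn : G n = m) :
    ∀ᶠ z in nhds y, (z ∈ g '' K ↔ z ∈ L) := by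
  subst hx hn
  obtain ⟨ε, hε, H⟩ := h3 x nK.frontier _ nL.frontier
  refine M.lens (GConvex_image hK g) hL (nK.image hg.cong) nL (sK.image nK.ut.tan hg.cong) sL
    ⟨ε, hε, fun a c σ => ?_⟩
  have := H (g.trans σ.refl) (IsometryEquiv.refl X)
    ((hg.trans (RProd.mirror σ)).op (hi.add_odd odd_one)) ((RProd.refl : M.RProd 0 _ _).op (by simp))
  have e1 : ⇑(g.trans σ.refl) '' K = σ.refl '' (g '' K) := by
    exact image_comp σ.refl g K
  have e2 : ⇑(IsometryEquiv.refl X) '' L = L := image_id L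
  rw [e1, e2] at this
  exact this

lemma frontier_congr {K L : Set X} {x : X} (h : ∀ᶠ z in nhds x, (z ∈ K ↔ z ∈ L)) :
    x ∈ frontier K ↔ x ∈ frontier L := by
  have h1 : x ∈ closure K ↔ x ∈ closure L := by
    rw [mem_closure_iff_frequently, mem_closure_iff_frequently]
    exact frequently_congr h
  have h2 : x ∈ interior K ↔ x ∈ interior L := by
    rw [mem_interior_iff_mem_nhds, mem_interior_iff_mem_nhds]
    exact eventually_congr h
  rw [frontier, frontier, Set.mem_sdiff, Set.mem_sdiff, h1, h2]

lemma IsNormal.eq_of_germ {K L : Set X} {x : X} {n m : E × ℝ} (nK : M.IsNormal K x n)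
    (nL : M.IsNormal L x m) (h : ∀ᶠ z in nhds x, (z ∈ K ↔ z ∈ L)) : n = m := by
  obtain ⟨κ, -, hκ⟩ := nK.inner
  exact M.normal_unique_of_subset nK.ut nL.ut hκ
    (h.mono fun z hz hzK => nL.sup (hz.1 hzK))

/-- Standing data for a pair of bodies to which the lens lemma applies everywhere. -/
structure Pair (K L : Set X) : Prop where
  clK : IsClosed K
  clL : IsClosed L
  cvK : GConvex K
  cvL : GConvex L
  inK : (interior K).Nonempty
  inL : (interior L).Nonempty
  frK : (frontier K).Nonempty
  frL : (frontier L).Nonempty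
  nmK : ∀ x ∈ frontier K, ∃ n, M.IsNormal K x n
  nmL : ∀ x ∈ frontier L, ∃ n, M.IsNormal L x n
  scK : ∀ x n, M.IsNormal K x n → M.SC K x n
  scL : ∀ x n, M.IsNormal L x n → M.SC L x n
  c3 : T6Cond3 K L

variable {M}

lemma Pair.symm {K L : Set X} (h : M.Pair K L) : M.Pair L K :=
  ⟨h.clL, h.clK, h.cvL, h.cvK, h.inL, h.inK, h.frL, h.frK, h.nmL, h.nmK, h.scL, h.scK, h.c3.symm⟩

lemma Pair.germ_odd {K L : Set X} (h : M.Pair K L) {x y : X} {n m : E × ℝ}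
    (nK : M.IsNormal K x n) (nL : M.IsNormal L y m) {i : ℕ} {g : X ≃ᵢ X}
    {G : E × ℝ →ₗ[ℝ] E × ℝ} (hi : Odd i) (hg : M.RProd i g G) (hx : g x = y) (hn : G n = m) :
    ∀ᶠ z in nhds y, (z ∈ g '' K ↔ z ∈ L) :=
  M.germ_odd h.cvK h.cvL h.c3 nK nL (h.scK _ _ nK) (fun _ => h.scL _ _ nL) hi hg hx hn

lemma Pair.germ_even {K L : Set X} (h : M.Pair K L) {x x' : X} {n n' : E × ℝ}
    (nK : M.IsNormal K x n) (nK' : M.IsNormal K x' n') {i : ℕ} {g : X ≃ᵢ X}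
    {G : E × ℝ →ₗ[ℝ] E × ℝ} (hi : Even i) (hg : M.RProd i g G) (hx : g x = x') (hn : G n = n') :
    ∀ᶠ z in nhds x', (z ∈ g '' K ↔ z ∈ K) := by
  obtain ⟨y, hy⟩ := h.frL
  obtain ⟨m, nL⟩ := h.nmL y hy
  obtain ⟨j, f, F, hj, hf, hfx, hfn⟩ := M.exists_frame_odd nL.ut nK.ut
  have h1 := h.symm.germ_odd nL nK hj hf hfx hfn
  have h2 := h.symm.germ_odd nL nK' (hj.add_even hi) (hf.trans hg)
    (by rw [IsometryEquiv.trans_apply, hfx, hx]) (by rw [LinearMap.comp_apply, hfn, hn])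
  have h3 : Tendsto g.symm (nhds x') (nhds x) := by
    have := g.symm.continuous.tendsto x'
    rwa [← hx, g.symm_apply_apply, hx] at this
  filter_upwards [h2, h3.eventually h1] with z hz1 hz2
  have e : ⇑(f.trans g) '' L = g '' (f '' L) := image_comp g f L
  rw [← hz1, e]
  have key : ∀ S : Set X, z ∈ g '' S ↔ g.symm z ∈ S := fun S => by
    constructor
    · rintro ⟨w, hw, rfl⟩; rwa [g.symm_apply_apply]
    · intro hw; exact ⟨_, hw, g.apply_symm_apply z⟩
  rw [key, key]
  exact hz2.symm

lemma exists_frame_even {x y : X} {n m : E × ℝ} (hn : M.UT x n) (hm : M.UT y m) :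
    ∃ i f F, Even i ∧ M.RProd i f F ∧ f x = y ∧ F n = m := by
  obtain ⟨i, f, F, hi, hf, hx, hF⟩ := M.exists_frame_odd hn hm
  obtain ⟨g, G, hg, hgy, hG⟩ := M.exists_frame_refl hm
  exact ⟨i + 1, _, _, hi.add_odd odd_one, hf.trans hg,
    by rw [IsometryEquiv.trans_apply, hx, hgy], by rw [LinearMap.comp_apply, hF, hG]⟩

lemma Pair.of_one {K L : Set X} (clK : IsClosed K) (clL : IsClosed L) (cvK : GConvex K)
    (cvL : GConvex L) (inK : (interior K).Nonempty) (inL : (interior L).Nonempty)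
    (frL : (frontier L).Nonempty)
    (bK : CondBallInside K) (bL : CondBallInside L) (h3 : T6Cond3 K L) (hk : M.k ≠ -1)
    {x : X} {n : E × ℝ} (nK : M.IsNormal K x n) (sK : M.SC K x n) : M.Pair K L := by
  have step : ∀ {K L : Set X}, GConvex K → GConvex L → T6Cond3 K L → ∀ {x : X} {n : E × ℝ},
      M.IsNormal K x n → M.SC K x n → ∀ y m, M.IsNormal L y m → M.SC L y m := by
    intro K L cvK cvL h3 x n nK sK y m nL
    obtain ⟨j, f, F, hj, hf, hfx, hfn⟩ := M.exists_frame_odd nK.ut nL.ut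
    have h1 := M.germ_odd cvK cvL h3 nK nL sK (fun h => absurd h hk) hj hf hfx hfn
    have h2 := sK.image nK.ut.tan hf.cong
    rw [hfx, hfn] at h2
    exact h2.congr h1
  have hL := step cvK cvL h3 nK sK
  obtain ⟨y, hy⟩ := frL
  obtain ⟨m, nL⟩ := M.exists_normal cvL bL hy
  exact ⟨clK, clL, cvK, cvL, inK, inL, ⟨x, nK.frontier⟩, ⟨y, hy⟩,
    fun x hx => M.exists_normal cvK bK hx, fun x hx => M.exists_normal cvL bL hx,
    step cvL cvK h3.symm nL (hL _ _ nL), hL, h3⟩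

end SF

lemma inter_frontier_nonempty {Y : Type*} [TopologicalSpace Y] {s K : Set Y}
    (hs : IsPreconnected s) (hK : IsClosed K) (h1 : (s ∩ K).Nonempty) (h2 : (s ∩ Kᶜ).Nonempty) :
    (s ∩ frontier K).Nonempty := by
  by_contra hne
  have hsub : s ⊆ interior K ∪ Kᶜ := by
    intro x hx
    by_cases hxK : x ∈ K
    · left
      by_contra hi
      exact hne ⟨x, hx, _root_.subset_closure hxK, hi⟩
    · exact Or.inr hxK
  obtain ⟨x, -, hx1, hx2⟩ := hs _ _ isOpen_interior hK.isOpen_compl hsub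
    (by
      obtain ⟨x, hx, hxK⟩ := h1
      rcases hsub hx with h | h
      · exact ⟨x, hx, h⟩
      · exact absurd hxK h) h2
  exact hx2 (interior_subset hx1)

lemma eq_zero_of_trig {α β : ℝ}
    (h : ∀ θ : ℝ, 0 ≤ (Real.cos θ - 1) * α + Real.sin θ * β) : β = 0 := by
  have hd : HasDerivAt (fun θ : ℝ => (Real.cos θ - 1) * α + Real.sin θ * β)
      (-Real.sin 0 * α + Real.cos 0 * β) 0 :=
    (((Real.hasDerivAt_cos 0).sub_const 1).mul_const α).add ((Real.hasDerivAt_sin 0).mul_const β)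
  have hm : IsLocalMin (fun θ : ℝ => (Real.cos θ - 1) * α + Real.sin θ * β) 0 :=
    Eventually.of_forall fun θ => by simpa using h θ
  simpa using hm.hasDerivAt_eq_zero hd

namespace SF

variable {E : Type*} [NormedAddCommGroup E] [InnerProductSpace ℝ E]
variable (M : SF X E) [Nonempty X] [Fact (2 ≤ Module.finrank ℝ E)]

/-- A choice of inner normal. -/
noncomputable def nu (K : Set X) (x : X) : E × ℝ := Classical.epsilon fun n => M.IsNormal K x n

variable {M} in
lemma IsNormal.nu_eq {K : Set X} {x : X} {n : E × ℝ} (h : M.IsNormal K x n) : M.nu K x = n :=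
  IsNormal.unique (M := M) (Classical.epsilon_spec (p := fun n => M.IsNormal K x n) ⟨n, h⟩) h

variable {M}

lemma finiteDimensional_of_fact : FiniteDimensional ℝ E := by
  have hE : 2 ≤ Module.finrank ℝ E := Fact.out
  exact FiniteDimensional.of_finrank_pos (by omega)

/-- The normal map has a shape operator at some boundary point. -/
lemma Pair.exists_shape {K L : Set X} (P : M.Pair K L) :
    ∃ z n, M.IsNormal K z n ∧ ∃ A : E × ℝ →L[ℝ] E × ℝ, ∀ ε > (0 : ℝ), ∀ᶠ x in nhds z, ∀ m,
      M.IsNormal K x m → ‖m - n - A (M x - M z)‖ ≤ ε * ‖M x - M z‖ := by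
  have : FiniteDimensional ℝ E := finiteDimensional_of_fact
  obtain ⟨x₀, hx₀⟩ := P.frK
  obtain ⟨U, Z, hU, hxU, -, hZ, hlip, hret⟩ := M.exists_chart P.clK P.cvK P.inK hx₀
  have hnu : ∀ x ∈ frontier K, M.IsNormal K x (M.nu K x) := fun x hx => by
    obtain ⟨n, hn⟩ := P.nmK x hx
    rwa [hn.nu_eq]
  obtain ⟨w, hw, hd⟩ := exists_differentiableAt hU ⟨_, hxU⟩ (f := fun w => M.nu K (Z w)) (by
    intro w hw
    obtain ⟨C, hC⟩ := hlip w hw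
    obtain ⟨C', hC'⟩ := IsNormal.lipschitz M (hnu _ (hZ w hw))
    have ht : Tendsto Z (nhds w) (nhds (Z w)) := by
      rw [← M.tendsto_iff, tendsto_iff_norm_sub_tendsto_zero]
      have h0 : Tendsto (fun w' => C * ‖w' - w‖) (nhds w) (nhds 0) := by
        have : Continuous fun w' => C * ‖w' - w‖ := by fun_prop
        simpa using this.tendsto w
      exact squeeze_zero' (Eventually.of_forall fun _ => norm_nonneg _) hC h0
    refine ⟨|C'| * C, ?_⟩
    filter_upwards [hC, ht.eventually hC', hU.mem_nhds hw] with w' h1 h2 h3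
    calc _ ≤ C' * ‖M (Z w') - M (Z w)‖ := h2 _ (hnu _ (hZ w' h3))
      _ ≤ |C'| * ‖M (Z w') - M (Z w)‖ := by gcongr; exact le_abs_self _
      _ ≤ |C'| * (C * ‖w' - w‖) := by gcongr
      _ = _ := by ring)
  obtain ⟨s, hs, hret⟩ := hret w hw
  set D := fderiv ℝ (fun w => M.nu K (Z w)) w
  refine ⟨Z w, M.nu K (Z w), hnu _ (hZ w hw), s • D, fun ε hε => ?_⟩
  have h1 := hd.hasFDerivAt.isLittleO.def (div_pos hε hs)
  have h2 : Tendsto (fun x => w + s • (M x - M (Z w))) (nhds (Z w)) (nhds w) := by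
    have := M.continuous
    have h : Continuous fun x => w + s • (M x - M (Z w)) := by fun_prop
    simpa using h.tendsto (Z w)
  filter_upwards [h2.eventually h1] with x hx m hm
  rw [hret x hm.frontier, hm.nu_eq, add_sub_cancel_left, norm_smul, Real.norm_of_nonneg hs.le,
    ← mul_assoc, div_mul_cancel₀ _ hs.ne', map_smul] at hx
  exact hx

/-- Boundary points in a given tangent direction. -/
lemma exists_boundary_curve {K : Set X} (hK : IsClosed K) {z : X} {n e : E × ℝ}
    (hn : M.IsNormal K z n) (he : M.UT z e) (hen : M.b e n = 0) {ε : ℝ} (hε : 0 < ε) :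
    ∀ᶠ t in nhdsWithin (0 : ℝ) (Ioi 0), ∃ x ∈ frontier K, ‖M x - M z - t • e‖ ≤ ε * t := by
  obtain ⟨κ, hκ1, hκ⟩ := hn.inner
  have hκ0 : 0 < κ := by linarith
  have hdir : ∀ φ : ℝ, M.UT z (Real.cos φ • e + Real.sin φ • n) := fun φ => by
    refine ⟨(he.tan.smul _).add (hn.ut.tan.smul _), ?_⟩
    simp only [b_add_left, b_add_right, b_smul_left, b_smul_right, he.unit, hn.ut.unit, hen,
      M.b_comm n e]
    linear_combination Real.cos_sq_add_sin_sq φ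
  set η := ε / (2 * (‖M z‖ + ‖e‖ + 1)) with hη
  have hη0 : 0 < η := by positivity
  have ev1 : ∀ᶠ t in nhdsWithin (0 : ℝ) (Ioi 0), |cs M.k t - 1| ≤ η * t := by
    have := ((hasDerivAt_cs M.hk 0).isLittleO.def hη0).filter_mono
      (nhdsWithin_le_nhds (s := Ioi 0))
    filter_upwards [this, self_mem_nhdsWithin] with t ht ht0
    have ht0' : (0 : ℝ) < t := ht0
    simpa [cs_zero M.hk, sn_zero M.hk, abs_of_pos ht0'] using ht
  have ev2 : ∀ᶠ t in nhdsWithin (0 : ℝ) (Ioi 0), |sn M.k t - t| ≤ η * t := by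
    have := ((hasDerivAt_sn M.hk 0).isLittleO.def hη0).filter_mono
      (nhdsWithin_le_nhds (s := Ioi 0))
    filter_upwards [this, self_mem_nhdsWithin] with t ht ht0
    have ht0' : (0 : ℝ) < t := ht0
    simpa [cs_zero M.hk, sn_zero M.hk, abs_of_pos ht0'] using ht
  have ev3 : ∀ᶠ t in nhdsWithin (0 : ℝ) (Ioi 0), |sn M.k t - t| ≤ 1 * t := by
    have := ((hasDerivAt_sn M.hk 0).isLittleO.def one_pos).filter_mono
      (nhdsWithin_le_nhds (s := Ioi 0))
    filter_upwards [this, self_mem_nhdsWithin] with t ht ht0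
    have ht0' : (0 : ℝ) < t := ht0
    simpa [cs_zero M.hk, sn_zero M.hk, abs_of_pos ht0'] using ht
  have ev4 : ∀ᶠ t in nhdsWithin (0 : ℝ) (Ioi 0),
      (κ * t) ^ 2 * ‖e‖ + 2 * (κ * t) * ‖n‖ < ε / 2 := by
    have : Continuous fun t : ℝ => (κ * t) ^ 2 * ‖e‖ + 2 * (κ * t) * ‖n‖ := by fun_prop
    exact ((this.tendsto 0).mono_left nhdsWithin_le_nhds).eventually_lt_const
      (by simpa using half_pos hε)
  have ev5 : ∀ᶠ t in nhdsWithin (0 : ℝ) (Ioi 0), κ * t < 1 := by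
    have : Continuous fun t : ℝ => κ * t := by fun_prop
    exact ((this.tendsto 0).mono_left nhdsWithin_le_nhds).eventually_lt_const (by simp)
  have ev6 : ∀ᶠ t in nhdsWithin (0 : ℝ) (Ioi 0), κ * vs M.k t ≤ sn M.k t * Real.sin (κ * t) := by
    have hid : HasDerivAt (fun t : ℝ => t / 2) (1 / 2) 0 := (hasDerivAt_id (0 : ℝ)).div_const 2
    have h1 : HasDerivAt (fun t => Real.sin (κ * t)) κ 0 := by
      simpa using (((hasDerivAt_id (0 : ℝ)).const_mul κ).sin)
    have h2 : HasDerivAt (fun t => cs M.k (t / 2)) (-(M.k * sn M.k (0 / 2)) * (1 / 2)) 0 :=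
      HasDerivAt.comp (h₂ := cs M.k) (0 : ℝ) (hasDerivAt_cs M.hk (0 / 2)) hid
    have h3 : HasDerivAt (fun t => sn M.k (t / 2)) (cs M.k (0 / 2) * (1 / 2)) 0 :=
      HasDerivAt.comp (h₂ := sn M.k) (0 : ℝ) (hasDerivAt_sn M.hk (0 / 2)) hid
    have h4 := ((h2.mul h1).sub (h3.const_mul κ)).isLittleO.def (by positivity : 0 < κ / 2)
    filter_upwards [h4.filter_mono (nhdsWithin_le_nhds (s := Ioi 0)), self_mem_nhdsWithin,
      Ioo_mem_nhdsGT (zero_lt_one' ℝ)] with t ht ht0 ht1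
    have ht0' : (0 : ℝ) < t := ht0
    have hs : 0 < sn M.k (t / 2) := sn_pos M.hk (half_pos ht1.1) fun _ => by
      linarith [ht1.2, Real.pi_gt_three]
    have hG : 0 ≤ cs M.k (t / 2) * Real.sin (κ * t) - κ * sn M.k (t / 2) := by
      simp [cs_zero M.hk, sn_zero M.hk, abs_of_pos ht0'] at ht
      nlinarith [(abs_le.1 ht).1]
    have e : sn M.k t = 2 * sn M.k (t / 2) * cs M.k (t / 2) := by
      have := sn_add M.hk (t / 2) (t / 2)
      rw [add_halves] at this
      rw [this]; ring
    rw [e, vs]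
    nlinarith
  filter_upwards [ev1, ev2, ev3, ev4, ev5, ev6, M.eventually_sn_pos, self_mem_nhdsWithin] with
    t t1 t2 t3 t4 t5 t6 t7 t8
  have t0 : (0 : ℝ) < t := t8
  have hκt : 0 < κ * t := mul_pos hκ0 t0
  set p : ℝ → X := fun φ => M.exp z (Real.cos φ • e + Real.sin φ • n) t with hp
  have hMp : ∀ φ, M (p φ) = cs M.k t • M z + sn M.k t • (Real.cos φ • e + Real.sin φ • n) :=
    fun φ => M.M_exp (hdir φ) t
  have hpc : Continuous p := by
    rw [M.isInducing.continuous_iff]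
    have : (M ∘ p) = fun φ => cs M.k t • M z + sn M.k t • (Real.cos φ • e + Real.sin φ • n) :=
      funext hMp
    rw [this]; fun_prop
  have hpn : ∀ φ, M.b (M (p φ) - M z) n = sn M.k t * Real.sin φ := fun φ => by
    rw [hp, M.b_exp_sub (hdir φ) hn.ut.tan]
    simp only [b_add_left, b_smul_left, hen, hn.ut.unit]; ring
  have hph : ∀ φ, M.h (p φ) z = vs M.k t := fun φ => by
    have := M.h_exp_exp (hdir φ) t 0
    rwa [M.exp_zero, sub_zero] at this
  have hsin : 0 < Real.sin (κ * t) := Real.sin_pos_of_pos_of_lt_pi hκt (by linarith [Real.pi_gt_three])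
  obtain ⟨x, ⟨φ, hφ, rfl⟩, hx⟩ := inter_frontier_nonempty
    ((isPreconnected_Icc (a := -(κ * t)) (b := κ * t)).image p hpc.continuousOn) hK
    ⟨p (κ * t), mem_image_of_mem p ⟨by linarith, le_rfl⟩, hκ (by
      rw [mem_D, hph, hpn]; exact t6)⟩
    ⟨p (-(κ * t)), mem_image_of_mem p ⟨le_rfl, by linarith⟩, fun hm => by
      have := hn.sup hm
      rw [mem_D_zero, hpn, Real.sin_neg] at this
      nlinarith⟩
  refine ⟨_, hx, ?_⟩
  have hφ' : |φ| ≤ κ * t := abs_le.2 hφ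
  have e1 : M (p φ) - M z - t • e = (cs M.k t - 1) • M z +
      ((sn M.k t - t) + sn M.k t * (Real.cos φ - 1)) • e + (sn M.k t * Real.sin φ) • n := by
    rw [hMp]; module
  have hsn : |sn M.k t| ≤ 2 * t := by
    rw [abs_of_pos t7]; linarith [(abs_le.1 t3).2]
  have hcos : |Real.cos φ - 1| ≤ (κ * t) ^ 2 / 2 := by
    rw [abs_sub_comm, abs_of_nonneg (by linarith [Real.cos_le_one φ])]
    have h1 := Real.one_sub_sq_div_two_le_cos (x := φ)
    have h2 := sq_abs φ ▸ pow_le_pow_left₀ (abs_nonneg φ) hφ' 2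
    linarith
  have hsinφ : |Real.sin φ| ≤ κ * t := (Real.abs_sin_le_abs (x := φ)).trans hφ'
  have hη1 : η * (‖M z‖ + ‖e‖) ≤ ε / 2 := by
    rw [hη, div_mul_eq_mul_div, div_le_div_iff₀ (by positivity) two_pos]
    nlinarith [norm_nonneg (M z), norm_nonneg e]
  rw [e1]
  calc _ ≤ ‖(cs M.k t - 1) • M z‖ +
      ‖((sn M.k t - t) + sn M.k t * (Real.cos φ - 1)) • e‖ + ‖(sn M.k t * Real.sin φ) • n‖ :=
        norm_add₃_le
    _ = |cs M.k t - 1| * ‖M z‖ + |(sn M.k t - t) + sn M.k t * (Real.cos φ - 1)| * ‖e‖ +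
        |sn M.k t| * |Real.sin φ| * ‖n‖ := by
      rw [norm_smul, norm_smul, norm_smul, Real.norm_eq_abs, Real.norm_eq_abs, Real.norm_eq_abs,
        abs_mul (sn M.k t)]
    _ ≤ η * t * ‖M z‖ + (η * t + 2 * t * ((κ * t) ^ 2 / 2)) * ‖e‖ +
        2 * t * (κ * t) * ‖n‖ := by
      gcongr
      refine (abs_add_le _ _).trans (add_le_add t2 ?_)
      rw [abs_mul]
      gcongr
    _ = t * (η * (‖M z‖ + ‖e‖)) + t * ((κ * t) ^ 2 * ‖e‖ + 2 * (κ * t) * ‖n‖) := by ring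
    _ ≤ t * (ε / 2) + t * (ε / 2) := by gcongr
    _ = ε * t := by ring

end SF

namespace SF

variable {E : Type*} [NormedAddCommGroup E] [InnerProductSpace ℝ E]
variable {M : SF X E} [Nonempty X] [Fact (2 ≤ Module.finrank ℝ E)]

/-- `A` is a shape operator for `K` at `z`. -/
def Shape (M : SF X E) (K : Set X) (z : X) (n : E × ℝ) (A : E × ℝ →L[ℝ] E × ℝ) : Prop :=
  ∀ ε > (0 : ℝ), ∀ᶠ x in nhds z, ∀ m, M.IsNormal K x m → ‖m - n - A (M x - M z)‖ ≤ ε * ‖M x - M z‖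

lemma Pair.exists_seq {K L : Set X} (P : M.Pair K L) {z : X} {n e : E × ℝ}
    (hn : M.IsNormal K z n) {A : E × ℝ →L[ℝ] E × ℝ} (hA : M.Shape K z n A) (he : M.UT z e)
    (hen : M.b e n = 0) :
    ∃ (t : ℕ → ℝ) (x : ℕ → X) (m : ℕ → E × ℝ), (∀ j, 0 < t j) ∧ (∀ j, M.IsNormal K (x j) (m j)) ∧
      Tendsto x atTop (nhds z) ∧ Tendsto m atTop (nhds n) ∧
      Tendsto (fun j => (t j)⁻¹ • (M (x j) - M z)) atTop (nhds e) ∧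
      Tendsto (fun j => (t j)⁻¹ • (m j - n)) atTop (nhds (A e)) := by
  have key : ∀ j : ℕ, ∃ (t : ℝ) (x : X) (m : E × ℝ), 0 < t ∧ M.IsNormal K x m ∧
      t < 1 / ((j : ℝ) + 1) ∧ ‖t⁻¹ • (M x - M z) - e‖ ≤ 1 / ((j : ℝ) + 1) ∧
      ‖t⁻¹ • (m - n) - A (t⁻¹ • (M x - M z))‖ ≤ 1 / ((j : ℝ) + 1) := by
    intro j
    set ε : ℝ := 1 / ((j : ℝ) + 1) with hε
    have hε0 : 0 < ε := Nat.one_div_pos_of_nat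
    set δ : ℝ := ε / (‖e‖ + 1) with hδ
    have hδ0 : 0 < δ := by positivity
    set η : ℝ := min ε 1 with hη
    have hη0 : 0 < η := lt_min hε0 one_pos
    obtain ⟨V, hVz, hV⟩ : ∃ V ∈ nhds (M z), ∀ x, M x ∈ V → ∀ m, M.IsNormal K x m →
        ‖m - n - A (M x - M z)‖ ≤ δ * ‖M x - M z‖ := by
      have := hA δ hδ0
      rw [M.isInducing.nhds_eq_comap] at this
      obtain ⟨V, hV, hVs⟩ := mem_comap.1 this
      exact ⟨V, hV, fun x hx => hVs hx⟩
    obtain ⟨r, hr, hrV⟩ := Metric.mem_nhds_iff.1 hVz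
    have h1 := exists_boundary_curve P.clK hn he hen hη0
    have h2 : ∀ᶠ t in nhdsWithin (0 : ℝ) (Ioi 0), t < min ε (r / (‖e‖ + 1)) :=
      (tendsto_id.mono_left nhdsWithin_le_nhds).eventually_lt_const (by positivity)
    obtain ⟨t, ⟨x, hx, hxt⟩, ht, ht0⟩ := (h1.and (h2.and self_mem_nhdsWithin)).exists
    have ht0' : (0 : ℝ) < t := ht0
    obtain ⟨m, hm⟩ := P.nmK x hx
    have hxn : ‖M x - M z‖ ≤ (‖e‖ + 1) * t := by
      calc _ = ‖(M x - M z - t • e) + t • e‖ := by rw [sub_add_cancel]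
        _ ≤ η * t + ‖t • e‖ := (norm_add_le _ _).trans (by gcongr)
        _ ≤ 1 * t + t * ‖e‖ := by
          rw [norm_smul, Real.norm_of_nonneg ht0'.le]; gcongr; exact min_le_right _ _
        _ = _ := by ring
    have hxV : M x ∈ V := hrV (by
      rw [mem_ball, dist_eq_norm]
      have := ht.trans_le (min_le_right _ _)
      rw [lt_div_iff₀ (by positivity)] at this
      linarith)
    refine ⟨t, x, m, ht0', hm, ht.trans_le (min_le_left _ _), ?_, ?_⟩
    · have : t⁻¹ • (M x - M z) - e = t⁻¹ • (M x - M z - t • e) := by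
        rw [smul_sub t⁻¹ _ (t • e), inv_smul_smul₀ ht0'.ne']
      rw [this, norm_smul, norm_inv, Real.norm_of_nonneg ht0'.le, inv_mul_le_iff₀ ht0', mul_comm t]
      exact hxt.trans (by gcongr; exact min_le_left _ _)
    · rw [map_smul, ← smul_sub, norm_smul, norm_inv, Real.norm_of_nonneg ht0'.le,
        inv_mul_le_iff₀ ht0']
      calc _ ≤ δ * ‖M x - M z‖ := hV x hxV m hm
        _ ≤ δ * ((‖e‖ + 1) * t) := by gcongr
        _ = t * ε := by rw [hδ]; field_simp
  choose t x m h1 h2 h3 h4 h5 using key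
  have h0 := tendsto_one_div_add_atTop_nhds_zero_nat (𝕜 := ℝ)
  have l1 : Tendsto (fun j => (t j)⁻¹ • (M (x j) - M z)) atTop (nhds e) := by
    rw [tendsto_iff_norm_sub_tendsto_zero]
    exact squeeze_zero (fun _ => norm_nonneg _) h4 h0
  have l2 : Tendsto (fun j => (t j)⁻¹ • (m j - n)) atTop (nhds (A e)) := by
    have a1 : Tendsto (fun j => A ((t j)⁻¹ • (M (x j) - M z))) atTop (nhds (A e)) :=
      (A.continuous.tendsto e).comp l1
    have a2 : Tendsto (fun j => (t j)⁻¹ • (m j - n) - A ((t j)⁻¹ • (M (x j) - M z))) atTop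
        (nhds 0) := squeeze_zero_norm h5 h0
    simpa using a2.add a1
  have lt0 : Tendsto t atTop (nhds 0) := squeeze_zero (fun j => (h1 j).le) (fun j => (h3 j).le) h0
  refine ⟨t, x, m, h1, h2, ?_, ?_, l1, l2⟩
  · rw [← M.tendsto_iff]
    have := (lt0.smul l1).add_const (M z)
    simpa [smul_inv_smul₀ (h1 _).ne'] using this
  · have := (lt0.smul l2).add_const n
    simpa [smul_inv_smul₀ (h1 _).ne'] using this

lemma Pair.shape_tan {K L : Set X} (P : M.Pair K L) {z : X} {n e : E × ℝ}
    (hn : M.IsNormal K z n) {A : E × ℝ →L[ℝ] E × ℝ} (hA : M.Shape K z n A) (he : M.UT z e)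
    (hen : M.b e n = 0) : M.Tan z (A e) ∧ M.b (A e) n = 0 := by
  obtain ⟨t, x, m, ht, hm, lx, lm, l1, l2⟩ := P.exists_seq hn hA he hen
  have lMx : Tendsto (fun j => M (x j)) atTop (nhds (M z)) := M.tendsto_iff.2 lx
  constructor
  · have hc : Tendsto (fun j => M.q (M (x j)) ((t j)⁻¹ • (m j - n)) +
        M.q ((t j)⁻¹ • (M (x j) - M z)) n) atTop (nhds (M.q (M z) (A e) + M.q e n)) := by
      have c : Continuous fun p : (E × ℝ) × (E × ℝ) => M.q p.1 p.2 := by fun_prop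
      exact ((c.tendsto (M z, A e)).comp (lMx.prodMk_nhds l2)).add
        ((c.tendsto (e, n)).comp (l1.prodMk_nhds tendsto_const_nhds))
    have h0 : ∀ j, M.q (M (x j)) ((t j)⁻¹ • (m j - n)) +
        M.q ((t j)⁻¹ • (M (x j) - M z)) n = 0 := fun j => by
      have e1 : M.q (M (x j)) (m j) = 0 := (hm j).ut.tan
      have e2 : M.q (M z) n = 0 := hn.ut.tan
      rw [q_smul_left, q_smul_right, q_sub_left, q_sub_right, e1, e2]; ring
    have h1 := tendsto_nhds_unique hc (by simp only [h0]; exact tendsto_const_nhds)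
    have h2 : M.q e n = 0 := by
      by_cases hk : M.k = 0
      · simp [q, hk, M.tan_snd hk he.tan]
      · have h := M.k_mul_b (v := e) (w := n)
        rw [hen, M.k_sq hk] at h; linarith
    unfold Tan; linarith
  · have hc : Tendsto (fun j => M.b ((t j)⁻¹ • (m j - n)) (m j + n)) atTop
        (nhds (M.b (A e) (n + n))) := by
      have c : Continuous fun p : (E × ℝ) × (E × ℝ) => M.b p.1 p.2 := by fun_prop
      exact (c.tendsto (A e, n + n)).comp (l2.prodMk_nhds (lm.add_const n))
    have h0 : ∀ j, M.b ((t j)⁻¹ • (m j - n)) (m j + n) = 0 := fun j => by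
      rw [b_smul_left, b_add_right, b_sub_left, b_sub_left, (hm j).ut.unit, hn.ut.unit,
        M.b_comm n]; ring
    have h1 := tendsto_nhds_unique hc (by simp only [h0]; exact tendsto_const_nhds)
    rw [b_add_right] at h1; linarith

lemma Pair.shape_orth {K L : Set X} (P : M.Pair K L) {z : X} {n v w : E × ℝ}
    (hn : M.IsNormal K z n) {A : E × ℝ →L[ℝ] E × ℝ} (hA : M.Shape K z n A) (hv : M.UT z v)
    (hw : M.UT z w) (hvn : M.b v n = 0) (hwn : M.b w n = 0) (hvw : M.b v w = 0) :
    M.b w (A v) = 0 := by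
  have : FiniteDimensional ℝ E := finiteDimensional_of_fact
  obtain ⟨t, x, m, ht, hm, lx, lm, l1, l2⟩ := P.exists_seq hn hA hv hvn
  refine eq_zero_of_trig (α := M.b v (A v)) fun θ => ?_
  obtain ⟨i, f, F, hi, hf, hfz, hFn, hFv⟩ := M.exists_rotation hn.ut hv hw hvn hwn hvw θ
  have hg := P.germ_even hn hn hi hf hfz hFn
  have hFc : Continuous F := F.continuous_of_finiteDimensional
  have c : Continuous fun p : (E × ℝ) × (E × ℝ) => M.b p.1 p.2 := by fun_prop
  have hc : Tendsto (fun j => M.b (F ((t j)⁻¹ • (M (x j) - M z)) - (t j)⁻¹ • (M (x j) - M z))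
      ((t j)⁻¹ • (m j - n))) atTop (nhds (M.b (F v - v) (A v))) :=
    (c.tendsto (F v - v, A v)).comp ((((hFc.tendsto v).comp l1).sub l1).prodMk_nhds l2)
  have hfx : Tendsto (fun j => f (x j)) atTop (nhds z) := by
    have := (f.continuous.tendsto z).comp lx
    rwa [hfz] at this
  have h0 : ∀ᶠ j in atTop, 0 ≤ M.b (F ((t j)⁻¹ • (M (x j) - M z)) - (t j)⁻¹ • (M (x j) - M z))
      ((t j)⁻¹ • (m j - n)) := by
    filter_upwards [hfx.eventually hg] with j hj
    have hxK : x j ∈ K := (hm j).mem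
    have h1 := (hm j).sup (hj.1 (mem_image_of_mem f hxK))
    rw [mem_D_zero] at h1
    have h2 : M.b (M (f (x j)) - M (f z)) (F n) = M.b (M (x j) - M z) n :=
      hf.cong.b_sub hn.ut.tan (x j)
    rw [hFn, hfz] at h2
    have hFz : F (M z) = M z := by rw [← hf.cong.map, hfz]
    have e1 : F ((t j)⁻¹ • (M (x j) - M z)) - (t j)⁻¹ • (M (x j) - M z) =
        (t j)⁻¹ • (M (f (x j)) - M (x j)) := by
      rw [map_smul, map_sub, hFz, ← hf.cong.map, ← smul_sub]; congr 1; abel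
    rw [e1, b_smul_left, b_smul_right]
    have h3 : M.b (M (f (x j)) - M (x j)) (m j - n) = M.b (M (f (x j)) - M (x j)) (m j) := by
      simp only [b_sub_left, b_sub_right] at h2 ⊢
      linarith
    rw [h3]
    have := inv_pos.2 (ht j)
    positivity
  have h1 := ge_of_tendsto hc h0
  rw [hFv] at h1
  simp only [b_sub_left, b_add_left, b_smul_left] at h1
  linarith

/-- The shape operator is a multiple of the identity. -/
lemma Pair.shape_scalar {K L : Set X} (P : M.Pair K L) {z : X} {n : E × ℝ}
    (hn : M.IsNormal K z n) {A : E × ℝ →L[ℝ] E × ℝ} (hA : M.Shape K z n A) :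
    ∃ κ : ℝ, ∀ y, M.Tan z y → M.b y n = 0 → A y = -(κ • y) := by
  obtain ⟨v, hv, hvn⟩ := M.exists_UT_orth z n
  have hself : ∀ e, M.UT z e → M.b e n = 0 → A e = M.b e (A e) • e := by
    intro e he hen
    obtain ⟨h1, h2⟩ := P.shape_tan hn hA he hen
    have hyt : M.Tan z (A e - M.b e (A e) • e) := h1.sub (he.tan.smul _)
    have hyn : M.b (A e - M.b e (A e) • e) n = 0 := by
      rw [b_sub_left, b_smul_left, h2, hen]; ring
    have hye : M.b e (A e - M.b e (A e) • e) = 0 := by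
      rw [b_sub_right, b_smul_right, he.unit]; ring
    rw [← sub_eq_zero]
    by_contra hne
    have hu := M.UT_normalize hyt hne
    have h3 := P.shape_orth hn hA he hu hen (by rw [b_smul_left, hyn, mul_zero])
      (by rw [b_smul_right, hye, mul_zero])
    rw [b_smul_left] at h3
    have hp := M.tan_pos hyt hne
    rcases mul_eq_zero.1 h3 with h4 | h4
    · exact (inv_pos.2 (Real.sqrt_pos.2 hp)).ne' h4
    · have h5 : M.b (A e - M.b e (A e) • e) (A e - M.b e (A e) • e) = 0 := by
        rw [b_sub_right, h4, b_smul_right, M.b_comm _ e, hye]; ring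
      exact hp.ne' h5
  have heq : ∀ e, M.UT z e → M.b e n = 0 → M.b v e = 0 → M.b e (A e) = M.b v (A v) := by
    intro e he hen hve
    have hs : √(2 : ℝ) * √2 = 2 := Real.mul_self_sqrt (by norm_num)
    have h2 : (0 : ℝ) < √2 := by positivity
    have hi : (√(2 : ℝ))⁻¹ * (√2)⁻¹ = 1 / 2 := by rw [← mul_inv, hs]; norm_num
    have hev : M.b e v = 0 := by rw [b_comm]; exact hve
    have u1 : M.UT z ((√2)⁻¹ • (v + e)) := ⟨(hv.tan.add he.tan).smul _, by
      simp only [b_smul_left, b_smul_right, b_add_left, b_add_right, hv.unit, he.unit, hve, hev]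
      linear_combination 2 * hi⟩
    have u2 : M.UT z ((√2)⁻¹ • (v - e)) := ⟨(hv.tan.sub he.tan).smul _, by
      simp only [b_smul_left, b_smul_right, b_sub_left, b_sub_right, hv.unit, he.unit, hve, hev]
      linear_combination 2 * hi⟩
    have h3 := P.shape_orth hn hA u1 u2
      (by simp only [b_smul_left, b_add_left, hvn, hen]; ring)
      (by simp only [b_smul_left, b_sub_left, hvn, hen]; ring)
      (by
        simp only [b_smul_left, b_smul_right, b_sub_right, b_add_left, hv.unit, he.unit, hve, hev]
        ring)
    have h4 := P.shape_orth hn hA hv he hvn hen hve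
    have h5 := P.shape_orth hn hA he hv hen hvn hev
    simp only [map_smul, map_add, b_smul_left, b_smul_right, b_sub_left, b_add_right, h4, h5] at h3
    have h6 : (1 / 2) * (M.b v (A v) - M.b e (A e)) = 0 := by rw [← hi]; linarith
    linarith
  refine ⟨-M.b v (A v), fun y hy hyn => ?_⟩
  rw [neg_smul, neg_neg]
  have hdec : y = M.b v y • v + (y - M.b v y • v) := by abel
  have h1t : M.Tan z (y - M.b v y • v) := hy.sub (hv.tan.smul _)
  by_cases h0 : y - M.b v y • v = 0
  · rw [sub_eq_zero] at h0
    rw [h0, map_smul, hself v hv hvn, smul_comm]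
    simp only [b_smul_right, hv.unit, mul_one]
  · have hu := M.UT_normalize h1t h0
    set c := (√(M.b (y - M.b v y • v) (y - M.b v y • v)))⁻¹ with hc
    have hc0 : c ≠ 0 := (inv_pos.2 (Real.sqrt_pos.2 (M.tan_pos h1t h0))).ne'
    have hun : M.b (c • (y - M.b v y • v)) n = 0 := by
      rw [b_smul_left, b_sub_left, b_smul_left, hyn, hvn]; ring
    have huv : M.b v (c • (y - M.b v y • v)) = 0 := by
      rw [b_smul_right, b_sub_right, b_smul_right, hv.unit]; ring
    have h2 := hself _ hu hun
    rw [heq _ hu hun huv, map_smul, smul_comm] at h2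
    have h3 := smul_right_injective _ hc0 h2
    calc A y = A (M.b v y • v) + A (y - M.b v y • v) := by rw [← map_add, ← hdec]
      _ = M.b v y • A v + M.b v (A v) • (y - M.b v y • v) := by rw [map_smul, h3]
      _ = M.b v y • (M.b v (A v) • v) + M.b v (A v) • (y - M.b v y • v) := by rw [← hself v hv hvn]
      _ = M.b v (A v) • y := by module

end SF

namespace SF

variable {E : Type*} [NormedAddCommGroup E] [InnerProductSpace ℝ E]
variable {M : SF X E} [Nonempty X] [Fact (2 ≤ Module.finrank ℝ E)]

/-- `z` is an umbilic of curvature `κ`. -/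
def Umb (M : SF X E) (K : Set X) (κ : ℝ) (z : X) (n : E × ℝ) : Prop :=
  ∀ ε > (0 : ℝ), ∀ᶠ x in nhds z, ∀ m, M.IsNormal K x m →
    ‖m - n + κ • (M x - M z)‖ ≤ ε * ‖M x - M z‖

lemma tendsto_norm_chord (z : X) : Tendsto (fun x => ‖M x - M z‖) (nhds z) (nhds 0) := by
  have := M.continuous
  have h : Continuous fun x => ‖M x - M z‖ := by fun_prop
  simpa using h.tendsto z

lemma Shape.umb {K : Set X} {z : X} {n : E × ℝ} (hn : M.IsNormal K z n)
    {A : E × ℝ →L[ℝ] E × ℝ} (hA : M.Shape K z n A) {κ : ℝ}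
    (hκ : ∀ y, M.Tan z y → M.b y n = 0 → A y = -(κ • y)) : M.Umb K κ z n := by
  intro ε hε
  obtain ⟨κi, hκi1, hκi⟩ := hn.inner
  set C : ℝ := ‖A (M z) + κ • M z‖ + κi * ‖A n + κ • n‖ with hC
  have hsm : ∀ᶠ x in nhds z, C * ‖M x - M z‖ < ε / 2 := by
    have := (tendsto_norm_chord (M := M) z).const_mul C
    rw [mul_zero] at this
    exact this.eventually_lt_const (half_pos hε)
  filter_upwards [hA (ε / 2) (half_pos hε), hsm] with x h1 h2 m hm
  set u := M x - M z with hu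
  have hh0 := M.h_nonneg x z
  have hb0 : 0 ≤ M.b u n := M.mem_D_zero.1 (hn.sup hm.mem)
  have hb1 : M.b u n ≤ κi * M.h x z := by
    by_contra! hlt
    exact hm.not_mem_interior (interior_mono hκi (M.mem_interior_D hlt))
  have hh1 : M.h x z ≤ ‖u‖ ^ 2 := M.h_le_norm_sq x z
  set y := u + (M.k * M.h x z) • M z - M.b u n • n with hy
  have hyt : M.Tan z y := (M.tan_chord x z).sub (hn.ut.tan.smul _)
  have hyn : M.b y n = 0 := by
    have := M.kb_tan hn.ut.tan
    simp only [hy, b_sub_left, b_add_left, b_smul_left, hn.ut.unit]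
    linear_combination M.h x z * this
  have e1 : A u + κ • u = -((M.k * M.h x z) • (A (M z) + κ • M z)) +
      M.b u n • (A n + κ • n) := by
    have e2 : u = y - (M.k * M.h x z) • M z + M.b u n • n := by rw [hy]; abel
    have e3 : A u = A y - (M.k * M.h x z) • A (M z) + M.b u n • A n := by
      conv_lhs => rw [e2]
      simp only [map_add, map_sub, map_smul]
    rw [e3, hκ y hyt hyn, hy]; module
  have e4 : ‖A u + κ • u‖ ≤ C * ‖u‖ * ‖u‖ := by
    rw [e1]
    calc _ ≤ |M.k| * M.h x z * ‖A (M z) + κ • M z‖ + M.b u n * ‖A n + κ • n‖ := by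
          refine (norm_add_le _ _).trans ?_
          rw [norm_neg, norm_smul, norm_smul, Real.norm_eq_abs, Real.norm_eq_abs, abs_mul,
            abs_of_nonneg hh0, abs_of_nonneg hb0]
      _ ≤ 1 * M.h x z * ‖A (M z) + κ • M z‖ + κi * M.h x z * ‖A n + κ • n‖ := by
          gcongr; exact M.k_abs
      _ = C * M.h x z := by rw [hC]; ring
      _ ≤ C * ‖u‖ ^ 2 := by gcongr
      _ = _ := by ring
  calc ‖m - n + κ • u‖ = ‖(m - n - A u) + (A u + κ • u)‖ := by congr 1; abel
    _ ≤ ε / 2 * ‖u‖ + C * ‖u‖ * ‖u‖ := (norm_add_le _ _).trans (add_le_add (h1 m hm) e4)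
    _ ≤ ε / 2 * ‖u‖ + ε / 2 * ‖u‖ := by gcongr
    _ = ε * ‖u‖ := by ring

lemma Umb.image {K K' : Set X} (nm : ∀ x ∈ frontier K, ∃ n, M.IsNormal K x n) {κ : ℝ} {z : X}
    {n : E × ℝ} (h : M.Umb K κ z n) {f : X ≃ᵢ X} {F : E × ℝ →ₗ[ℝ] E × ℝ} (hf : M.Cong f F)
    (hK : ∀ᶠ w in nhds (f z), (w ∈ f '' K ↔ w ∈ K')) : M.Umb K' κ (f z) (F n) := by
  have : FiniteDimensional ℝ E := finiteDimensional_of_fact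
  intro ε hε
  obtain ⟨C, hC, hch⟩ := M.chord_bound z
  set B := √(2 * C)
  set F' := LinearMap.toContinuousLinearMap F
  have hh : ∀ᶠ x in nhds z, M.h x z < 1 := by
    have : Tendsto (fun x => M.h x z) (nhds z) (nhds 0) := M.tendsto_h.2 tendsto_id
    exact this.eventually_lt_const one_pos
  have ht : Tendsto f.symm (nhds (f z)) (nhds z) := by
    simpa using f.symm.continuous.tendsto (f z)
  filter_upwards [eventually_eventually_nhds.2 hK, ht.eventually hh,
    ht.eventually (h (ε / (‖F'‖ * B + 1)) (by positivity))] with x' h1 h2 h3 m hm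
  obtain ⟨x, rfl⟩ := f.surjective x'
  rw [f.symm_apply_apply] at h2 h3
  have hx : x ∈ frontier K := by
    have a1 : f x ∈ frontier (f '' K) := (frontier_congr h1).2 hm.frontier
    have a2 := f.toHomeomorph.image_frontier K
    obtain ⟨w, hw, hwx⟩ := a2.symm ▸ a1
    rwa [← f.injective hwx]
  obtain ⟨m₀, hm₀⟩ := nm x hx
  have e0 : F m₀ = m := IsNormal.eq_of_germ M (hm₀.image hf) hm h1
  have e1 : m - F n + κ • (M (f x) - M (f z)) = F' (m₀ - n + κ • (M x - M z)) := by
    rw [← e0, hf.map, hf.map]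
    simp [F']
  have hu : ‖M x - M z‖ ≤ B * ‖M (f x) - M (f z)‖ := by
    rw [← abs_of_nonneg (norm_nonneg (M x - M z)),
      ← abs_of_nonneg (mul_nonneg (Real.sqrt_nonneg (2 * C)) (norm_nonneg (M (f x) - M (f z)))),
      ← sq_le_sq, mul_pow, Real.sq_sqrt (by positivity)]
    have b1 := hch x
    have b2 := M.h_le_norm_sq (f x) (f z)
    rw [M.h_isom] at b2
    have b3 := M.h_nonneg x z
    calc _ ≤ C * (M.h x z * (1 + M.h x z)) := b1
      _ ≤ C * (M.h x z * 2) := by gcongr; linarith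
      _ ≤ C * (‖M (f x) - M (f z)‖ ^ 2 * 2) := by gcongr
      _ = _ := by ring
  rw [e1]
  calc _ ≤ ‖F'‖ * (ε / (‖F'‖ * B + 1) * ‖M x - M z‖) := F'.le_opNorm_of_le (h3 m₀ hm₀)
    _ ≤ ‖F'‖ * (ε / (‖F'‖ * B + 1) * (B * ‖M (f x) - M (f z)‖)) := by gcongr
    _ = ε * ((‖F'‖ * B) / (‖F'‖ * B + 1)) * ‖M (f x) - M (f z)‖ := by ring
    _ ≤ ε * 1 * ‖M (f x) - M (f z)‖ := by
      gcongr
      rw [div_le_one (by positivity)]; linarith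
    _ = _ := by ring

lemma Pair.exists_umb {K L : Set X} (P : M.Pair K L) :
    ∃ κ, (∀ x n, M.IsNormal K x n → M.Umb K κ x n) ∧ ∀ x n, M.IsNormal L x n → M.Umb L κ x n := by
  obtain ⟨z, n, hn, A, hA⟩ := P.exists_shape
  obtain ⟨κ, hκ⟩ := P.shape_scalar hn hA
  have hu := Shape.umb hn hA hκ
  refine ⟨κ, fun x m hm => ?_, fun x m hm => ?_⟩
  · obtain ⟨i, f, F, hi, hf, rfl, rfl⟩ := exists_frame_even hn.ut hm.ut
    exact hu.image P.nmK hf.cong (P.germ_even hn hm hi hf rfl rfl)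
  · obtain ⟨i, f, F, hi, hf, rfl, rfl⟩ := M.exists_frame_odd hn.ut hm.ut
    exact hu.image P.nmK hf.cong (P.germ_odd hn hm hi hf rfl rfl)

/-- Boundary points near an umbilic boundary point have the same curvature centre. -/
lemma Pair.center_const {K L : Set X} (P : M.Pair K L) {κ : ℝ}
    (hκ : ∀ x n, M.IsNormal K x n → M.Umb K κ x n) {x₀ : X} {n₀ : E × ℝ}
    (hn₀ : M.IsNormal K x₀ n₀) :
    ∀ᶠ x in nhds x₀, ∀ n, M.IsNormal K x n → n + κ • M x = n₀ + κ • M x₀ := by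
  obtain ⟨U, Z, hU, hxU, hZx, hZ, hlip, hret⟩ := M.exists_chart P.clK P.cvK P.inK hn₀.frontier
  have hnu : ∀ x ∈ frontier K, M.IsNormal K x (M.nu K x) := fun x hx => by
    obtain ⟨n, hn⟩ := P.nmK x hx
    rwa [hn.nu_eq]
  set G : E × ℝ → E × ℝ := fun w => M.nu K (Z w) + κ • M (Z w) with hG
  have hd : ∀ w ∈ U, HasFDerivAt G (0 : E × ℝ →L[ℝ] E × ℝ) w := by
    intro w hw
    obtain ⟨C, hC⟩ := hlip w hw
    have ht : Tendsto Z (nhds w) (nhds (Z w)) := by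
      rw [← M.tendsto_iff, tendsto_iff_norm_sub_tendsto_zero]
      have h0 : Tendsto (fun w' => C * ‖w' - w‖) (nhds w) (nhds 0) := by
        have : Continuous fun w' => C * ‖w' - w‖ := by fun_prop
        simpa using this.tendsto w
      exact squeeze_zero' (Eventually.of_forall fun _ => norm_nonneg _) hC h0
    refine .of_isLittleO (Asymptotics.isLittleO_iff.2 fun ε hε => ?_)
    have hCp : 0 < |C| + 1 := by positivity
    filter_upwards [hC, ht.eventually (hκ _ _ (hnu _ (hZ w hw)) _ (div_pos hε hCp)),
      hU.mem_nhds hw] with w' h1 h2 h3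
    have e1 : G w' - G w - (0 : E × ℝ →L[ℝ] E × ℝ) (w' - w) =
        M.nu K (Z w') - M.nu K (Z w) + κ • (M (Z w') - M (Z w)) := by
      simp only [hG, zero_apply, sub_zero, smul_sub]; abel
    rw [e1]
    calc _ ≤ ε / (|C| + 1) * ‖M (Z w') - M (Z w)‖ := h2 _ (hnu _ (hZ w' h3))
      _ ≤ ε / (|C| + 1) * ((|C| + 1) * ‖w' - w‖) := by
        gcongr
        exact h1.trans (by gcongr; linarith [le_abs_self C])
      _ = _ := by field_simp
  obtain ⟨r, hr, hrU⟩ := Metric.isOpen_iff.1 hU _ hxU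
  obtain ⟨s, hs, hret⟩ := hret _ hxU
  have ht : Tendsto (fun x => M x₀ + s • (M x - M x₀)) (nhds x₀) (nhds (M x₀)) := by
    have := M.continuous
    have h : Continuous fun x => M x₀ + s • (M x - M x₀) := by fun_prop
    simpa using h.tendsto x₀
  filter_upwards [ht.eventually (ball_mem_nhds _ hr)] with x hx n hn
  have hxn := hret x hn.frontier
  rw [hZx] at hxn
  have hc := (convex_ball (M x₀) r).is_const_of_fderivWithin_eq_zero (𝕜 := ℝ) (f := G)
    (fun w hw => (hd w (hrU hw)).differentiableAt.differentiableWithinAt)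
    (fun w hw => by
      rw [fderivWithin_of_isOpen isOpen_ball hw]; exact (hd w (hrU hw)).fderiv)
    hx (mem_ball_self hr)
  simp only [hG, hxn, hZx, hn.nu_eq, hn₀.nu_eq] at hc
  exact hc

end SF

namespace SF
variable {E : Type*} [NormedAddCommGroup E] [InnerProductSpace ℝ E]
variable {M : SF X E} [Nonempty X] [Fact (2 ≤ Module.finrank ℝ E)]

variable (M) in
/-- The umbilic hypersurface of curvature `κ` through `x` with inner unit normal `n`. -/
def bdD (κ : ℝ) (x : X) (n : E × ℝ) : Set X := {z | κ * M.h z x = M.b (M z - M x) n}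

lemma mem_bdD {κ : ℝ} {x z : X} {n : E × ℝ} :
    z ∈ M.bdD κ x n ↔ κ * M.h z x = M.b (M z - M x) n := Iff.rfl

lemma self_mem_bdD (κ : ℝ) (x : X) (n : E × ℝ) : x ∈ M.bdD κ x n := by
  simp [mem_bdD, h_self, b_zero_left]

lemma bdD_subset (κ : ℝ) (x : X) (n : E × ℝ) : M.bdD κ x n ⊆ M.D κ x n := fun _ h => le_of_eq h

lemma recentre_UT {κ : ℝ} {x z : X} {n : E × ℝ} (hn : M.UT x n) (hz : z ∈ M.bdD κ x n) :
    M.UT z (n - κ • (M z - M x)) := by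
  rw [mem_bdD] at hz
  constructor
  · have h1 := M.q_tan hn.tan z
    have h2 := M.k_mul_h z x
    have h3 : M.q (M z) (M z) = 1 := M.q_self z
    change M.q _ _ = 0
    simp only [q_sub_right, q_smul_right, h1, h3]
    linear_combination (-κ) * -h2 - M.k * hz
  · have h2 : M.b (M z - M x) (M z - M x) = 2 * M.h z x := by unfold h; ring
    simp only [b_sub_left _ n, b_sub_right _ _ n, b_smul_right, b_smul_left, hn.unit, h2,
      M.b_comm n]
    linear_combination (2 * κ) * hz

lemma recentre {κ : ℝ} {x z : X} {n : E × ℝ} (hz : z ∈ M.bdD κ x n) (y : X) :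
    M.b (M y - M z) (n - κ • (M z - M x)) - κ * M.h y z = M.b (M y - M x) n - κ * M.h y x := by
  rw [mem_bdD] at hz
  unfold h at *
  simp only [b_sub_left, b_sub_right, b_smul_right, M.b_comm (M x) (M y), M.b_comm (M z) (M y),
    M.b_comm (M x) (M z)] at *
  linear_combination hz

lemma recentre_bdD {κ : ℝ} {x z : X} {n : E × ℝ} (hz : z ∈ M.bdD κ x n) :
    M.bdD κ z (n - κ • (M z - M x)) = M.bdD κ x n := by
  ext y
  have := recentre hz y
  rw [mem_bdD, mem_bdD]
  constructor <;> intro h <;> linarith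

lemma mem_bdD_of_center {K : Set X} {κ : ℝ} {x z : X} {n m : E × ℝ} (hn : M.IsNormal K x n)
    (hm : M.IsNormal K z m) (hc : m + κ • M z = n + κ • M x) : z ∈ M.bdD κ x n := by
  have hm' : m = n - κ • (M z - M x) := by
    rw [smul_sub]; rw [← sub_eq_zero] at hc ⊢; rw [← hc]; abel
  rw [mem_bdD]
  rcases eq_or_ne κ 0 with rfl | h0
  · rw [zero_smul, sub_zero] at hm'
    have h1 := M.mem_D_zero.1 (hn.sup hm.mem)
    have h2 := M.mem_D_zero.1 (hm.sup hn.mem)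
    rw [hm', b_sub_left] at h2
    rw [b_sub_left] at h1 ⊢
    linarith
  · have h1 := hm.ut.unit
    have h2 : M.b (M z - M x) (M z - M x) = 2 * M.h z x := by unfold h; ring
    rw [hm'] at h1
    simp only [b_sub_left _ n, b_sub_right _ _ n, b_smul_right, b_smul_left, hn.ut.unit, h2,
      M.b_comm n] at h1
    apply mul_left_cancel₀ h0
    linear_combination h1 / 2

lemma isPreconnected_bdD {κ : ℝ} (hκ : 0 < κ) {x : X} {n : E × ℝ} (hn : M.UT x n) :
    IsPreconnected (M.bdD κ x n) := by
  refine isPreconnected_of_forall x fun z hz => ?_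
  rcases eq_or_ne z x with rfl | hzx
  · exact ⟨{z}, by simpa using hz, rfl, rfl, isPreconnected_singleton⟩
  obtain ⟨v, hv, hzv⟩ := M.exists_log x z
  set t := dist x z with ht
  have ht0 : 0 < t := dist_pos.2 hzx.symm
  have hk := M.hk
  have hz' : z = M.exp x v t := M.injective (by rw [hzv, M.M_exp hv])
  have hs2 : ∀ s, sn M.k s = 2 * sn M.k (s / 2) * cs M.k (s / 2) := fun s => by
    have := sn_add hk (s / 2) (s / 2)
    rw [add_halves] at this; rw [this]; ring
  have hvs : ∀ s, vs M.k s = 2 * sn M.k (s / 2) ^ 2 := fun s => rfl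
  have hht : ∀ u, M.UT x u → ∀ s, M.h (M.exp x u s) x = vs M.k s := fun u hu s => by
    have := M.h_exp_exp hu s 0
    rwa [exp_zero, sub_zero] at this
  have hpi : M.k = 1 → t ≤ Real.pi := fun h => M.hpi h x z
  have hsn : 0 < sn M.k (t / 2) := sn_pos hk (by linarith) fun h => by
    have := hpi h; linarith [Real.pi_pos]
  set β := M.b v n with hβ
  have hβ1 : κ * sn M.k (t / 2) = cs M.k (t / 2) * β := by
    rw [mem_bdD, hz', hht v hv, M.b_exp_sub hv hn.tan, hvs, hs2 t] at hz
    apply mul_left_cancel₀ hsn.ne'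
    linear_combination hz / 2
  have htpi : M.k = 1 → t / 2 < Real.pi / 2 := fun h => by
    refine lt_of_le_of_ne (by have := hpi h; linarith) fun h' => ?_
    have h0 : cs M.k (t / 2) = 0 := by rw [h', h]; simp [cs]
    rw [h0] at hβ1
    nlinarith
  have hcs : ∀ s ∈ Icc 0 t, 0 < cs M.k (s / 2) := fun s hs =>
    cs_pos hk (by linarith [hs.1]) fun h => by have := htpi h; linarith [hs.2]
  have hβr : 0 ≤ 1 - β ^ 2 := by
    have := (M.tan_nonneg ((hv.tan.sub (hn.tan.smul β))) : 0 ≤ M.b (v - β • n) (v - β • n))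
    simp only [b_sub_left, b_sub_right, b_smul_left, b_smul_right, hv.unit, hn.unit,
      M.b_comm n v, ← hβ] at this
    nlinarith
  obtain ⟨e, he, hen, hve⟩ : ∃ e, M.UT x e ∧ M.b e n = 0 ∧ v = √(1 - β ^ 2) • e + β • n := by
    have hw : M.Tan x (v - β • n) := hv.tan.sub (hn.tan.smul β)
    have hww : M.b (v - β • n) (v - β • n) = 1 - β ^ 2 := by
      simp only [b_sub_left, b_sub_right, b_smul_left, b_smul_right, hv.unit, hn.unit,
        M.b_comm n v, ← hβ]
      ring
    by_cases h0 : v - β • n = 0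
    · obtain ⟨e, he, hen⟩ := M.exists_UT_orth x n
      refine ⟨e, he, hen, ?_⟩
      rw [← hww, h0, b_zero_left]
      simp [sub_eq_zero.1 h0]
    · have hp : 0 < 1 - β ^ 2 := by
        rw [← hww]; exact M.tan_pos hw h0
      refine ⟨_, M.UT_normalize hw h0, ?_, ?_⟩
      · simp only [b_smul_left, b_sub_left, hn.unit, ← hβ]; ring
      · rw [hww, smul_smul, mul_inv_cancel₀ (Real.sqrt_pos.2 hp).ne', one_smul]; abel
  set σ : ℝ → ℝ := fun s => κ * sn M.k (s / 2) / cs M.k (s / 2) with hσ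
  have hσt : σ t = β := by
    rw [hσ]; dsimp only
    rw [div_eq_iff (hcs t (right_mem_Icc.2 ht0.le)).ne', hβ1]; ring
  have hσ0 : ∀ s ∈ Icc 0 t, 0 ≤ σ s := fun s hs => by
    refine div_nonneg (mul_nonneg hκ.le ?_) (hcs s hs).le
    rcases hs.1.eq_or_lt with h | h
    · rw [← h, zero_div, sn_zero hk]
    · exact (sn_pos hk (by linarith) fun h => by
        have := htpi h; linarith [Real.pi_pos, hs.2]).le
  have hσle : ∀ s ∈ Icc 0 t, σ s ≤ β := fun s hs => by
    rw [← hσt]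
    rw [hσ]; dsimp only
    rw [div_le_div_iff₀ (hcs s hs) (hcs t (right_mem_Icc.2 ht0.le))]
    have h1 := sn_sub hk (t / 2) (s / 2)
    have h2 : 0 ≤ sn M.k (t / 2 - s / 2) := by
      rcases hs.2.eq_or_lt with h | h
      · rw [h, sub_self, sn_zero hk]
      · exact (sn_pos hk (by linarith) fun h => by
          have := htpi h; linarith [Real.pi_pos, hs.1]).le
    rw [h1] at h2
    nlinarith
  have hσ1 : ∀ s ∈ Icc 0 t, 0 ≤ 1 - σ s ^ 2 := fun s hs => by
    nlinarith [hσ0 s hs, hσle s hs]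
  have hu : ∀ s ∈ Icc 0 t, M.UT x (√(1 - σ s ^ 2) • e + σ s • n) := fun s hs => by
    refine ⟨(he.tan.smul _).add (hn.tan.smul _), ?_⟩
    simp only [b_add_left, b_add_right, b_smul_left, b_smul_right, he.unit, hn.unit, hen,
      M.b_comm n e]
    linear_combination Real.mul_self_sqrt (hσ1 s hs)
  have hcont : ContinuousOn (fun s => M.exp x (√(1 - σ s ^ 2) • e + σ s • n) s) (Icc 0 t) := by
    rw [M.isInducing.continuousOn_iff]
    have hσc : ContinuousOn σ (Icc 0 t) := by
      refine ContinuousOn.div ?_ ?_ fun s hs => (hcs s hs).ne'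
      · have := continuous_sn M.hk; fun_prop
      · have := continuous_cs M.hk; fun_prop
    have : ContinuousOn (fun s => cs M.k s • M x +
        sn M.k s • (√(1 - σ s ^ 2) • e + σ s • n)) (Icc 0 t) := by
      have := continuous_sn M.hk
      have := continuous_cs M.hk
      fun_prop
    exact this.congr fun s hs => M.M_exp (hu s hs) s
  refine ⟨_, ?_, ?_, ?_, isPreconnected_Icc.image _ hcont⟩
  · rintro _ ⟨s, hs, rfl⟩
    rw [mem_bdD, hht _ (hu s hs), M.b_exp_sub (hu s hs) hn.tan, hvs, hs2 s]
    simp only [b_add_left, b_smul_left, hen, hn.unit, hσ]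
    field_simp [(hcs s hs).ne']
    ring
  · exact ⟨0, left_mem_Icc.2 ht0.le, M.exp_zero _ _⟩
  · refine ⟨t, right_mem_Icc.2 ht0.le, ?_⟩
    dsimp only
    rw [hσt, ← hve, hz']

end SF

lemma eq_of_eventually_eq {Y β : Type*} [TopologicalSpace Y] {s : Set Y} (hs : IsPreconnected s)
    {f : Y → β} (h : ∀ x ∈ s, ∀ᶠ y in nhdsWithin x s, f y = f x) {x y : Y} (hx : x ∈ s)
    (hy : y ∈ s) : f x = f y :=
  hs.induction₂' (fun x y => f x = f y)
    (fun x hx => (h x hx).mono fun _ h => ⟨h.symm, h⟩)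
    (fun _ _ _ _ _ _ h h' => h.trans h') hx hy

namespace SF
variable {E : Type*} [NormedAddCommGroup E] [InnerProductSpace ℝ E]
variable {M : SF X E} [Nonempty X] [Fact (2 ≤ Module.finrank ℝ E)]

lemma Pair.eventually_mem_bdD {K L : Set X} (P : M.Pair K L) {κ : ℝ}
    (hκ : ∀ x n, M.IsNormal K x n → M.Umb K κ x n) {x : X} {n : E × ℝ} (hn : M.IsNormal K x n) :
    ∀ᶠ z in nhds x, z ∈ frontier K → z ∈ M.bdD κ x n := by
  filter_upwards [P.center_const hκ hn] with z hz hzK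
  obtain ⟨m, hm⟩ := P.nmK z hzK
  exact mem_bdD_of_center hn hm (hz m hm)

lemma Pair.curv_pos {K L : Set X} (P : M.Pair K L) {κ : ℝ}
    (hκ : ∀ x n, M.IsNormal K x n → M.Umb K κ x n) {x : X} {n : E × ℝ} (hn : M.IsNormal K x n) :
    0 < κ := by
  obtain ⟨κ', hκ', hsc⟩ := P.scK x n hn
  have hev := (P.eventually_mem_bdD hκ hn).and hsc
  rw [M.isInducing.nhds_eq_comap, eventually_comap, Metric.eventually_nhds_iff] at hev
  obtain ⟨δ, hδ, hev⟩ := hev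
  obtain ⟨e, he, hen⟩ := M.exists_UT_orth x n
  have he0 : 0 < ‖e‖ := norm_pos_iff.2 fun h => by
    have := he.unit
    rw [h, b_zero_left] at this
    exact zero_ne_one this
  have hlim : ∀ᶠ t in nhdsWithin (0 : ℝ) (Ioi 0), (‖e‖ + ‖e‖ / 2) * t < δ := by
    have : Tendsto (fun t : ℝ => (‖e‖ + ‖e‖ / 2) * t) (nhdsWithin 0 (Ioi 0)) (nhds 0) := by
      have h : Continuous fun t : ℝ => (‖e‖ + ‖e‖ / 2) * t := by fun_prop
      simpa using (h.tendsto 0).mono_left nhdsWithin_le_nhds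
    exact this.eventually (gt_mem_nhds hδ)
  obtain ⟨t, ⟨⟨z, hzK, hz⟩, htδ⟩, ht⟩ :=
    (((M.exists_boundary_curve P.clK hn he hen (half_pos he0)).and hlim).and
      self_mem_nhdsWithin).exists
  have ht : 0 < t := ht
  have hte : ‖t • e‖ = t * ‖e‖ := by rw [norm_smul, Real.norm_of_nonneg ht.le]
  have hzx : z ≠ x := by
    rintro rfl
    rw [sub_self, zero_sub, norm_neg, hte] at hz
    nlinarith [mul_pos ht he0]
  have hd : dist (M z) (M x) < δ := by
    rw [dist_eq_norm]
    calc ‖M z - M x‖ = ‖(M z - M x - t • e) + t • e‖ := by rw [sub_add_cancel]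
      _ ≤ ‖e‖ / 2 * t + t * ‖e‖ := (norm_add_le _ _).trans (by rw [hte]; gcongr)
      _ < δ := by linarith
  obtain ⟨h1, h2⟩ := hev hd z rfl
  have h3 := h1 hzK
  have h4 := M.mem_D.1 (h2 (P.clK.frontier_subset hzK))
  rw [mem_bdD, ] at h3
  have h5 : 0 < M.h z x := lt_of_le_of_ne (M.h_nonneg z x) fun h => hzx (M.h_eq_zero.1 h.symm)
  rw [← h3] at h4
  exact hκ'.trans_le (le_of_mul_le_mul_right h4 h5)

lemma Pair.bdD_subset_frontier {K L : Set X} (P : M.Pair K L) {κ : ℝ}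
    (hκ : ∀ x n, M.IsNormal K x n → M.Umb K κ x n) {x : X} {n : E × ℝ} (hn : M.IsNormal K x n) :
    ∀ᶠ y in nhdsWithin x (M.bdD κ x n), y ∈ frontier K := by
  have hκ0 := P.curv_pos hκ hn
  obtain ⟨r, hr, hev⟩ := Metric.eventually_nhds_iff.1 (P.eventually_mem_bdD hκ hn)
  obtain ⟨κ₀, -, hin⟩ := hn.inner
  obtain ⟨δ, hδ, hvs⟩ := (mem_nhdsGT_iff_exists_Ioo_subset).1
    ((eventually_vs_lt M.hk κ one_pos).and M.eventually_sn_pos)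
  have hδ : 0 < δ := hδ
  obtain ⟨t, ht, ht1⟩ := ((M.eventually_exp_mem_D hn.ut hn.ut (by rw [hn.ut.unit]; exact one_pos)
    κ₀).and (Ioo_mem_nhdsGT (lt_min (lt_min hδ one_pos) (half_pos hr)))).exists
  have ht0 := ht1.1
  obtain ⟨⟨htδ, ht1⟩, htr⟩ : (t < δ ∧ t < 1) ∧ t < r / 2 := by
    have := ht1.2; rwa [lt_min_iff, lt_min_iff] at this
  have hT : ∀ s, Tendsto (fun y => M.exp y (n - κ • (M y - M x)) s) (nhdsWithin x (M.bdD κ x n))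
      (nhds (M.exp x n s)) := fun s => by
    rw [← M.tendsto_iff]
    have hc : Continuous fun y => cs M.k s • M y + sn M.k s • (n - κ • (M y - M x)) := by
      have := M.continuous
      fun_prop
    have h := (hc.tendsto x).mono_left (nhdsWithin_le_nhds (s := M.bdD κ x n))
    rw [sub_self, smul_zero, sub_zero, ← M.M_exp hn.ut s] at h
    refine h.congr' ?_
    filter_upwards [self_mem_nhdsWithin] with y hy
    rw [M.M_exp (recentre_UT hn.ut hy)]
  have hneg : M.exp x n (-t) ∈ Kᶜ := fun h => by
    have h1 := M.mem_D_zero.1 (hn.sup h)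
    rw [M.b_exp_sub hn.ut hn.ut.tan, hn.ut.unit, sn_neg M.hk, mul_one] at h1
    have := (hvs ⟨ht0, htδ⟩).2
    linarith
  filter_upwards [self_mem_nhdsWithin,
    (hT t).eventually (isOpen_interior.mem_nhds (interior_mono hin ht)),
    (hT (-t)).eventually (P.clK.isOpen_compl.mem_nhds hneg),
    mem_nhdsWithin_of_mem_nhds (ball_mem_nhds x (half_pos hr))] with y hy h1 h2 h3
  have hu := recentre_UT hn.ut hy
  have hu' := M.continuous_exp hu
  obtain ⟨_, ⟨s, hs, rfl⟩, hsK⟩ := inter_frontier_nonempty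
    ((isPreconnected_Icc (a := -t) (b := t)).image _ hu'.continuousOn) P.clK
    ⟨_, ⟨t, ⟨by linarith, le_rfl⟩, rfl⟩, interior_subset h1⟩
    ⟨_, ⟨-t, ⟨le_rfl, by linarith⟩, rfl⟩, h2⟩
  have hsd : dist (M.exp y (n - κ • (M y - M x)) s) y = |s| := by
    have := M.dist_exp_exp hu (s := s) (t := 0) fun _ => by
      rw [sub_zero, abs_le]; constructor <;> linarith [hs.1, hs.2, Real.pi_gt_three]
    rwa [exp_zero, sub_zero] at this
  have hmem := hev (y := M.exp y (n - κ • (M y - M x)) s) (by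
    have h4 := dist_triangle (M.exp y (n - κ • (M y - M x)) s) y x
    have h5 : |s| ≤ t := abs_le.2 hs
    have h6 : dist y x < r / 2 := h3
    linarith) hsK
  rw [← recentre_bdD hy, mem_bdD, M.b_exp_sub hu hu.tan, hu.unit, mul_one] at hmem
  have hh : M.h (M.exp y (n - κ • (M y - M x)) s) y = vs M.k s := by
    have := M.h_exp_exp hu s 0
    rwa [exp_zero, sub_zero] at this
  rw [hh] at hmem
  rcases lt_trichotomy s 0 with h | h | h
  · have h5 := (hvs ⟨neg_pos.2 h, show -s < δ by linarith [hs.1]⟩).2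
    rw [sn_neg M.hk] at h5
    have := mul_nonneg hκ0.le (vs_nonneg (k := M.k) s)
    linarith
  · rwa [h, exp_zero] at hsK
  · have h5 := (hvs ⟨h, show s < δ by linarith [hs.2]⟩).1
    linarith

/-- The components of the boundary are umbilic hypersurfaces. -/
lemma Pair.component {K L : Set X} (P : M.Pair K L) {κ : ℝ}
    (hκ : ∀ x n, M.IsNormal K x n → M.Umb K κ x n) {x : X} {n : E × ℝ} (hn : M.IsNormal K x n) :
    connectedComponentIn (frontier K) x = M.bdD κ x n := by
  have hκ0 := P.curv_pos hκ hn
  have hnu : ∀ y ∈ frontier K, M.IsNormal K y (M.nu K y) := fun y hy => by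
    obtain ⟨n, hn⟩ := P.nmK y hy
    rwa [hn.nu_eq]
  have hcc : ∀ y ∈ frontier K, ∀ᶠ z in nhds y, z ∈ frontier K →
      M.nu K z + κ • M z = M.nu K y + κ • M y := fun y hy => by
    filter_upwards [P.center_const hκ (hnu y hy)] with z hz hzK using hz _ (hnu z hzK)
  apply Subset.antisymm
  · intro z hz
    have hzK := connectedComponentIn_subset _ _ hz
    have h := eq_of_eventually_eq (isPreconnected_connectedComponentIn (x := x) (F := frontier K))
      (f := fun y => M.nu K y + κ • M y) (fun y hy => by
        filter_upwards [mem_nhdsWithin_of_mem_nhds (hcc y (connectedComponentIn_subset _ _ hy)),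
          self_mem_nhdsWithin] with z hz hzT using hz (connectedComponentIn_subset _ _ hzT))
      (mem_connectedComponentIn hn.frontier) hz
    refine mem_bdD_of_center hn (hnu z hzK) ?_
    rw [← hn.nu_eq]
    exact h.symm
  · refine (isPreconnected_bdD hκ0 hn.ut).subset_connectedComponentIn (self_mem_bdD κ x n) ?_
    intro z hz
    have h := eq_of_eventually_eq (isPreconnected_bdD hκ0 hn.ut)
      (f := fun y => y ∈ frontier K ∧ M.nu K y + κ • M y = n + κ • M x) (fun y hy => by
        by_cases hyK : y ∈ frontier K
        · by_cases hyc : M.nu K y + κ • M y = n + κ • M x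
          · have hy' : M.nu K y = n - κ • (M y - M x) := by
              rw [smul_sub]; rw [← sub_eq_zero] at hyc ⊢; rw [← hyc]; abel
            have h := P.bdD_subset_frontier hκ (hnu y hyK)
            rw [hy', recentre_bdD hy] at h
            filter_upwards [mem_nhdsWithin_of_mem_nhds (hcc y hyK), h] with z h1 h2
            simp only [hyK, h2, true_and, h1 h2]
          · filter_upwards [mem_nhdsWithin_of_mem_nhds (hcc y hyK)] with z h1
            simp only [hyK, hyc, and_false, eq_iff_iff, iff_false, not_and]
            intro h2
            rwa [h1 h2]
        · filter_upwards [mem_nhdsWithin_of_mem_nhds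
            (isClosed_frontier.isOpen_compl.mem_nhds hyK)] with z hz
          have hz : z ∉ frontier K := hz
          simp only [hyK, hz, false_and])
      (self_mem_bdD κ x n) hz
    exact (h.mp ⟨hn.frontier, by rw [hn.nu_eq]⟩).1

end SF

namespace SF
variable {E : Type*} [NormedAddCommGroup E] [InnerProductSpace ℝ E]
variable {M : SF X E} [Nonempty X] [Fact (2 ≤ Module.finrank ℝ E)]

variable (M) in
/-- The defining function of `M.D κ x n`. -/
noncomputable def fD (κ : ℝ) (x : X) (n : E × ℝ) (z : X) : ℝ := M.b (M z - M x) n - κ * M.h z x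

lemma mem_D_iff {κ : ℝ} {x z : X} {n : E × ℝ} : z ∈ M.D κ x n ↔ 0 ≤ M.fD κ x n z := by
  rw [M.mem_D, fD, sub_nonneg]

lemma mem_bdD_iff {κ : ℝ} {x z : X} {n : E × ℝ} : z ∈ M.bdD κ x n ↔ M.fD κ x n z = 0 := by
  rw [mem_bdD, fD, sub_eq_zero, eq_comm]

lemma continuous_fD (κ : ℝ) (x : X) (n : E × ℝ) : Continuous (M.fD κ x n) := by
  unfold fD
  have := M.continuous
  have := M.continuous_h
  fun_prop

lemma fD_exp {κ : ℝ} {x z : X} {n v : E × ℝ} (hn : M.UT x n) (hv : M.UT z v)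
    (h : M.b v (n + κ • (M x - M z)) = 0) (t : ℝ) :
    M.fD κ x n (M.exp z v t) = cs M.k t * M.fD κ x n z - κ * vs M.k t := by
  have h1 := M.h_exp hv x t
  have h2 := M.kb_tan hn.tan
  have h3 := mul_vs M.hk t
  unfold fD
  rw [M.h_comm, h1, M.M_exp hv, M.h_comm z x]
  rw [b_add_right, b_smul_right] at h
  simp only [b_sub_left, b_add_left, b_smul_left, b_sub_right, M.b_comm (M x) v,
    M.b_comm (M z) v] at h ⊢
  linear_combination sn M.k t * h + M.b (M x) n * h3 - vs M.k t * h2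

lemma b_lt_of_neg {x : X} {n : E × ℝ} (hn : M.UT x n) (h : M.k = -1) (z : X) :
    M.b (M z - M x) n < 1 + M.h z x := by
  obtain ⟨w, hw, hzw⟩ := M.exists_log x z
  have hz' : z = M.exp x w (dist x z) := M.injective (by rw [hzw, M.M_exp hw])
  have h1 : M.h z x = vs M.k (dist x z) := by
    have := M.h_exp_exp hw (dist x z) 0
    rwa [exp_zero, sub_zero, ← hz'] at this
  have h2 : M.b (M z - M x) n = sn M.k (dist x z) * M.b w n := by
    have := M.b_exp_sub hw hn.tan (dist x z)
    rwa [← hz'] at this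
  have h3 : M.b w n ≤ 1 := by
    have := M.tan_nonneg (hw.tan.sub hn.tan)
    simp only [b_sub_left, b_sub_right, hw.unit, hn.unit, M.b_comm n w] at this
    linarith
  have h4 := mul_vs M.hk (dist x z)
  rw [h1, h2]
  rw [h] at h4 ⊢
  simp only [sn_neg_one, cs_neg_one] at h4 ⊢
  have h5 := Real.sinh_lt_cosh (x := dist x z)
  have h6 : 0 ≤ Real.sinh (dist x z) := Real.sinh_nonneg_iff.2 dist_nonneg
  nlinarith [mul_le_mul_of_nonneg_left h3 h6]

lemma D_subset_of_bdD {K : Set X} (hK : GConvex K) {κ : ℝ} (hκ : 0 < κ) {x : X} {n : E × ℝ}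
    (hn : M.UT x n) (hk : 0 ≤ κ ^ 2 + M.k) (hS : M.bdD κ x n ⊆ K) : M.D κ x n ⊆ K := by
  intro z hz
  rcases (mem_D_iff.1 hz).eq_or_lt with hf | hf
  · exact hS (mem_bdD_iff.2 hf.symm)
  obtain ⟨v, hv, hvn⟩ := M.exists_UT_orth z (n + κ • (M x - M z))
  set f := M.fD κ x n z with hfd
  obtain ⟨T, hT0, hT⟩ : ∃ T : ℝ, 0 ≤ T ∧ cs M.k T * f - κ * vs M.k T ≤ 0 := by
    rcases M.hk with h | h | h
    · refine ⟨Real.pi / 2, by positivity, ?_⟩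
      have : cs M.k (Real.pi / 2) = 0 := by rw [h]; simp
      rw [this]
      nlinarith [vs_nonneg (k := M.k) (Real.pi / 2)]
    · refine ⟨√(2 * f / κ), by positivity, ?_⟩
      have : vs M.k √(2 * f / κ) = f / κ := by
        rw [h]
        have := Real.sq_sqrt (show 0 ≤ 2 * f / κ by positivity)
        simp only [vs, sn_null]
        linear_combination this / 2
      rw [this, h, cs_null]
      field_simp
      linarith
    · have hfκ : f < κ := by
        have h1 := b_lt_of_neg hn h z
        have h2 := M.h_nonneg z x
        have h7 : 1 ≤ κ := by nlinarith
        rw [hfd, fD]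
        nlinarith
      have h0 : 0 < κ - f := sub_pos.2 hfκ
      have hp : 0 < κ / (κ - f) := by positivity
      refine ⟨κ / (κ - f), hp.le, ?_⟩
      have h1 := (Real.self_le_sinh_iff.2 hp.le).trans (Real.sinh_lt_cosh (x := _)).le
      have h2 := mul_vs M.hk (κ / (κ - f))
      rw [div_le_iff₀ h0] at h1
      rw [h] at h2 ⊢
      simp only [cs_neg_one] at h2 ⊢
      nlinarith
  have hcont : Continuous fun t => cs M.k t * f - κ * vs M.k t := by
    have := continuous_cs M.hk
    have := continuous_vs M.hk
    fun_prop
  obtain ⟨t, -, ht⟩ := intermediate_value_Icc' hT0 hcont.continuousOn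
    (show (0 : ℝ) ∈ Icc _ _ from ⟨hT, by
      rw [cs_zero M.hk, vs_zero M.hk, mul_zero, sub_zero, one_mul]; exact hf.le⟩)
  have ht : cs M.k t * f - κ * vs M.k t = 0 := ht
  have hcs : 0 < cs M.k t := by
    by_contra! hc
    have h1 := mul_nonneg hκ.le (vs_nonneg (k := M.k) t)
    have h2 : cs M.k t * f ≤ 0 := mul_nonpos_of_nonpos_of_nonneg hc hf.le
    have h3 : κ * vs M.k t = 0 := by linarith
    have h4 : vs M.k t = 0 := (mul_eq_zero.1 h3).resolve_left hκ.ne'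
    have h5 := mul_vs M.hk t
    rw [h4] at h5
    linarith
  have h1 : M.exp z v t ∈ K := hS (mem_bdD_iff.2 (by rw [fD_exp hn hv hvn, ← hfd, ht]))
  have h2 : M.exp z v (-t) ∈ K := hS (mem_bdD_iff.2 (by
    rw [fD_exp hn hv hvn, ← hfd, cs_neg M.hk, vs_neg M.hk, ht]))
  refine M.mem_of_combo hK h1 h2 zero_le_one zero_le_one (mul_pos two_pos hcs) ?_
  rw [M.M_exp hv, M.M_exp hv, cs_neg M.hk, sn_neg M.hk]
  module

lemma Pair.eq_D {K L : Set X} (P : M.Pair K L) {κ : ℝ}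
    (hκ : ∀ x n, M.IsNormal K x n → M.Umb K κ x n) {x : X} {n : E × ℝ} (hn : M.IsNormal K x n)
    (hk : 0 ≤ κ ^ 2 + M.k) : K = M.D κ x n := by
  have hκ0 := P.curv_pos hκ hn
  have hSf : M.bdD κ x n ⊆ frontier K := by
    rw [← P.component hκ hn]; exact connectedComponentIn_subset _ _
  have hDK := D_subset_of_bdD P.cvK hκ0 hn.ut hk (hSf.trans P.clK.frontier_subset)
  refine Subset.antisymm (fun z hz => ?_) hDK
  by_contra hzD
  rw [mem_D_iff, not_le] at hzD
  obtain ⟨p, hp, hpf, hpz⟩ : ∃ p, p ∈ interior K ∧ 0 < M.fD κ x n p ∧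
      (M.k = 1 → dist z p < Real.pi) := by
    obtain ⟨δ, hδ, hvs⟩ := (mem_nhdsGT_iff_exists_Ioo_subset).1 (eventually_vs_lt M.hk κ one_pos)
    have hδ : 0 < δ := hδ
    have hpt : ∀ t, 0 < t → t < δ → M.exp x n t ∈ interior K ∧ 0 < M.fD κ x n (M.exp x n t) := by
      intro t h0 h1
      have h2 : κ * vs M.k t < 1 * sn M.k t := hvs ⟨h0, h1⟩
      have h3 : M.h (M.exp x n t) x = vs M.k t := by
        have := M.h_exp_exp hn.ut t 0
        rwa [exp_zero, sub_zero] at this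
      have h4 : M.b (M (M.exp x n t) - M x) n = sn M.k t := by
        rw [M.b_exp_sub hn.ut hn.ut.tan, hn.ut.unit, mul_one]
      rw [fD, h3, h4]
      exact ⟨interior_mono hDK (M.mem_interior_D (by rw [h3, h4]; linarith)), by linarith⟩
    set t := min δ 1 / 2 with ht
    have hm : 0 < min δ 1 := lt_min hδ one_pos
    have hmδ : min δ 1 ≤ δ := min_le_left _ _
    have hm1 : min δ 1 ≤ 1 := min_le_right _ _
    obtain ⟨h1, h2⟩ := hpt t (by linarith) (by linarith)
    obtain ⟨h3, h4⟩ := hpt (t / 2) (by linarith) (by linarith)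
    by_cases hc : M.k = 1 ∧ dist z (M.exp x n t) = Real.pi
    · refine ⟨_, h3, h4, fun hk1 => lt_of_le_of_ne (M.hpi hk1 _ _) fun h => ?_⟩
      have key : ∀ y : X, dist z y = Real.pi → M y = -M z := fun y hy => by
        obtain ⟨v, hv, hyv⟩ := M.exists_log z y
        rw [hyv, hy, hk1]; simp
      have h5 := M.injective ((key _ h).trans (key _ hc.2).symm)
      have h6 := M.dist_exp_exp hn.ut (s := t / 2) (t := t) fun _ => by
        rw [abs_le]; constructor <;> linarith [Real.pi_gt_three]
      rw [h5, dist_self] at h6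
      have := abs_eq_zero.1 h6.symm
      linarith
    · exact ⟨_, h1, h2, fun hk1 => lt_of_le_of_ne (M.hpi hk1 _ _) fun h => hc ⟨hk1, h⟩⟩
  obtain ⟨v, hv, hpv⟩ := M.exists_log z p
  set d := dist z p
  have hp' : p = M.exp z v d := M.injective (by rw [hpv, M.M_exp hv])
  obtain ⟨s, hs, hfs⟩ := intermediate_value_Icc (dist_nonneg : 0 ≤ d)
    ((continuous_fD κ x n).comp (M.continuous_exp hv)).continuousOn
    (show (0 : ℝ) ∈ Icc _ _ from ⟨by
      simp only [Function.comp, exp_zero]; exact hzD.le, by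
      change 0 ≤ M.fD κ x n (M.exp z v d); rw [← hp']; exact hpf.le⟩)
  have hfs : M.fD κ x n (M.exp z v s) = 0 := hfs
  have hs0 : 0 < s := lt_of_le_of_ne hs.1 fun h => by
    rw [← h, exp_zero] at hfs; linarith
  have hsd : s < d := lt_of_le_of_ne hs.2 fun h => by
    rw [h, ← hp'] at hfs; linarith
  have hfr := hSf (mem_bdD_iff.2 hfs)
  have hsn : ∀ u, 0 < u → u ≤ d → 0 < sn M.k u := fun u h0 h1 => sn_pos M.hk h0 fun h => by
    have := hpz h; linarith
  refine hfr.2 (M.mem_interior_of_combo P.cvK hz hp (hsn (d - s) (by linarith) (by linarith)).le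
    (hsn s hs0 hsd.le) (hsn d (by linarith) le_rfl) ?_)
  rw [hp']
  exact M.sn_smul_exp hv d s

end SF

namespace SF
variable {E : Type*} [NormedAddCommGroup E] [InnerProductSpace ℝ E]
variable {M : SF X E} [Nonempty X] [Fact (2 ≤ Module.finrank ℝ E)]

variable (M) in
lemma k_eq_one_of_sphere {d : ℕ} (h : IsSphereSpace X d) : M.k = 1 := by
  by_contra hk
  obtain ⟨e, -, -, he⟩ := h
  obtain ⟨x⟩ := ‹Nonempty X›
  have := Nonempty.intro x
  obtain ⟨v, hv⟩ := M.exists_UT x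
  have h1 := M.dist_exp hv (t := 4) (by norm_num) fun h => absurd h hk
  rw [he] at h1
  have := Real.arccos_le_pi (inner ℝ (e x) (e (M.exp x v 4)))
  linarith [Real.pi_lt_d2]

variable (M) in
/-- The radius of a sphere of curvature `κ`. -/
lemma exists_radius {κ : ℝ} (hκ : 0 < κ) (h : 0 < κ ^ 2 + M.k) :
    ∃ ρ > (0 : ℝ), (M.k = 1 → ρ < Real.pi / 2) ∧ cs M.k ρ / sn M.k ρ = κ := by
  have hq := Real.sqrt_pos.2 h
  have hq2 : (√(κ ^ 2 + M.k))⁻¹ ^ 2 * (κ ^ 2 + M.k) = 1 := by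
    rw [inv_pow, Real.sq_sqrt h.le, inv_mul_cancel₀ h.ne']
  set β := (√(κ ^ 2 + M.k))⁻¹ with hβ
  have hβ0 : 0 < β := inv_pos.2 hq
  have hκβ : 0 < κ * β := mul_pos hκ hβ0
  obtain ⟨t, ht, hct, htk⟩ := exists_sn_eq M.hk (β := β) (by nlinarith [mul_pos hκβ hκβ])
  have h1 := cs_sq M.hk t
  rw [ht] at h1
  have h2 : cs M.k t = κ * β := by
    have : (cs M.k t - κ * β) * (cs M.k t + κ * β) = 0 := by linear_combination h1 - hq2
    rcases mul_eq_zero.1 this with h | h <;> linarith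
  refine ⟨t, ?_, fun h => (le_abs_self t).trans_lt (htk h), ?_⟩
  · by_contra! hc
    rcases hc.eq_or_lt with h0 | h0
    · rw [h0, sn_zero M.hk] at ht; linarith
    · have := sn_pos M.hk (neg_pos.2 h0) fun h => by
        have := htk h
        rw [abs_of_neg h0] at this
        linarith [Real.pi_pos]
      rw [sn_neg M.hk, ht] at this
      linarith
  · rw [h2, ht]; field_simp

lemma bdD_eq_sphere {x : X} {n : E × ℝ} (hn : M.UT x n) {ρ : ℝ} (h0 : 0 < ρ)
    (h1 : M.k = 1 → ρ < Real.pi) :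
    M.bdD (cs M.k ρ / sn M.k ρ) x n = sphere (M.exp x n ρ) ρ := by
  ext z
  rw [mem_bdD, mem_sphere]
  have h2 := M.dist_exp_le_iff hn h0 h1 z
  have h3 := M.dist_exp_lt_iff hn h0 h1 z
  rw [M.mem_D] at h2
  constructor
  · intro h; exact le_antisymm (h2.2 h.le) (not_lt.1 fun h' => (h3.1 h').ne h)
  · intro h; exact le_antisymm (h2.1 h.le) (not_lt.1 fun h' => (h3.2 h').ne h)

lemma tendsto_busemann {x : X} {n : E × ℝ} (hn : M.UT x n) (h : M.k = -1) (z : X) :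
    Tendsto (fun t => dist z (M.exp x n t) - t) atTop
      (nhds (Real.log (1 + M.h z x - M.b (M z - M x) n))) := by
  set c := 1 + M.h z x - M.b (M z - M x) n with hc
  have hc0 : 0 < c := by have := b_lt_of_neg hn h z; linarith
  have hcosh : ∀ t, Real.cosh (dist z (M.exp x n t)) =
      (1 + M.h z x) * Real.cosh t - Real.sinh t * M.b (M z - M x) n := fun t => by
    have h1 := mul_vs M.hk (dist z (M.exp x n t))
    have h2 := mul_vs M.hk t
    rw [← h_eq_vs, M.h_exp hn] at h1
    rw [h] at h1 h2
    simp only [cs_neg_one, sn_neg_one] at h1 h2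
    linear_combination h1 - h2
  have he : Tendsto (fun t => Real.exp (-t)) atTop (nhds 0) := Real.tendsto_exp_neg_atTop_nhds_zero
  have key : Tendsto (fun t => Real.exp (dist z (M.exp x n t) - t)) atTop (nhds c) := by
    have h1 : Tendsto (fun t => c + (1 + M.h z x + M.b (M z - M x) n) * (Real.exp (-t) *
        Real.exp (-t)) - Real.exp (-dist z (M.exp x n t)) * Real.exp (-t)) atTop (nhds c) := by
      have h2 : Tendsto (fun t => Real.exp (-dist z (M.exp x n t)) * Real.exp (-t)) atTop
          (nhds 0) := by
        refine squeeze_zero (fun t => by positivity) (fun t => ?_) he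
        exact mul_le_of_le_one_left (Real.exp_pos _).le
          (Real.exp_le_one_iff.2 (neg_nonpos.2 dist_nonneg))
      simpa using (tendsto_const_nhds.add ((he.mul he).const_mul _)).sub h2
    refine h1.congr fun t => ?_
    have h2 := hcosh t
    rw [Real.cosh_eq, Real.cosh_eq, Real.sinh_eq] at h2
    have h3 : Real.exp t * Real.exp (-t) = 1 := by rw [← Real.exp_add]; simp
    rw [sub_eq_add_neg (dist _ _), Real.exp_add, hc]
    linear_combination (-2 * Real.exp (-t)) * h2 -
      (1 + M.h z x - M.b (M z - M x) n) * h3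
  have := (Real.continuousAt_log hc0.ne').tendsto.comp key
  simpa [Function.comp_def] using this

lemma isParaball_D {x : X} {n : E × ℝ} (hn : M.UT x n) (h : M.k = -1) :
    IsParaball (M.D 1 x n) := by
  refine ⟨M.exp x n, Isometry.of_dist_eq fun s t => ?_, ?_⟩
  · rw [M.dist_exp_exp hn fun hk => by rw [h] at hk; norm_num at hk, Real.dist_eq]
  · ext z
    have h1 := tendsto_busemann hn h z
    have h2 := b_lt_of_neg hn h z
    have h3 : Real.log (1 + M.h z x - M.b (M z - M x) n) ≤ 0 ↔ z ∈ M.D 1 x n := by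
      rw [Real.log_nonpos_iff (by linarith), M.mem_D]
      constructor <;> intro h <;> linarith
    rw [← h3]
    constructor
    · intro h; exact ⟨_, h, h1⟩
    · rintro ⟨b, hb, hb'⟩
      rwa [tendsto_nhds_unique h1 hb']

lemma frontier_D_subset (κ : ℝ) (x : X) (n : E × ℝ) : frontier (M.D κ x n) ⊆ M.bdD κ x n := by
  intro z hz
  have h1 : z ∈ M.D κ x n := (M.isClosed_D κ x n).frontier_subset hz
  refine le_antisymm (M.mem_D.1 h1) (not_lt.1 fun h => hz.2 (M.mem_interior_D h))

lemma Pair.concl_of_nonneg {K L : Set X} (P : M.Pair K L) {κ : ℝ}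
    (hκ : ∀ x n, M.IsNormal K x n → M.Umb K κ x n) (hκL : ∀ x n, M.IsNormal L x n → M.Umb L κ x n)
    (hk : 0 ≤ κ ^ 2 + M.k) (d : ℕ) : T6Cond4 d K L := by
  obtain ⟨x, hx⟩ := P.frK
  obtain ⟨y, hy⟩ := P.frL
  obtain ⟨n, hn⟩ := P.nmK x hx
  obtain ⟨m, hm⟩ := P.nmL y hy
  have hκ0 := P.curv_pos hκ hn
  have hK := P.eq_D hκ hn hk
  have hL := P.symm.eq_D hκL hm hk
  have hC : ∀ C ∈ bdryComponents K ∪ bdryComponents L, (∃ z v, M.UT z v ∧ C = M.bdD κ z v) := by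
    rintro C (⟨z, hz, rfl⟩ | ⟨z, hz, rfl⟩)
    · obtain ⟨v, hv⟩ := P.nmK z hz
      exact ⟨z, v, hv.ut, P.component hκ hv⟩
    · obtain ⟨v, hv⟩ := P.nmL z hz
      exact ⟨z, v, hv.ut, P.symm.component hκL hv⟩
  rcases hk.eq_or_lt with h0 | h0
  · right; left
    have hk1 : M.k = -1 := by
      rcases M.hk with h | h | h
      · rw [h] at h0; nlinarith
      · rw [h] at h0; nlinarith
      · exact h
    have hκ1 : κ = 1 := by rw [hk1] at h0; nlinarith
    rw [hκ1] at hK hL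
    have hKP : IsParaball K := by rw [hK]; exact isParaball_D hn.ut hk1
    have hLP : IsParaball L := by rw [hL]; exact isParaball_D hm.ut hk1
    refine ⟨?_, hKP, hLP⟩
    rintro C (⟨z, hz, rfl⟩ | ⟨z, hz, rfl⟩)
    · obtain ⟨v, hv⟩ := P.nmK z hz
      refine ⟨K, hKP, Subset.antisymm (connectedComponentIn_subset _ _) ?_⟩
      rw [P.component hκ hv]
      have := P.eq_D hκ hv hk
      nth_rewrite 1 [this]
      exact frontier_D_subset _ _ _
    · obtain ⟨v, hv⟩ := P.nmL z hz
      refine ⟨L, hLP, Subset.antisymm (connectedComponentIn_subset _ _) ?_⟩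
      rw [P.symm.component hκL hv]
      have := P.symm.eq_D hκL hv hk
      nth_rewrite 1 [this]
      exact frontier_D_subset _ _ _
  · left
    obtain ⟨ρ, hρ, hρ1, hρκ⟩ := M.exists_radius hκ0 h0
    have hρ2 : M.k = 1 → ρ < Real.pi := fun h => by linarith [hρ1 h, Real.pi_pos]
    refine ⟨ρ, hρ, fun h => (hρ1 (M.k_eq_one_of_sphere h)).le, fun C hCm => ?_,
      ⟨M.exp x n ρ, ?_⟩, ⟨M.exp y m ρ, ?_⟩⟩
    · obtain ⟨z, v, hv, rfl⟩ := hC C hCm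
      exact ⟨_, by rw [← bdD_eq_sphere hv hρ hρ2, hρκ]⟩
    · rw [M.closedBall_eq_D hn.ut hρ hρ2, hρκ, ← hK]
    · rw [M.closedBall_eq_D hm.ut hρ hρ2, hρκ, ← hL]

end SF

namespace SF
variable {E : Type*} [NormedAddCommGroup E] [InnerProductSpace ℝ E]
variable {M : SF X E} [Nonempty X] [Fact (2 ≤ Module.finrank ℝ E)]

lemma isHalfspace_D {p : X} {a : E × ℝ} (ha : M.UT p a) : IsHalfspace (M.D 0 p a) := by
  have hμ : ∀ z, M.b (M ((M.mirror_tan ha).refl z) - M p) a = -M.b (M z - M p) a := fun z => by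
    rw [← M.mu_tan ha.tan, ← M.mu_tan ha.tan, (M.mirror_tan ha).mu_refl]
  have him : ∀ z, z ∈ ⇑(M.mirror_tan ha).refl '' M.D 0 p a ↔ M.b (M z - M p) a ≤ 0 := fun z => by
    constructor
    · rintro ⟨y, hy, rfl⟩
      rw [M.mem_D_zero] at hy
      rw [hμ]; linarith
    · intro hz
      refine ⟨(M.mirror_tan ha).refl z, ?_, (M.mirror_tan ha).refl_refl z⟩
      rw [M.mem_D_zero, hμ]; linarith
  refine ⟨_, (M.mirror_tan ha).isReflection, M.isClosed_D _ _ _, ?_, ?_⟩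
  · ext z
    rw [mem_union, him, M.mem_D_zero]
    simpa using le_total _ _
  · ext z
    rw [mem_inter_iff, him, M.mem_D_zero, Set.mem_ofPred_eq, (M.mirror_tan ha).refl_eq_self,
      M.mu_tan ha.tan]
    exact ⟨fun h => le_antisymm h.2 h.1, fun h => ⟨h.ge, h.le⟩⟩

lemma infDist_D_le_iff (h : M.k = -1) {p : X} {a : E × ℝ} (ha : M.UT p a) {lam : ℝ}
    (hl : 0 ≤ lam) (z : X) :
    infDist z (M.D 0 p a) ≤ lam ↔ -Real.sinh lam ≤ M.b (M z) a := by
  have hk : M.k ≠ 0 := by rw [h]; norm_num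
  have hb : ∀ y, M.b (M y - M p) a = M.b (M y) a := fun y => by
    rw [b_sub_left, ha.tan.b_zero hk, sub_zero]
  have hsl : 0 ≤ Real.sinh lam := Real.sinh_nonneg_iff.2 hl
  obtain ⟨p₀, t, hp₀, h0, hz, -, ht, -⟩ := M.exists_foot (y := z) ha (by rw [h]; norm_num)
  have hne : (M.D 0 p a).Nonempty := ⟨p, M.self_mem_D _ _ _⟩
  rw [h, sn_neg_one, hb] at ht
  rcases le_or_gt 0 (M.b (M z) a) with h1 | h1
  · have : z ∈ M.D 0 p a := by rw [M.mem_D_zero, hb]; exact h1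
    rw [infDist_zero_of_mem this]
    exact ⟨fun _ => by linarith, fun _ => hl⟩
  have ht0 : t < 0 := by rwa [← ht, Real.sinh_neg_iff] at h1
  have hd : infDist z (M.D 0 p a) = -t := by
    apply le_antisymm
    · have hm : p₀ ∈ M.D 0 p a := by
        rw [M.mem_D_zero, hb, hp₀.tan.b_zero hk]
      have h2 := infDist_le_dist_of_mem (x := z) hm
      have h3 := M.dist_exp_exp hp₀ (s := t) (t := 0) (by rw [h]; norm_num)
      rw [← hz, M.exp_zero, sub_zero, abs_of_neg ht0] at h3
      rwa [h3] at h2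
    · refine (le_infDist hne).2 fun y hy => ?_
      rw [M.mem_D_zero, hb] at hy
      have h2 := M.h_exp hp₀ y t
      rw [← hz, h_comm, h_eq_vs, b_sub_left, hp₀.tan.b_zero hk, sub_zero, ← vs_neg M.hk t] at h2
      have h3 : 0 < cs M.k t := by rw [h, cs_neg_one]; exact Real.cosh_pos _
      have h4 : sn M.k t < 0 := by rw [h, sn_neg_one, ht]; exact h1
      refine (vs_le_iff M.hk (by linarith) dist_nonneg (by rw [h]; norm_num)
        (by rw [h]; norm_num)).1 ?_
      rw [h2]
      nlinarith [mul_nonneg h3.le (M.h_nonneg y p₀)]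
  rw [hd, ← ht]
  constructor
  · intro h5
    have := Real.sinh_le_sinh.2 h5
    rw [Real.sinh_neg] at this
    linarith
  · intro h5
    rw [← Real.sinh_le_sinh, Real.sinh_neg]
    linarith

lemma tanh_pos {t : ℝ} (h : 0 < t) : 0 < Real.tanh t := by
  rw [Real.tanh_eq_sinh_div_cosh]
  exact div_pos (Real.sinh_pos_iff.2 h) (Real.cosh_pos _)

lemma parallel_eq_D (h : M.k = -1) {p x : X} {a n : E × ℝ} (ha : M.UT p a) (hn : M.UT x n)
    {lam : ℝ} (hl : 0 ≤ lam) (e : a = Real.sinh lam • M x + Real.cosh lam • n) :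
    {z | infDist z (M.D 0 p a) ≤ lam} = M.D (Real.tanh lam) x n := by
  have hk : M.k ≠ 0 := by rw [h]; norm_num
  ext z
  rw [Set.mem_ofPred_eq, infDist_D_le_iff h ha hl, M.mem_D, e, b_add_right, b_smul_right,
    b_smul_right, b_sub_left, hn.tan.b_zero hk, sub_zero, M.b_eq _ _ hk]
  have h1 := M.k_mul_h z x
  rw [h] at h1 ⊢
  have hC := Real.cosh_pos lam
  rw [Real.tanh_eq_sinh_div_cosh, div_mul_eq_mul_div, div_le_iff₀ hC]
  have h2 : M.q (M z) (M x) = 1 + M.h z x := by linarith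
  rw [h2]
  constructor <;> intro h3 <;> nlinarith

lemma frontier_D {κ : ℝ} (hκ : 0 ≤ κ) {x : X} {n : E × ℝ} (hn : M.UT x n) :
    frontier (M.D κ x n) = M.bdD κ x n := by
  refine (frontier_D_subset _ _ _).antisymm fun z hz => ?_
  refine frontier_of_mem (M.bdD_subset _ _ _ hz) fun hi => ?_
  have hm := M.recentre_UT hn hz
  set m := n - κ • (M z - M x) with hmd
  have h1 := (M.tendsto_exp_zero hm.neg).eventually (mem_interior_iff_mem_nhds.1 hi)
  obtain ⟨t, ht, hs⟩ := (h1.and M.eventually_sn_pos).exists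
  have h2 : M.exp z (-m) t ∈ M.D κ x n := ht
  rw [M.mem_D] at h2
  have h3 := M.recentre hz (M.exp z (-m) t)
  rw [← hmd, M.b_exp_sub hm.neg hm.tan, b_neg_left, hm.unit] at h3
  nlinarith [mul_nonneg hκ (M.h_nonneg (M.exp z (-m) t) z)]

lemma not_isHyperplane_bdD (h : M.k = -1) {κ : ℝ} (h0 : 0 < κ) (h1 : κ < 1) {x : X} {n : E × ℝ}
    (hn : M.UT x n) : ¬ IsHyperplane (M.bdD κ x n) := by
  rintro ⟨σ, -, hσ⟩
  obtain ⟨e, he, hen⟩ := M.exists_UT_orth x n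
  set S := Real.sinh (1 / 2) with hS
  set C := Real.cosh (1 / 2) with hC
  have hS0 : 0 < S := Real.sinh_pos_iff.2 (by norm_num)
  have hC0 : 0 < C := Real.cosh_pos _
  have hCS : C ^ 2 - S ^ 2 = 1 := Real.cosh_sq_sub_sinh_sq _
  have hC1 : 1 < C := by nlinarith
  set c := κ * S / C with hc
  have hcC : c * C = κ * S := by rw [hc]; field_simp
  have hc0 : 0 < c := by positivity
  have hc1 : c < 1 := by
    rw [hc, div_lt_one hC0]
    have : S < C := by nlinarith
    nlinarith
  set u := √(1 - c ^ 2) • e + c • n with hu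
  have hsq : √(1 - c ^ 2) ^ 2 = 1 - c ^ 2 := Real.sq_sqrt (by nlinarith)
  have hun : M.b u n = c := by
    rw [hu, b_add_left, b_smul_left, b_smul_left, hen, hn.unit]; ring
  have hut : M.UT x u := by
    refine ⟨(he.tan.smul _).add (hn.tan.smul _), ?_⟩
    nth_rewrite 2 [hu]
    rw [b_add_right, b_smul_right, b_smul_right, hun, hu, b_add_left, b_smul_left, b_smul_left,
      he.unit, M.b_comm n e, hen]
    linear_combination hsq
  have hmem : ∀ t, M.exp x u t ∈ M.bdD κ x n ↔ κ * vs (-1) t = Real.sinh t * c := fun t => by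
    have := M.h_exp_exp hut t 0
    rw [M.exp_zero, sub_zero] at this
    rw [M.mem_bdD, this, M.b_exp_sub hut hn.tan, hun, h, sn_neg_one]
  have hs1 : Real.sinh 1 = 2 * S * C := by
    rw [hS, hC, ← Real.sinh_two_mul]; norm_num
  have hv1 : vs (-1) 1 = 2 * S ^ 2 := by
    show 2 * sn (-1) (1 / 2) ^ 2 = _
    rw [sn_neg_one]
  have hx : σ x = x := by
    have : x ∈ M.bdD κ x n := M.self_mem_bdD _ _ _
    rwa [hσ] at this
  have hy : σ (M.exp x u 1) = M.exp x u 1 := by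
    have : M.exp x u 1 ∈ M.bdD κ x n := by
      rw [hmem, hs1, hv1]; linear_combination (-2 * S) * hcC
    rwa [hσ] at this
  have hcm := M.sn_smul_exp hut 1 (1 / 2)
  rw [h, sn_neg_one, sn_neg_one, sn_neg_one, show (1 : ℝ) - 1 / 2 = 1 / 2 by norm_num, ← hS] at hcm
  have hsp : 0 < Real.sinh 1 := by rw [hs1]; positivity
  have e1 := M.stewart hcm hS0.le hS0.le hsp.le (σ (M.exp x u (1 / 2)))
  have e2 := M.stewart hcm hS0.le hS0.le hsp.le (M.exp x u (1 / 2))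
  have g1 := M.h_isom σ x (M.exp x u (1 / 2))
  have g2 := M.h_isom σ (M.exp x u 1) (M.exp x u (1 / 2))
  rw [hx] at g1
  rw [hy] at g2
  rw [g1, g2, ← e2, M.h_self] at e1
  have e3 : M.h (M.exp x u (1 / 2)) (σ (M.exp x u (1 / 2))) = 0 := by
    have h5 := mul_left_cancel₀ (by positivity) e1
    have h6 : Real.sinh 1 * M.h (M.exp x u (1 / 2)) (σ (M.exp x u (1 / 2))) = 0 := by linarith
    exact (mul_eq_zero.1 h6).resolve_left hsp.ne'
  rw [M.h_eq_zero] at e3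
  have hm : M.exp x u (1 / 2) ∈ M.bdD κ x n := by rw [hσ]; exact e3.symm
  rw [hmem, ← hS] at hm
  have h5 := mul_vs (k := -1) (h ▸ M.hk) (1 / 2)
  rw [cs_neg_one, ← hC] at h5
  have h6 : vs (-1) (1 / 2) = C - 1 := by linarith
  rw [h6] at hm
  have : κ * (C - 1) = 0 := by
    linear_combination (-C) * hm - S * hcC + κ * hCS
  rcases mul_eq_zero.1 this with h7 | h7 <;> linarith

lemma isHypersphere_bdD (h : M.k = -1) {lam : ℝ} (hl : 0 < lam) {x : X} {n : E × ℝ}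
    (hn : M.UT x n) : IsHypersphere (M.bdD (Real.tanh lam) x n) lam := by
  have h0 : 0 < Real.tanh lam := tanh_pos hl
  refine ⟨hl, ⟨M.D 0 (M.exp x n lam) (M.vel x n lam), isHalfspace_D (M.vel_UT hn _), ?_⟩,
    not_isHyperplane_bdD h h0 (Real.tanh_lt_one _) hn⟩
  rw [parallel_eq_D h (M.vel_UT hn lam) hn hl.le, frontier_D h0.le hn]
  unfold vel
  rw [h, sn_neg_one, cs_neg_one, neg_mul, neg_neg, one_mul]

lemma Pair.concl {K L : Set X} (P : M.Pair K L) (d : ℕ) : T6Cond4 d K L := by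
  obtain ⟨κ, hκ, hκL⟩ := P.exists_umb
  rcases le_or_gt 0 (κ ^ 2 + M.k) with hk | hk
  · exact P.concl_of_nonneg hκ hκL hk d
  have h : M.k = -1 := by
    rcases M.hk with h | h | h
    · rw [h] at hk; nlinarith [sq_nonneg κ]
    · rw [h] at hk; nlinarith [sq_nonneg κ]
    · exact h
  rw [h] at hk
  right; right
  obtain ⟨x, hx⟩ := P.frK
  obtain ⟨n, hn⟩ := P.nmK x hx
  have hκ0 := P.curv_pos hκ hn
  have hκ1 : κ < 1 := by nlinarith
  have e : Real.tanh (Real.artanh κ) = κ := Real.tanh_artanh ⟨by linarith, hκ1⟩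
  have hl : 0 < Real.artanh κ := Real.artanh_pos ⟨hκ0, hκ1⟩
  refine ⟨_, hl, ?_⟩
  rintro C (⟨z, hz, rfl⟩ | ⟨z, hz, rfl⟩)
  · obtain ⟨v, hv⟩ := P.nmK z hz
    rw [P.component hκ hv]
    have := isHypersphere_bdD h hl hv.ut
    rwa [e] at this
  · obtain ⟨v, hv⟩ := P.nmL z hz
    rw [P.symm.component hκL hv]
    have := isHypersphere_bdD h hl hv.ut
    rwa [e] at this

end SF

namespace SF
variable {E : Type*} [NormedAddCommGroup E] [InnerProductSpace ℝ E]
variable {M : SF X E} [Nonempty X] [Fact (2 ≤ Module.finrank ℝ E)]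

lemma preconnectedSpace (M : SF X E) : PreconnectedSpace X := by
  obtain ⟨x⟩ := ‹Nonempty X›
  refine ⟨isPreconnected_of_forall x fun y _ => ?_⟩
  obtain ⟨v, hv, hy⟩ := M.exists_log x y
  refine ⟨range (M.exp x v), subset_univ _, ⟨0, M.exp_zero x v⟩, ⟨dist x y, ?_⟩,
    isPreconnected_range (M.continuous_exp hv)⟩
  exact M.injective (by rw [M.M_exp hv, hy])

lemma frontier_nonempty (M : SF X E) {K : Set X} (hi : (interior K).Nonempty) (hK : K ≠ univ) :
    (frontier K).Nonempty :=
  have := M.preconnectedSpace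
  nonempty_frontier_iff.2 ⟨hi.mono interior_subset, hK⟩

lemma mirror_swap_eq {p : X} {a : E × ℝ} (ha : M.UT p a) (t : ℝ) (z : X) :
    M.mu (M (M.exp p a (-t)) - M (M.exp p a t)) (M.off (M.exp p a (-t)) (M.exp p a t)) (M z) =
      -(2 * sn M.k t) * M.b (M z - M p) a := by
  rw [mu_swap, M.h_exp ha, M.h_exp ha, vs_neg M.hk, cs_neg M.hk, sn_neg M.hk]
  ring

lemma exists_halfspace {P : Set X} (hP : IsHalfspace P) :
    ∃ (p : X) (a : E × ℝ), M.UT p a ∧ P = M.D 0 p a := by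
  obtain ⟨σ, hσ, hPc, hU, hI⟩ := hP
  have hσσ : ∀ z, σ (σ z) = z := fun z => DFunLike.congr_fun hσ.1 z
  obtain ⟨z, hz⟩ : ∃ z, σ z ≠ z := by
    by_contra! hc
    exact hσ.2.1 (by ext z; exact hc z)
  obtain ⟨v, hv, hy⟩ := M.exists_log z (σ z)
  set t := dist z (σ z) / 2 with ht
  have ht0 : 0 < t := half_pos (dist_pos.2 hz.symm)
  have hsn : 0 < sn M.k t := sn_pos M.hk ht0 fun h => by
    have := M.hpi h z (σ z); have := Real.pi_pos; rw [ht]; linarith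
  have ha := M.vel_UT hv t
  set p := M.exp z v t with hp
  set a := M.vel z v t with had
  have e1 : M.exp p a (-t) = z := by rw [hp, had, M.exp_vel hv, add_neg_cancel, M.exp_zero]
  have e2 : M.exp p a t = σ z := by
    rw [hp, had, M.exp_vel hv, ht, add_halves]
    exact M.injective (by rw [M.M_exp hv, hy])
  have hmu := mirror_swap_eq ha t
  rw [e1, e2] at hmu
  have hr := M.reflection_unique hσ hz.symm rfl
  have hm := M.mirror_swap hz.symm
  set f : X → ℝ := fun w => M.b (M w - M p) a with hf
  have hfix : ∀ w, σ w = w ↔ f w = 0 := fun w => by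
    rw [hr, Mirror.refl_eq_self, hmu]
    simp [hsn.ne', hf]
  have hfs : ∀ w, f (σ w) = -f w := fun w => by
    have h1 := hm.mu_refl w
    rw [hmu, hmu, ← hr] at h1
    have : 2 * sn M.k t * (f (σ w) + f w) = 0 := by simp only [hf]; linarith
    have := (mul_eq_zero.1 this).resolve_left (by positivity)
    linarith
  have hpre : IsPreconnected {w | 0 < f w} := by
    have h2 := M.isPreconnected_side (-(M z - M (σ z))) (-M.off z (σ z))
    have : {w | 0 < M.mu (-(M z - M (σ z))) (-M.off z (σ z)) (M w)} = {w | 0 < f w} := by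
      ext w
      rw [Set.mem_ofPred_eq, Set.mem_ofPred_eq, Mirror.mu_neg, hmu, neg_mul, neg_neg]
      exact mul_pos_iff_of_pos_left (by positivity)
    rwa [this] at h2
  have hcl : IsClosed (⇑σ '' P) := σ.toHomeomorph.isClosed_image.2 hPc
  have hmemσ : ∀ w, w ∈ ⇑σ '' P ↔ σ w ∈ P := fun w =>
    ⟨by rintro ⟨y, hy, rfl⟩; rwa [hσσ], fun h => ⟨_, h, hσσ w⟩⟩
  have hcov : ∀ w, w ∈ P ∨ σ w ∈ P := fun w => by
    have : w ∈ P ∪ ⇑σ '' P := hU ▸ mem_univ w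
    rwa [mem_union, hmemσ] at this
  have hint : ∀ w, (w ∈ P ∧ σ w ∈ P) ↔ f w = 0 := fun w => by
    rw [← hfix, ← hmemσ]
    exact Set.ext_iff.1 hI w
  have hor : {w | 0 < f w} ⊆ P ∨ {w | 0 < f w} ⊆ ⇑σ '' P := by
    refine isPreconnected_iff_subset_of_disjoint_closed.1 hpre _ _ hPc hcl
      (by rw [hU]; exact subset_univ _) ?_
    rw [hI]
    ext w
    simp only [mem_inter_iff, Set.mem_ofPred_eq, hfix, mem_empty_iff_false, iff_false, not_and]
    exact fun h => h.ne'
  rcases hor with hs | hs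
  · refine ⟨p, a, ha, ?_⟩
    ext w
    rw [M.mem_D_zero]
    change _ ↔ 0 ≤ f w
    constructor
    · intro hw
      by_contra! hc
      have h1 : σ w ∈ P := hs (by rw [Set.mem_ofPred_eq, hfs]; linarith)
      exact hc.ne ((hint w).1 ⟨hw, h1⟩)
    · intro hw
      rcases hw.eq_or_lt with h0 | h0
      · exact ((hint w).2 h0.symm).1
      · exact hs h0
  · refine ⟨p, -a, ha.neg, ?_⟩
    ext w
    rw [M.mem_D_zero, b_neg_right]
    change _ ↔ 0 ≤ -f w
    constructor
    · intro hw
      by_contra! hc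
      have h1 : σ w ∈ P := (hmemσ w).1 (hs (show 0 < f w by linarith))
      have := (hint w).1 ⟨hw, h1⟩
      linarith
    · intro hw
      rcases hw.eq_or_lt with h0 | h0
      · exact ((hint w).2 (by linarith)).1
      · have := (hmemσ (σ w)).1 (hs (show 0 < f (σ w) by rw [hfs]; linarith))
        rwa [hσσ] at this

lemma SC_of_condCurvBound {d : ℕ} {K : Set X} (h : M.k = -1) (hd : IsHyperbolicSpace X d)
    (hK : CondCurvBound d K) {x : X} {n : E × ℝ} (hn : M.IsNormal K x n) : M.SC K x n := by
  have hk : M.k ≠ 0 := by rw [h]; norm_num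
  obtain ⟨ε, hε, B, hB, hxB, -, -, hH⟩ := hK x hn.frontier
  obtain ⟨P, lam, hP, hl, -, rfl⟩ := hH hd
  obtain ⟨p, a, ha, rfl⟩ := exists_halfspace (M := M) hP
  have hcont : Continuous fun z => M.b (M z) a := M.continuous_b M.continuous continuous_const
  have hmem : ∀ z, z ∈ {y | infDist y (M.D 0 p a) ≤ lam} ↔ -Real.sinh lam ≤ M.b (M z) a :=
    fun z => infDist_D_le_iff h ha hl.le z
  have hcl : IsClosed {y | infDist y (M.D 0 p a) ≤ lam} :=
    isClosed_le (continuous_infDist_pt _) continuous_const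
  have hxb : M.b (M x) a = -Real.sinh lam := by
    refine le_antisymm (not_lt.1 fun h' => hxB.2 ?_) ((hmem x).1 (hcl.frontier_subset hxB))
    refine mem_interior.2 ⟨{z | -Real.sinh lam < M.b (M z) a}, fun z hz => ?_,
      isOpen_lt continuous_const hcont, h'⟩
    exact (hmem z).2 (le_of_lt hz)
  set S := Real.sinh lam with hS
  set C := Real.cosh lam with hC
  have hC0 : 0 < C := Real.cosh_pos _
  have hCS : C ^ 2 - S ^ 2 = 1 := Real.cosh_sq_sub_sinh_sq _
  set m := C⁻¹ • (a - S • M x) with hmd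
  have hxx : M.b (M x) (M x) = -1 := by rw [M.b_self hk, h]
  have hm : M.UT x m := by
    constructor
    · rw [M.tan_b hk, hmd, b_smul_right, b_sub_right, b_smul_right, hxb, hxx]; ring
    · rw [hmd, b_smul_left, b_smul_right, b_sub_left, b_sub_right, b_sub_right, b_smul_left,
        b_smul_left, b_smul_right, b_smul_right, ha.unit, hxx, M.b_comm a, hxb]
      field_simp
      linear_combination -hCS
  have hsub : ∀ᶠ z in nhds x, z ∈ K → z ∈ M.D (Real.tanh lam) x m := by
    filter_upwards [closedBall_mem_nhds x hε] with z hz hzK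
    rw [← parallel_eq_D h ha hm hl.le (by rw [hmd, smul_inv_smul₀ hC0.ne']; abel)]
    exact hB ⟨hzK, hz⟩
  have ht := tanh_pos hl
  obtain ⟨κ, -, hκ⟩ := hn.inner
  have e : n = m := M.normal_unique_of_subset hn.ut hm hκ
    (hsub.mono fun z hz hzK => M.D_anti ht.le _ _ (hz hzK))
  exact ⟨_, ht, e ▸ hsub⟩

lemma pair_of_hyperbolic {d : ℕ} {K L : Set X} (h : M.k = -1) (hd : IsHyperbolicSpace X d)
    (clK : IsClosed K) (clL : IsClosed L) (cvK : GConvex K)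
    (cvL : GConvex L) (inK : (interior K).Nonempty) (inL : (interior L).Nonempty)
    (prK : K ≠ univ) (prL : L ≠ univ) (bK : CondBallInside K) (bL : CondBallInside L)
    (cK : CondCurvBound d K) (cL : CondCurvBound d L) (h3 : T6Cond3 K L) : M.Pair K L :=
  ⟨clK, clL, cvK, cvL, inK, inL, M.frontier_nonempty inK prK, M.frontier_nonempty inL prL,
    fun _ hx => M.exists_normal cvK bK hx, fun _ hx => M.exists_normal cvL bL hx,
    fun _ _ hn => SC_of_condCurvBound h hd cK hn, fun _ _ hn => SC_of_condCurvBound h hd cL hn, h3⟩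

end SF

lemma isCompact_convexHull {F : Type*} [NormedAddCommGroup F] [NormedSpace ℝ F]
    [FiniteDimensional ℝ F] {S : Set F} (hS : IsCompact S) : IsCompact (convexHull ℝ S) := by
  rcases S.eq_empty_or_nonempty with rfl | ⟨s, hs⟩
  · simp
  have key : convexHull ℝ S =
      (fun p : (Fin (Module.finrank ℝ F + 1) → ℝ) × (Fin (Module.finrank ℝ F + 1) → F) =>
        ∑ i, p.1 i • p.2 i) '' (stdSimplex ℝ (Fin (Module.finrank ℝ F + 1)) ×ˢ
          Set.pi univ fun _ => S) := by
    refine Subset.antisymm (fun x hx => ?_) ?_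
    · obtain ⟨ι, _, z, w, hz, hai, hw, h1, rfl⟩ := eq_pos_convex_span_of_mem_convexHull hx
      have hcard : Fintype.card ι ≤ Fintype.card (Fin (Module.finrank ℝ F + 1)) := by
        rw [Fintype.card_fin]
        exact hai.card_le_finrank_succ.trans (Nat.succ_le_succ (Submodule.finrank_le _))
      obtain ⟨f⟩ := Function.Embedding.nonempty_of_card_le hcard
      have hout : ∀ j ∉ range f, Function.extend f w 0 j = 0 := fun j hj =>
        Function.extend_apply' _ _ _ hj
      refine ⟨(Function.extend f w 0, Function.extend f z fun _ => s), ⟨⟨fun j => ?_, ?_⟩, ?_⟩, ?_⟩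
      · by_cases hj : j ∈ range f
        · obtain ⟨i, rfl⟩ := hj
          simpa only [f.injective.extend_apply] using (hw i).le
        · exact (hout j hj).ge
      · rw [← h1]
        exact (Fintype.sum_of_injective f f.injective _ _ hout fun i =>
          (f.injective.extend_apply _ _ _).symm).symm
      · intro j _
        by_cases hj : j ∈ range f
        · obtain ⟨i, rfl⟩ := hj
          simpa only [f.injective.extend_apply] using hz (mem_range_self i)
        · simpa only [Function.extend_apply' _ _ _ hj] using hs
      · refine (Fintype.sum_of_injective f f.injective _ _ (fun j hj => ?_) fun i => ?_).symm
        · simp only [hout j hj, zero_smul]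
        · simp only [f.injective.extend_apply]
    · rintro _ ⟨⟨w, z⟩, ⟨hw, hz⟩, rfl⟩
      exact (convex_convexHull ℝ S).sum_mem (fun i _ => hw.1 i) hw.2
        fun i _ => subset_convexHull ℝ S (hz i trivial)
  rw [key]
  exact ((isCompact_stdSimplex ℝ _).prod (isCompact_univ_pi fun _ => hS)).image (by fun_prop)

lemma exists_separating {F : Type*} [NormedAddCommGroup F] [InnerProductSpace ℝ F]
    [FiniteDimensional ℝ F] {S : Set F} (hS : IsCompact S) {x : F} (hx : x ∉ convexHull ℝ S) :
    ∃ (a : F) (δ : ℝ), 0 < δ ∧ ∀ y ∈ S, δ < inner ℝ a (y - x) := by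
  obtain ⟨f, u, h1, h2⟩ := geometric_hahn_banach_point_closed (convex_convexHull ℝ S)
    (isCompact_convexHull hS).isClosed hx
  refine ⟨(InnerProductSpace.toDual ℝ F).symm f, u - f x, sub_pos.2 h1, fun y hy => ?_⟩
  rw [InnerProductSpace.toDual_symm_apply, map_sub]
  exact sub_lt_sub_right (h2 y (subset_convexHull ℝ S hy)) _

lemma exists_local_farthest {F : Type*} [NormedAddCommGroup F] [InnerProductSpace ℝ F]
    [FiniteDimensional ℝ F] {T : Set F} (hT : IsClosed T)
    (hcv : Convex ℝ T) {x₀ y : F}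
    (hx : x₀ ∈ T.extremePoints ℝ) (hy : y ∈ T) (hxy : y ≠ x₀) :
    ∃ c, ∃ x ∈ T, x ≠ c ∧ ∀ᶠ z in nhds x, z ∈ T → dist z c ≤ dist x c := by
  set r := dist y x₀ with hr
  have hr0 : 0 < r := dist_pos.2 hxy
  set S := T ∩ sphere x₀ r with hS
  have hSc : IsCompact S := (isCompact_sphere x₀ r).inter_left hT
  have hx₀ : x₀ ∉ convexHull ℝ S := by
    intro h
    have := extremePoints_convexHull_subset (inter_extremePoints_subset_extremePoints_of_subset
      (convexHull_min inter_subset_left hcv) ⟨h, hx⟩)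
    exact hr0.ne (by simpa using this.2)
  obtain ⟨a, δ, hδ, ha⟩ := exists_separating hSc hx₀
  set c := x₀ + (r ^ 2 / δ) • a with hc
  have hlt : ∀ z ∈ S, dist z c < dist x₀ c := by
    intro z hz
    have h1 := ha z hz
    have h2 : ‖z - x₀‖ = r := by rw [← dist_eq_norm]; exact hz.2
    rw [dist_eq_norm, dist_eq_norm]
    refine lt_of_pow_lt_pow_left₀ 2 (norm_nonneg _) ?_
    have e1 : z - c = (z - x₀) - (r ^ 2 / δ) • a := by rw [hc]; abel
    have e2 : x₀ - c = -((r ^ 2 / δ) • a) := by rw [hc]; abel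
    rw [e1, e2, norm_neg, norm_sub_sq_real, h2, inner_smul_right, real_inner_comm]
    have : r ^ 2 / δ * δ < r ^ 2 / δ * inner ℝ a (z - x₀) :=
      mul_lt_mul_of_pos_left h1 (by positivity)
    rw [div_mul_cancel₀ _ hδ.ne'] at this
    nlinarith [sq_nonneg r]
  obtain ⟨x, ⟨hxT, hxr⟩, hmax⟩ := ((isCompact_closedBall x₀ r).inter_left hT).exists_isMaxOn
    ⟨x₀, hx.1, mem_closedBall_self hr0.le⟩
    (f := fun z => dist z c) (by fun_prop)
  have hge : dist x₀ c ≤ dist x c := hmax ⟨hx.1, mem_closedBall_self hr0.le⟩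
  have hxb : x ∈ ball x₀ r := by
    refine mem_ball.2 (lt_of_le_of_ne hxr fun h => ?_)
    exact absurd (hlt x ⟨hxT, h⟩) hge.not_gt
  refine ⟨c, x, hxT, ?_, ?_⟩
  · intro h
    rw [h, dist_self] at hge
    exact ((hlt y ⟨hy, rfl⟩).trans_le hge).not_ge dist_nonneg
  · filter_upwards [isOpen_ball.mem_nhds hxb] with z hz hzT
    exact hmax ⟨hzT, ball_subset_closedBall hz⟩

namespace SF
variable {E : Type*} [NormedAddCommGroup E] [InnerProductSpace ℝ E]
variable {M : SF X E} [Nonempty X] [Fact (2 ≤ Module.finrank ℝ E)]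

lemma exists_ne (M : SF X E) {K : Set X} (hi : (interior K).Nonempty) (x : X) : ∃ y ∈ K, y ≠ x := by
  obtain ⟨z, hz⟩ := hi
  by_cases h : z = x
  · obtain ⟨v, hv⟩ := M.exists_UT z
    have := ((M.tendsto_exp_zero hv).eventually (isOpen_interior.mem_nhds hz)).and
      M.eventually_sn_pos
    obtain ⟨t, h1, h2⟩ := this.exists
    refine ⟨_, interior_subset h1, fun he => ?_⟩
    have := M.b_exp_sub hv hv.tan t
    rw [he, h, sub_self, M.b_zero_left, hv.unit] at this
    linarith
  · exact ⟨z, interior_subset hz, h⟩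

lemma frontier_of_local_ball {K : Set X} {x c : X} (hx : x ∈ K) (h0 : x ≠ c)
    (h1 : M.k = 1 → dist x c < Real.pi / 2)
    (hloc : ∀ᶠ z in nhds x, z ∈ K → dist z c ≤ dist x c) : x ∈ frontier K := by
  refine frontier_of_mem hx fun hi => ?_
  have hpos : 0 < dist c x := dist_pos.2 h0.symm
  rw [dist_comm x c] at hloc h1
  obtain ⟨v, hv, hy⟩ := M.exists_log c x
  have hex : M.exp c v (dist c x) = x := M.injective (by rw [M.M_exp hv, hy])
  have ht : Tendsto (M.exp c v) (nhdsWithin (dist c x) (Ioi (dist c x))) (nhds x) := by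
    conv => rhs; rw [← hex]
    exact ((M.continuous_exp hv).tendsto _).mono_left nhdsWithin_le_nhds
  have hev := (ht.eventually hloc).and ((ht.eventually (mem_interior_iff_mem_nhds.1 hi)).and
    (self_mem_nhdsWithin (a := dist c x) (s := Ioi (dist c x))))
  have hπ : ∀ᶠ t in nhdsWithin (dist c x) (Ioi (dist c x)), M.k = 1 → t ≤ Real.pi := by
    by_cases hk : M.k = 1
    · have := h1 hk
      have hp := Real.pi_pos
      filter_upwards [mem_nhdsWithin_of_mem_nhds (Iio_mem_nhds (by linarith : dist c x < Real.pi))]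
        with t ht _ using (le_of_lt ht)
    · exact Eventually.of_forall fun t h => absurd h hk
  obtain ⟨t, ⟨a, b, d⟩, e⟩ := (hev.and hπ).exists
  have := a b
  rw [dist_comm, M.dist_exp hv (hpos.le.trans (le_of_lt d)) e] at this
  exact absurd this (not_le.2 d)

lemma SC_of_local_ball {K : Set X} {x c : X} {n : E × ℝ} (hn : M.IsNormal K x n) (h0 : x ≠ c)
    (h1 : M.k = 1 → dist x c < Real.pi / 2)
    (hloc : ∀ᶠ z in nhds x, z ∈ K → dist z c ≤ dist x c) : M.SC K x n := by
  have hpos : 0 < dist x c := dist_pos.2 h0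
  have hpi : M.k = 1 → dist x c < Real.pi := fun h => by linarith [h1 h, Real.pi_pos]
  obtain ⟨v, hv, hy⟩ := M.exists_log x c
  have hex : M.exp x v (dist x c) = c := M.injective (by rw [M.M_exp hv, hy])
  have hκ : 0 < cs M.k (dist x c) / sn M.k (dist x c) :=
    div_pos (cs_pos M.hk hpos.le h1) (sn_pos M.hk hpos hpi)
  have hD : ∀ᶠ z in nhds x, z ∈ K → z ∈ M.D (cs M.k (dist x c) / sn M.k (dist x c)) x v := by
    filter_upwards [hloc] with z hz hzK
    rw [← M.dist_exp_le_iff hv hpos hpi, hex]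
    exact hz hzK
  obtain ⟨κ, -, hκ'⟩ := hn.inner
  have : n = v := M.normal_unique_of_subset hn.ut hv hκ' (by
    filter_upwards [hD] with z hz hzK using M.D_anti hκ.le x v (hz hzK))
  subst this
  exact ⟨_, hκ, hD⟩

lemma isometry_fst (hk : M.k = 0) : Isometry fun x => (M x).1 := by
  refine Isometry.of_dist_eq fun x y => ?_
  have := M.hd x y
  rw [hk, vs, sn_null, zero_mul, add_zero, real_inner_self_eq_norm_sq, Prod.fst_sub] at this
  rw [dist_eq_norm]
  exact (pow_left_inj₀ (norm_nonneg _) dist_nonneg two_ne_zero).1 (by linarith)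

lemma surjective_fst (hk : M.k = 0) : Function.Surjective fun x => (M x).1 := by
  intro w
  obtain ⟨x, hx⟩ := (M.mem (w, 1)).2 (by simp [hk])
  exact ⟨x, congrArg Prod.fst hx⟩

lemma exists_SC_of_extreme (hk : M.k = 0) {K : Set X} (clK : IsClosed K) (cvK : GConvex K)
    (inK : (interior K).Nonempty) (bK : CondBallInside K) (hE : HasExtremePoint K) :
    ∃ x n, M.IsNormal K x n ∧ M.SC K x n := by
  have : FiniteDimensional ℝ E := finiteDimensional_of_fact
  have hiso := isometry_fst hk
  let e : X ≃ᵢ E := ⟨Equiv.ofBijective _ ⟨hiso.injective, surjective_fst hk⟩, hiso⟩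
  have he : ∀ x, e x = (M x).1 := fun _ => rfl
  obtain ⟨x₀, hx₀, hext⟩ := hE
  obtain ⟨y, hy, hne⟩ := M.exists_ne inK x₀
  have hcv : Convex ℝ (e '' K) := by
    rintro _ ⟨u, hu, rfl⟩ _ ⟨w, hw, rfl⟩ a c ha hc hac
    obtain ⟨z, hz⟩ := e.surjective (a • e u + c • e w)
    refine ⟨z, M.mem_of_combo cvK hu hw ha hc one_pos ?_, hz⟩
    rw [one_smul]
    refine Prod.ext hz.symm ?_
    simp only [Prod.snd_add, Prod.smul_snd, M.snd_one hk, smul_eq_mul, mul_one, hac]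
  have hx₀e : e x₀ ∈ (e '' K).extremePoints ℝ := by
    refine mem_extremePoints_iff_left.2 ⟨mem_image_of_mem _ hx₀, ?_⟩
    rintro _ ⟨u, hu, rfl⟩ _ ⟨w, hw, rfl⟩ hseg
    have hb := dist_add_dist_of_mem_segment (openSegment_subset_segment ℝ _ _ hseg)
    rw [e.dist_eq, e.dist_eq, e.dist_eq] at hb
    rcases hext u hu w hw hb with rfl | rfl
    · rfl
    · exact right_mem_openSegment_iff.1 hseg
  obtain ⟨c, _, ⟨x, hx, rfl⟩, hxc, hloc⟩ := exists_local_farthest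
    (e.toHomeomorph.isClosed_image.2 clK) hcv hx₀e (mem_image_of_mem e hy) (e.injective.ne hne)
  obtain ⟨c, rfl⟩ := e.surjective c
  have hloc' : ∀ᶠ z in nhds x, z ∈ K → dist z c ≤ dist x c := by
    filter_upwards [e.continuous.continuousAt.eventually hloc] with z hz hzK
    rw [← e.dist_eq z c, ← e.dist_eq x c]
    exact hz (mem_image_of_mem e hzK)
  have hxc' : x ≠ c := fun h => hxc (congrArg e h)
  have h1 : M.k = 1 → dist x c < Real.pi / 2 := fun h => by rw [hk] at h; norm_num at h
  obtain ⟨n, hn⟩ := M.exists_normal cvK bK (frontier_of_local_ball hx hxc' h1 hloc')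
  exact ⟨x, n, hn, SC_of_local_ball hn hxc' h1 hloc'⟩

lemma pair_of_extreme (hk : M.k = 0) {K L : Set X} (clK : IsClosed K) (clL : IsClosed L)
    (cvK : GConvex K) (cvL : GConvex L) (inK : (interior K).Nonempty) (inL : (interior L).Nonempty)
    (prK : K ≠ univ) (prL : L ≠ univ) (bK : CondBallInside K) (bL : CondBallInside L)
    (hE : HasExtremePoint K ∨ HasExtremePoint L) (h3 : T6Cond3 K L) : M.Pair K L := by
  have hk' : M.k ≠ -1 := by rw [hk]; norm_num
  rcases hE with hE | hE
  · obtain ⟨x, n, hn, hs⟩ := exists_SC_of_extreme hk clK cvK inK bK hE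
    exact Pair.of_one clK clL cvK cvL inK inL (M.frontier_nonempty inL prL) bK bL h3 hk' hn hs
  · obtain ⟨x, n, hn, hs⟩ := exists_SC_of_extreme hk clL cvL inL bL hE
    exact Pair.symm (Pair.of_one clL clK cvL cvK inL inK (M.frontier_nonempty inK prK) bL bK h3.symm hk'
      hn hs)

end SF

namespace SF
variable {E : Type*} [NormedAddCommGroup E] [InnerProductSpace ℝ E]
variable {M : SF X E} [Nonempty X] [Fact (2 ≤ Module.finrank ℝ E)]

lemma compactSpace (hk : M.k = 1) : CompactSpace X := by
  have : FiniteDimensional ℝ E := finiteDimensional_of_fact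
  refine ⟨M.isInducing.isCompact_iff.2 ?_⟩
  rw [image_univ]
  have hr : range M = {w | M.q w w = 1} := by
    ext w
    refine ⟨?_, fun hw => M.exists_pt hw fun h => by rw [hk] at h; norm_num at h⟩
    rintro ⟨x, rfl⟩
    exact M.q_self x
  refine Metric.isCompact_of_isClosed_isBounded ?_ ?_
  · rw [hr]
    exact isClosed_eq (M.continuous_q continuous_id continuous_id) continuous_const
  · refine (isBounded_iff_forall_norm_le (s := range M)).2 ⟨1, ?_⟩
    rintro _ ⟨x, rfl⟩
    have h1 := norm_sq_le (M x)
    have h2 := M.q_self x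
    rw [q, hk] at h2
    nlinarith [norm_nonneg (M x)]

lemma exists_q_pos (hk : M.k = 1) {K : Set X} (clK : IsClosed K) (cvK : GConvex K)
    (hK : ∀ u ∈ K, ∀ u' ∈ K, M u' ≠ -M u) : ∃ p, ∀ z ∈ K, 0 < M.q (M z) p := by
  have : FiniteDimensional ℝ E := finiteDimensional_of_fact
  have := compactSpace hk
  set C : Set (E × ℝ) := {w | ∃ s : ℝ, 0 < s ∧ ∃ z ∈ K, w = s • M z} with hC
  have hC0 : (0 : E × ℝ) ∉ C := by
    rintro ⟨s, hs, z, -, hz⟩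
    have := M.q_self z
    rw [(smul_eq_zero.1 hz.symm).resolve_left hs.ne', M.q_zero_left] at this
    norm_num at this
  have hconv : Convex ℝ C := by
    rintro _ ⟨s, hs, z, hz, rfl⟩ _ ⟨s', hs', z', hz', rfl⟩ a c ha hc hac
    rw [smul_smul, smul_smul]
    rcases ha.eq_or_lt with rfl | ha
    · rw [zero_add] at hac
      subst hac
      exact ⟨s', hs', z', hz', by simp⟩
    rcases hc.eq_or_lt with rfl | hc
    · rw [add_zero] at hac
      subst hac
      exact ⟨s, hs, z, hz, by simp⟩
    have hA : 0 < a * s := mul_pos ha hs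
    have hB : 0 < c * s' := mul_pos hc hs'
    have hne : (a * s) • M z + (c * s') • M z' ≠ 0 := by
      intro h
      have h1 : (c * s') • M z' = -((a * s) • M z) := by
        rw [eq_neg_iff_add_eq_zero, add_comm, h]
      have h2 : (c * s') * (c * s') = (a * s) * (a * s) := by
        have := congrArg (fun w => M.q w w) h1
        simpa only [M.q_smul_left, M.q_smul_right, M.q_neg_left, M.q_neg_right, M.q_self, mul_one,
          mul_neg, neg_neg] using this
      have h3 : c * s' = a * s := (mul_self_inj hB.le hA.le).1 h2
      rw [h3, ← smul_neg] at h1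
      exact hK z hz z' hz' (smul_right_injective _ hA.ne' h1)
    have hOm := M.combo_Om hA.le hB.le hne
    have hq := M.smul_nrm hOm
    have hpos : 0 < √(M.q ((a * s) • M z + (c * s') • M z') ((a * s) • M z + (c * s') • M z')) := by
      refine (Real.sqrt_nonneg _).lt_of_ne fun h => hne ?_
      rw [← hq, ← h, zero_smul]
    exact ⟨_, hpos, _, M.mem_of_combo cvK hz hz' hA.le hB.le hpos hq.symm, hq.symm⟩
  have hcomp : IsCompact (M '' K) := clK.isCompact.image M.continuous
  have h0 : (0 : E × ℝ) ∉ convexHull ℝ (M '' K) := fun h => hC0 <| convexHull_min (by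
    rintro _ ⟨z, hz, rfl⟩
    exact ⟨1, one_pos, z, hz, (one_smul _ _).symm⟩) hconv h
  obtain ⟨f, u, h1, h2⟩ := geometric_hahn_banach_point_closed (convex_convexHull ℝ (M '' K))
    (isCompact_convexHull hcomp).isClosed h0
  rw [map_zero] at h1
  refine ⟨((InnerProductSpace.toDual ℝ E).symm (f.comp (ContinuousLinearMap.inl ℝ E ℝ)), f (0, 1)),
    fun z hz => ?_⟩
  have h3 := h1.trans (h2 _ (subset_convexHull ℝ _ (mem_image_of_mem M hz)))
  have h4 : M z = ((M z).1, (0 : ℝ)) + (M z).2 • ((0 : E), (1 : ℝ)) := by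
    refine Prod.ext ?_ ?_ <;> simp
  rw [q, hk, one_mul, real_inner_comm, InnerProductSpace.toDual_symm_apply]
  rw [h4, map_add, map_smul, smul_eq_mul] at h3
  simp only [ContinuousLinearMap.comp_apply, ContinuousLinearMap.inl_apply]
  linarith

lemma exists_SC_of_no_antipodal (hk : M.k = 1) {K : Set X} (clK : IsClosed K) (cvK : GConvex K)
    (inK : (interior K).Nonempty) (bK : CondBallInside K)
    (hK : ∀ u ∈ K, ∀ u' ∈ K, M u' ≠ -M u) : ∃ x n, M.IsNormal K x n ∧ M.SC K x n := by
  obtain ⟨p, hp⟩ := exists_q_pos hk clK cvK hK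
  have := compactSpace hk
  obtain ⟨y₀, hy₀⟩ := inK
  have hp0 : p ≠ 0 := by
    rintro rfl
    have := hp y₀ (interior_subset hy₀)
    rw [M.q_zero_right] at this
    exact this.false
  have hOm := (M.mem_Om_one hk).2 hp0
  have hlt : ∀ z ∈ K, dist z (M.nrm p) < Real.pi / 2 := by
    intro z hz
    have hq := hp z hz
    rw [← M.smul_nrm hOm, M.q_smul_right] at hq
    have hq' := lt_of_mul_lt_mul_left ((mul_zero _).trans_lt hq) (Real.sqrt_nonneg _)
    have hπ := Real.pi_pos
    rw [M.dist_lt_iff (by positivity) fun _ => by linarith]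
    have h1 := M.k_mul_h z (M.nrm p)
    have h2 := mul_vs M.hk (Real.pi / 2)
    rw [hk] at h1 h2 ⊢
    rw [cs_one, Real.cos_pi_div_two] at h2
    linarith
  obtain ⟨y, hy, hne⟩ := M.exists_ne ⟨y₀, hy₀⟩ (M.nrm p)
  obtain ⟨x, hx, hmax⟩ := clK.isCompact.exists_isMaxOn ⟨y, hy⟩
    (f := fun z => dist z (M.nrm p)) (by fun_prop)
  have hxc : x ≠ M.nrm p := fun h => by
    have : dist y (M.nrm p) ≤ dist x (M.nrm p) := hmax hy
    rw [h, dist_self] at this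
    exact (dist_pos.2 hne).not_ge this
  have hloc : ∀ᶠ z in nhds x, z ∈ K → dist z (M.nrm p) ≤ dist x (M.nrm p) :=
    Eventually.of_forall fun z hz => hmax hz
  obtain ⟨n, hn⟩ := M.exists_normal cvK bK 
    (frontier_of_local_ball (M := M) hx hxc (fun _ => hlt x hx) hloc)
  exact ⟨x, n, hn, SC_of_local_ball hn hxc (fun _ => hlt x hx) hloc⟩

lemma exp_mem_of_antipodal (hk : M.k = 1) {K : Set X} (cvK : GConvex K) {u u' : X} (hu : u ∈ K)
    (hu' : u' ∈ K) (ha : M u' = -M u) {v : E × ℝ} (hv : M.UT u v) {t s : ℝ} (ht0 : 0 < t)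
    (ht : t < Real.pi) (hK : M.exp u v t ∈ K) (hs0 : 0 ≤ s) (hs : s ≤ Real.pi) :
    M.exp u v s ∈ K := by
  have hst : 0 < sn M.k t := sn_pos M.hk ht0 fun _ => ht
  rcases le_total s t with h | h
  · refine M.mem_of_combo cvK hu hK ?_ ?_ hst (M.sn_smul_exp hv t s)
    · rw [hk, sn_one]
      exact Real.sin_nonneg_of_nonneg_of_le_pi (by linarith) (by linarith)
    · rw [hk, sn_one]
      exact Real.sin_nonneg_of_nonneg_of_le_pi hs0 hs
  · refine M.mem_of_combo cvK hu' hK (a := sn M.k (s - t)) (c := sn M.k s) ?_ ?_ hst ?_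
    · rw [hk, sn_one]
      exact Real.sin_nonneg_of_nonneg_of_le_pi (by linarith) (by linarith)
    · rw [hk, sn_one]
      exact Real.sin_nonneg_of_nonneg_of_le_pi hs0 hs
    · have := M.sn_smul_exp hv t s
      rw [← this, ha, ← neg_sub t s, sn_neg M.hk, neg_smul_neg]

lemma exists_eq_D_of_antipodal (hk : M.k = 1) {K : Set X} (clK : IsClosed K) (cvK : GConvex K)
    (prK : K ≠ univ) (bK : CondBallInside K) {u u' : X} (hu : u ∈ K) (hu' : u' ∈ K)
    (ha : M u' = -M u) : ∃ x n, M.UT x n ∧ K = M.D 0 x n := by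
  have hπ := Real.pi_pos
  have key : ∀ v, M.UT u v → (∀ᶠ t in nhdsWithin (0 : ℝ) (Ioi 0), M.exp u v t ∈ K) →
      ∀ s, 0 ≤ s → s ≤ Real.pi → M.exp u v s ∈ K := by
    intro v hv hev s h0 h1
    have h2 : ∀ᶠ t in nhdsWithin (0 : ℝ) (Ioi 0), 0 < t ∧ t < Real.pi :=
      Ioo_mem_nhdsGT hπ
    obtain ⟨t, ht, ht0, ht1⟩ := (hev.and h2).exists
    exact exp_mem_of_antipodal hk cvK hu hu' ha hv ht0 ht1 ht h0 h1
  have hlog : ∀ z, ∃ v, M.UT u v ∧ z = M.exp u v (dist u z) := fun z => by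
    obtain ⟨v, hv, hz⟩ := M.exists_log u z
    exact ⟨v, hv, M.injective (by rw [M.M_exp hv, hz])⟩
  have hfr : u ∈ frontier K := by
    refine frontier_of_mem hu fun hi => prK (eq_univ_of_forall fun z => ?_)
    obtain ⟨v, hv, hz⟩ := hlog z
    rw [hz]
    exact key v hv ((M.tendsto_exp_zero hv).eventually (mem_interior_iff_mem_nhds.1 hi)) _
      dist_nonneg (M.hpi hk u z)
  obtain ⟨n, hn⟩ := M.exists_normal cvK bK hfr
  obtain ⟨κ, -, hκ⟩ := hn.inner
  have hin : ∀ z, 0 < M.b (M z - M u) n → z ∈ K := by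
    intro z hb
    obtain ⟨v, hv, hz⟩ := hlog z
    rw [hz, M.b_exp_sub hv hn.ut.tan] at hb
    have h1 : 0 ≤ sn M.k (dist u z) := by
      rw [hk, sn_one]
      exact Real.sin_nonneg_of_nonneg_of_le_pi dist_nonneg (M.hpi hk u z)
    have h2 := lt_of_mul_lt_mul_left ((mul_zero _).trans_lt hb) h1
    rw [hz]
    refine key v hv ?_ _ dist_nonneg (M.hpi hk u z)
    filter_upwards [M.eventually_exp_mem_D hv hn.ut h2 κ] with t ht using hκ (interior_subset ht)
  refine ⟨u, n, hn.ut, hn.sup.antisymm fun z hz => ?_⟩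
  rw [M.mem_D_zero] at hz
  rcases hz.eq_or_lt with h0 | h0
  · have hz' : z ∈ M.bdD 0 u n := by rw [M.mem_bdD, zero_mul, h0]
    have hUT := M.recentre_UT hn.ut hz'
    rw [zero_smul, sub_zero] at hUT
    refine clK.mem_of_tendsto (M.tendsto_exp_zero hUT) ?_
    filter_upwards [M.eventually_sn_pos] with t ht
    refine hin _ ?_
    have h1 := M.b_exp_sub hUT hUT.tan t
    rw [hUT.unit, mul_one, M.b_sub_left] at h1
    rw [M.b_sub_left] at h0 ⊢
    linarith
  · exact hin z h0

lemma isPreconnected_bdD_zero {x : X} {n : E × ℝ} (hn : M.UT x n) :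
    IsPreconnected (M.bdD 0 x n) := by
  refine isPreconnected_of_forall x fun y hy => ?_
  rw [mem_bdD, zero_mul] at hy
  obtain ⟨v, hv, hvn, hyv⟩ : ∃ v, M.UT x v ∧ M.b v n = 0 ∧ M.exp x v (dist x y) = y := by
    obtain ⟨v, hv, hz⟩ := M.exists_log x y
    have hyv : M.exp x v (dist x y) = y := M.injective (by rw [M.M_exp hv, hz])
    rw [← hyv, M.b_exp_sub hv hn.tan, eq_comm, mul_eq_zero] at hy
    rcases hy with h0 | h0
    · obtain ⟨w, hw, hwn⟩ := M.exists_UT_orth x n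
      exact ⟨w, hw, hwn, M.injective (by rw [M.M_exp hw, hz, h0, zero_smul, zero_smul])⟩
    · exact ⟨v, hv, h0, hyv⟩
  refine ⟨range (M.exp x v), ?_, ⟨0, M.exp_zero x v⟩, ⟨_, hyv⟩,
    isPreconnected_range (M.continuous_exp hv)⟩
  rintro _ ⟨t, rfl⟩
  rw [mem_bdD, zero_mul, M.b_exp_sub hv hn.tan, hvn, mul_zero]

lemma concl_of_hemispheres (hk : M.k = 1) {x y : X} {n m : E × ℝ} (hn : M.UT x n) (hm : M.UT y m)
    (d : ℕ) : T6Cond4 d (M.D 0 x n) (M.D 0 y m) := by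
  have hπ := Real.pi_pos
  have hκ : cs M.k (Real.pi / 2) / sn M.k (Real.pi / 2) = 0 := by
    rw [hk, cs_one, Real.cos_pi_div_two, zero_div]
  have h0 : 0 < Real.pi / 2 := by positivity
  have h1 : M.k = 1 → Real.pi / 2 < Real.pi := fun _ => by linarith
  have hball : ∀ {z w}, M.UT z w → M.D 0 z w = closedBall (M.exp z w (Real.pi / 2)) (Real.pi / 2) :=
    fun hw => by rw [M.closedBall_eq_D hw h0 h1, hκ]
  have hcomp : ∀ {z w}, M.UT z w → ∀ C ∈ bdryComponents (M.D 0 z w),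
      C = sphere (M.exp z w (Real.pi / 2)) (Real.pi / 2) := by
    rintro z w hw _ ⟨p, hp, rfl⟩
    rw [frontier_D le_rfl hw] at hp ⊢
    rw [← bdD_eq_sphere hw h0 h1, hκ]
    exact (isPreconnected_bdD_zero hw).connectedComponentIn hp
  refine Or.inl ⟨Real.pi / 2, h0, fun _ => le_rfl, ?_, ⟨_, hball hn⟩, ⟨_, hball hm⟩⟩
  rintro C (hC | hC)
  · exact ⟨_, hcomp hn C hC⟩
  · exact ⟨_, hcomp hm C hC⟩

lemma concl_of_sphere (hk : M.k = 1) {K L : Set X} (clK : IsClosed K) (clL : IsClosed L)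
    (cvK : GConvex K) (cvL : GConvex L) (inK : (interior K).Nonempty) (inL : (interior L).Nonempty)
    (prK : K ≠ univ) (prL : L ≠ univ) (bK : CondBallInside K) (bL : CondBallInside L)
    (h3 : T6Cond3 K L) (d : ℕ) : T6Cond4 d K L := by
  have hk' : M.k ≠ -1 := by rw [hk]; norm_num
  by_cases hK : ∀ u ∈ K, ∀ u' ∈ K, M u' ≠ -M u
  · obtain ⟨x, n, hn, hs⟩ := exists_SC_of_no_antipodal hk clK cvK inK bK hK
    exact Pair.concl (Pair.of_one clK clL cvK cvL inK inL (M.frontier_nonempty inL prL) bK bL h3 hk'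
      hn hs) d
  by_cases hL : ∀ u ∈ L, ∀ u' ∈ L, M u' ≠ -M u
  · obtain ⟨x, n, hn, hs⟩ := exists_SC_of_no_antipodal hk clL cvL inL bL hL
    exact Pair.concl (Pair.symm (Pair.of_one clL clK cvL cvK inL inK (M.frontier_nonempty inK prK)
      bL bK h3.symm hk' hn hs)) d
  push Not at hK hL
  obtain ⟨u, hu, u', hu', ha⟩ := hK
  obtain ⟨w, hw, w', hw', hb⟩ := hL
  obtain ⟨x, n, hn, rfl⟩ := exists_eq_D_of_antipodal hk clK cvK prK bK hu hu' ha
  obtain ⟨y, m, hm, rfl⟩ := exists_eq_D_of_antipodal hk clL cvL prL bL hw hw' hb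
  exact concl_of_hemispheres hk hn hm d

end SF

lemma exists_SF_of_euclidean {d : ℕ} (h : IsEuclideanSpaceForm X d) :
    ∃ M : SF X (EuclideanSpace ℝ (Fin d)), M.k = 0 := by
  obtain ⟨e⟩ := h
  refine ⟨⟨0, fun x => (e x, 1), Or.inr (Or.inl rfl), fun w => ⟨?_, fun hw => ?_⟩, fun x y => ?_,
    fun h => by norm_num at h⟩, rfl⟩
  · rintro ⟨x, rfl⟩
    simp
  · obtain ⟨x, hx⟩ := e.surjective w.1
    refine ⟨x, Prod.ext hx ?_⟩
    have h0 := hw.2 le_rfl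
    have h1 := hw.1
    simp only
    nlinarith
  · rw [vs, sn_null, Prod.fst_sub, real_inner_self_eq_norm_sq, ← dist_eq_norm, e.dist_eq]
    ring

lemma exists_SF_of_hyperbolic {d : ℕ} (h : IsHyperbolicSpace X d) :
    ∃ M : SF X (EuclideanSpace ℝ (Fin d)), M.k = -1 := by
  obtain ⟨e, -, hr, hd⟩ := h
  have hm : ∀ w, (∃ x, e x = w) ↔ mink d w w = -1 ∧ 0 < w.2 := fun w => by
    rw [← mem_range, hr]
    rfl
  refine ⟨⟨-1, e, Or.inr (Or.inr rfl), fun w => ?_, fun x y => ?_, fun h => by norm_num at h⟩, rfl⟩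
  · rw [hm, mink]
    constructor
    · rintro ⟨h1, h2⟩
      exact ⟨by linarith, fun _ => h2⟩
    · rintro ⟨h1, h2⟩
      exact ⟨by linarith, h2 (by norm_num)⟩
  · have h1 := mul_vs (k := -1) (Or.inr (Or.inr rfl)) (dist x y)
    rw [cs_neg_one, hd, mink] at h1
    have hx := ((hm _).1 ⟨x, rfl⟩).1
    have hy := ((hm _).1 ⟨y, rfl⟩).1
    rw [mink] at hx hy
    simp only [Prod.fst_sub, Prod.snd_sub, inner_sub_left, inner_sub_right]
    rw [real_inner_comm (e x).1 (e y).1]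
    linarith

lemma exists_SF_of_sphere {d : ℕ} (h : IsSphereSpace X d) :
    ∃ M : SF X (EuclideanSpace ℝ (Fin d)), M.k = 1 := by
  obtain ⟨e, -, hr, hd⟩ := h
  set g : EuclideanSpace ℝ (Fin (d + 1)) → EuclideanSpace ℝ (Fin d) × ℝ :=
    fun u => (WithLp.toLp 2 fun i => u i.succ, u 0) with hg
  have hgi : ∀ u v, (inner ℝ u v : ℝ) = inner ℝ (g u).1 (g v).1 + (g u).2 * (g v).2 := fun u v => by
    simp only [hg, PiLp.inner_apply, Fin.sum_univ_succ, RCLike.inner_apply, conj_trivial]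
    ring
  have hgs : Function.Surjective g := fun w =>
    ⟨WithLp.toLp 2 (Fin.cons w.2 w.1.ofLp), by simp [hg]⟩
  have hm : ∀ w, (∃ x, e x = w) ↔ (inner ℝ w w : ℝ) = 1 := fun w => by
    rw [← mem_range, hr, mem_sphere_zero_iff_norm, real_inner_self_eq_norm_sq]
    exact (pow_eq_one_iff_of_nonneg (norm_nonneg _) two_ne_zero).symm
  refine ⟨⟨1, fun x => g (e x), Or.inl rfl, fun w => ⟨?_, fun hw => ?_⟩, fun x y => ?_,
    fun _ x y => ?_⟩, rfl⟩
  · rintro ⟨x, rfl⟩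
    have := (hm _).1 ⟨x, rfl⟩
    rw [hgi] at this
    exact ⟨by linarith, fun h => by norm_num at h⟩
  · obtain ⟨u, rfl⟩ := hgs w
    obtain ⟨x, rfl⟩ := (hm u).2 (by rw [hgi]; linarith [hw.1])
    exact ⟨x, rfl⟩
  · have h1 := mul_vs (k := 1) (Or.inl rfl) (dist x y)
    have hx := (hm _).1 ⟨x, rfl⟩
    have hy := (hm _).1 ⟨y, rfl⟩
    have hle := abs_le.1 (abs_real_inner_le_norm (e x) (e y))
    have hnx : ‖e x‖ = 1 := by
      rw [real_inner_self_eq_norm_sq] at hx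
      exact (pow_eq_one_iff_of_nonneg (norm_nonneg _) two_ne_zero).1 hx
    have hny : ‖e y‖ = 1 := by
      rw [real_inner_self_eq_norm_sq] at hy
      exact (pow_eq_one_iff_of_nonneg (norm_nonneg _) two_ne_zero).1 hy
    rw [hnx, hny, mul_one] at hle
    rw [cs_one, hd, Real.cos_arccos hle.1 hle.2, hgi] at h1
    rw [hgi] at hx hy
    rw [hd, hgi]
    simp only [Prod.fst_sub, Prod.snd_sub, inner_sub_left, inner_sub_right]
    rw [real_inner_comm (g (e x)).1 (g (e y)).1]
    linarith
  · rw [hd]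
    exact Real.arccos_le_pi _

lemma fact_finrank {d : ℕ} (hd : 2 ≤ d) :
    Fact (2 ≤ Module.finrank ℝ (EuclideanSpace ℝ (Fin d))) :=
  ⟨by rwa [finrank_euclideanSpace_fin]⟩

/-- **Lemma 6.3** ((3) ⟹ (4) in Theorem 6). Under the hypotheses of Theorem 6,
condition (3) (symmetry with respect to the orthogonal bisector hyperplane of
`[φx, ψy]` for all small intersections satisfying (A), (B), (C)) implies condition
(4): the connected components of the boundaries of `K` and `L` are congruent spheres
(for `S^d` of radius at most `π/2`), paraspheres, or congruent hyperspheres, with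
`K`, `L` congruent balls, resp. paraballs, in the first two cases. -/
theorem lemma6_3
    (d : ℕ) (hd : 2 ≤ d)
    (X : Type*) [MetricSpace X] (hX : IsSpaceForm X d)
    (K L : Set X)
    (hKcl : IsClosed K) (hLcl : IsClosed L)
    (hKcv : GConvex K) (hLcv : GConvex L)
    (hKint : (interior K).Nonempty) (hLint : (interior L).Nonempty)
    (hKpr : K ≠ univ) (hLpr : L ≠ univ)
    (hKss : CondBallInside K) (hLss : CondBallInside L)
    (hext : IsEuclideanSpaceForm X d → HasExtremePoint K ∨ HasExtremePoint L)
    (hKsss : IsHyperbolicSpace X d → CondCurvBound d K)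
    (hLsss : IsHyperbolicSpace X d → CondCurvBound d L)
    (h3 : T6Cond3 K L) :
    T6Cond4 d K L := by
  have : Nonempty X := hKint.to_type
  have := fact_finrank hd
  rcases hX with hS | hE | hH
  · obtain ⟨M, hk⟩ := exists_SF_of_sphere hS
    exact SF.concl_of_sphere hk hKcl hLcl hKcv hLcv hKint hLint hKpr hLpr hKss hLss h3 d
  · obtain ⟨M, hk⟩ := exists_SF_of_euclidean hE
    exact (SF.pair_of_extreme hk hKcl hLcl hKcv hLcv hKint hLint hKpr hLpr hKss hLss (hext hE)
      h3).concl d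
  · obtain ⟨M, hk⟩ := exists_SF_of_hyperbolic hH
    exact (SF.pair_of_hyperbolic hk hH hKcl hLcl hKcv hLcv hKint hLint hKpr hLpr hKss hLss
      (hKsss hH) (hLsss hH) h3).concl d

end BallChar
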